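/- Let t₀ < 0, p > 1, and f(t) = ((t − t₀)⁺)^p (the positive part raised to the power p). For each λ < 0 let u_λ be a classical solution of (P_f^λ) on Ω. Let v : Ω → (0, ∞) be twice continuously differentiable with Δv(x) = v(x)^p for every x ∈ Ω and v(x) → +∞ as x → ∂Ω (i.e. for every M > 0 there is a compact set K ⊂ Ω with v ≥ M on Ω∖K). Then (−λ)^{1/(p−1)} (u_λ − t₀) → v uniformly on every compact subset of Ω as λ → −∞. -/

import Mathlib

open Set MeasureTheory Filter Topology

/-- The Laplacian of `u` at `x`: the trace of the Hessian of `u`. -/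
noncomputable def laplacian {N : ℕ} (u : EuclideanSpace ℝ (Fin N) → ℝ)
    (x : EuclideanSpace ℝ (Fin N)) : ℝ :=
  ∑ i : Fin N, iteratedFDeriv ℝ 2 u x ![EuclideanSpace.single i 1, EuclideanSpace.single i 1]

/-- A classical solution of the problem `(P_f^λ)` on `Ω`:
`u` is continuous on the closure of `Ω`, twice continuously differentiable on `Ω`,
satisfies `-Δ u = λ f(u)` in `Ω` and `u = 0` on `∂ Ω`. -/
def IsClassicalSolution {N : ℕ} (Ω : Set (EuclideanSpace ℝ (Fin N))) (lam : ℝ)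
    (f : ℝ → ℝ) (u : EuclideanSpace ℝ (Fin N) → ℝ) : Prop :=
  ContinuousOn u (closure Ω) ∧ ContDiffOn ℝ 2 u Ω ∧
    (∀ x ∈ Ω, -laplacian u x = lam * f (u x)) ∧
    (∀ x ∈ frontier Ω, u x = 0)

/-- Condition (1.2): `f` is continuous, non-decreasing, non-negative and `f 0 > 0`. -/
def Cond12 (f : ℝ → ℝ) : Prop :=
  Continuous f ∧ Monotone f ∧ (∀ t, 0 ≤ f t) ∧ 0 < f 0

open Set MeasureTheory Filter Topology

set_option linter.unusedSectionVars false

section basics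
open scoped Laplacian

variable {F : Type*} [NormedAddCommGroup F] [InnerProductSpace ℝ F] [FiniteDimensional ℝ F]

/-- Scalar product of the gradients of `f` and `g`. -/
noncomputable def gdot (f g : F → ℝ) (x : F) : ℝ :=
  ∑ i, fderiv ℝ f x (stdOrthonormalBasis ℝ F i) * fderiv ℝ g x (stdOrthonormalBasis ℝ F i)

lemma lap_eq_sum_fderiv (f : F → ℝ) (x : F) :
    Δ f x = ∑ i, fderiv ℝ (fderiv ℝ f) x (stdOrthonormalBasis ℝ F i)
      (stdOrthonormalBasis ℝ F i) := by
  rw [InnerProductSpace.laplacian_eq_iteratedFDeriv_stdOrthonormalBasis]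
  refine Finset.sum_congr rfl fun i _ => ?_
  rw [iteratedFDeriv_two_apply]
  simp

lemma fderiv_fderiv_apply {f : F → ℝ} {x : F} (hf : ContDiffAt ℝ 2 f x) (e e' : F) :
    fderiv ℝ (fun y => fderiv ℝ f y e) x e' = fderiv ℝ (fderiv ℝ f) x e' e := by
  have hfd : DifferentiableAt ℝ (fderiv ℝ f) x :=
    (hf.fderiv_right (m := 1) (by norm_num)).differentiableAt (by norm_num)
  rw [fderiv_clm_apply hfd (differentiableAt_const e)]
  simp

lemma lap_eq_sum {f : F → ℝ} {x : F} (hf : ContDiffAt ℝ 2 f x) :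
    Δ f x = ∑ i, fderiv ℝ (fun y => fderiv ℝ f y (stdOrthonormalBasis ℝ F i)) x
      (stdOrthonormalBasis ℝ F i) := by
  rw [lap_eq_sum_fderiv]
  exact Finset.sum_congr rfl fun i _ => (fderiv_fderiv_apply hf _ _).symm

lemma cd2_eventually_diff {f : F → ℝ} {x : F} (hf : ContDiffAt ℝ 2 f x) :
    ∀ᶠ y in 𝓝 x, DifferentiableAt ℝ f y :=
  (hf.eventually (by simp)).mono fun _ hy => hy.differentiableAt (by norm_num)

lemma cd2_diff_fderiv_apply {f : F → ℝ} {x : F} (hf : ContDiffAt ℝ 2 f x) (e : F) :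
    DifferentiableAt ℝ (fun y => fderiv ℝ f y e) x :=
  ((hf.fderiv_right (m := 1) (by norm_num)).differentiableAt (by norm_num)).clm_apply
    (differentiableAt_const e)

lemma lap_mul {f g : F → ℝ} {x : F} (hf : ContDiffAt ℝ 2 f x) (hg : ContDiffAt ℝ 2 g x) :
    Δ (fun y => f y * g y) x = f x * Δ g x + g x * Δ f x + 2 * gdot f g x := by
  rw [lap_eq_sum (hf.mul hg), lap_eq_sum hf, lap_eq_sum hg, gdot, Finset.mul_sum, Finset.mul_sum,
    Finset.mul_sum, ← Finset.sum_add_distrib, ← Finset.sum_add_distrib]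
  refine Finset.sum_congr rfl fun i _ => ?_
  set e := stdOrthonormalBasis ℝ F i
  have h1 : (fun y => fderiv ℝ (fun y => f y * g y) y e) =ᶠ[𝓝 x]
      fun y => f y * fderiv ℝ g y e + g y * fderiv ℝ f y e := by
    filter_upwards [cd2_eventually_diff hf, cd2_eventually_diff hg] with y h1 h2
    rw [fderiv_fun_mul h1 h2]; simp
  have hfd := hf.differentiableAt (by norm_num)
  have hgd := hg.differentiableAt (by norm_num)
  rw [h1.fderiv_eq, fderiv_fun_add (hfd.fun_mul (cd2_diff_fderiv_apply hg e))
    (hgd.fun_mul (cd2_diff_fderiv_apply hf e)), fderiv_fun_mul hfd (cd2_diff_fderiv_apply hg e),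
    fderiv_fun_mul hgd (cd2_diff_fderiv_apply hf e)]
  simp
  ring

lemma lap_comp {f : F → ℝ} {h h' h'' : ℝ → ℝ} {x : F} (hf : ContDiffAt ℝ 2 f x)
    (hh : ContDiffAt ℝ 2 h (f x)) (h1 : ∀ᶠ t in 𝓝 (f x), HasDerivAt h (h' t) t)
    (h2 : HasDerivAt h' (h'' (f x)) (f x)) :
    Δ (fun y => h (f y)) x = h' (f x) * Δ f x + h'' (f x) * gdot f f x := by
  have hc : ContDiffAt ℝ 2 (fun y => h (f y)) x := hh.comp x hf
  rw [lap_eq_sum hc, lap_eq_sum hf, gdot, Finset.mul_sum, Finset.mul_sum,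
    ← Finset.sum_add_distrib]
  refine Finset.sum_congr rfl fun i _ => ?_
  set e := stdOrthonormalBasis ℝ F i
  have hfc : Tendsto f (𝓝 x) (𝓝 (f x)) := hf.continuousAt
  have h3 : (fun y => fderiv ℝ (fun y => h (f y)) y e) =ᶠ[𝓝 x]
      fun y => h' (f y) * fderiv ℝ f y e := by
    filter_upwards [cd2_eventually_diff hf, hfc.eventually h1] with y h4 h5
    have := (h5.comp_hasFDerivAt y h4.hasFDerivAt).fderiv
    have h6 : fderiv ℝ (fun y => h (f y)) y = h' (f y) • fderiv ℝ f y := this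
    rw [h6]; simp
  have hfd := hf.differentiableAt (by norm_num)
  have h7 := h2.comp_hasFDerivAt x hfd.hasFDerivAt
  have h8 : HasFDerivAt (fun y => h' (f y)) (h'' (f x) • fderiv ℝ f x) x := h7
  rw [h3.fderiv_eq, fderiv_fun_mul h8.differentiableAt (cd2_diff_fderiv_apply hf e), h8.fderiv]
  simp
  ring

lemma gdot_self (f : F → ℝ) (x : F) : gdot f f x = ‖fderiv ℝ f x‖ ^ 2 := by
  have h := (stdOrthonormalBasis ℝ F).sum_sq_norm_inner_right
    ((InnerProductSpace.toDual ℝ F).symm (fderiv ℝ f x))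
  rw [LinearIsometryEquiv.norm_map] at h
  rw [← h, gdot]
  refine Finset.sum_congr rfl fun i _ => ?_
  rw [real_inner_comm, InnerProductSpace.toDual_symm_apply, Real.norm_eq_abs, sq_abs, sq]

lemma gdot_self_nonneg (f : F → ℝ) (x : F) : 0 ≤ gdot f f x := by
  rw [gdot_self]; positivity

/-- At an interior local maximum of a `C²` function the Laplacian is nonpositive. -/
lemma lap_nonpos_of_isLocalMax {u : F → ℝ} {x : F}
    (hu : ContDiffAt ℝ 2 u x) (hmax : IsLocalMax u x) : Δ u x ≤ 0 := by
  rw [lap_eq_sum_fderiv]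
  apply Finset.sum_nonpos
  intro i _
  set e : F := stdOrthonormalBasis ℝ F i
  by_contra! hpos
  let L : ℝ → F := fun t => x + t • e
  have hL : ∀ t, HasDerivAt L e t := fun t => by
    simpa [L] using ((hasDerivAt_id t).smul_const e).const_add x
  have hL0 : L 0 = x := by simp [L]
  have hLc : ContinuousAt L 0 := (hL 0).continuousAt
  have hdiff : ∀ᶠ y in 𝓝 x, DifferentiableAt ℝ u y := cd2_eventually_diff hu
  have hLt : Tendsto L (𝓝 0) (𝓝 x) := by simpa [ContinuousAt, hL0] using hLc
  have hd1 : ∀ᶠ t in 𝓝 (0:ℝ), deriv (u ∘ L) t = fderiv ℝ u (L t) e := by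
    filter_upwards [hLt.eventually hdiff] with t ht
    exact (ht.hasFDerivAt.comp_hasDerivAt t (hL t)).deriv
  have hfd : DifferentiableAt ℝ (fderiv ℝ u) x :=
    (hu.fderiv_right (m := 1) (by norm_num)).differentiableAt (by norm_num)
  have hd2 : HasDerivAt (fun t => fderiv ℝ u (L t) e) (fderiv ℝ (fderiv ℝ u) x e e) 0 := by
    have h1 : HasDerivAt (fun t => fderiv ℝ u (L t)) (fderiv ℝ (fderiv ℝ u) x e) 0 := by
      have h2 : HasFDerivAt (fderiv ℝ u) (fderiv ℝ (fderiv ℝ u) x) (L 0) := by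
        rw [hL0]; exact hfd.hasFDerivAt
      exact h2.comp_hasDerivAt 0 (hL 0)
    simpa using h1.clm_apply (hasDerivAt_const (0:ℝ) e)
  have hdd : deriv (deriv (u ∘ L)) 0 = fderiv ℝ (fderiv ℝ u) x e e := by
    rw [Filter.EventuallyEq.deriv_eq hd1, hd2.deriv]
  have hmaxL : IsLocalMax (u ∘ L) 0 := by
    have := hLt.eventually hmax
    simpa [IsLocalMax, IsMaxFilter, hL0] using this
  have hcont : ContinuousAt (u ∘ L) 0 := by
    apply ContinuousAt.comp _ hLc
    rw [hL0]; exact hu.continuousAt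
  have hmin : IsLocalMin (u ∘ L) 0 :=
    isLocalMin_of_deriv_deriv_pos (by rw [hdd]; exact hpos) hmaxL.deriv_eq_zero hcont
  have hconst : (u ∘ L) =ᶠ[𝓝 0] fun _ => (u ∘ L) 0 := by
    filter_upwards [hmin, hmaxL] with t h1 h2
    exact le_antisymm h2 h1
  have h0 : deriv (u ∘ L) =ᶠ[𝓝 0] fun _ => 0 := by
    filter_upwards [hconst.eventuallyEq_nhds] with t ht
    rw [ht.deriv_eq]; simp
  rw [h0.deriv_eq] at hdd
  simp at hdd
  linarith

lemma lap_add {f g : F → ℝ} {x : F} (hf : ContDiffAt ℝ 2 f x) (hg : ContDiffAt ℝ 2 g x) :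
    Δ (fun y => f y + g y) x = Δ f x + Δ g x := hf.laplacian_add hg

lemma lap_sub {f g : F → ℝ} {x : F} (hf : ContDiffAt ℝ 2 f x) (hg : ContDiffAt ℝ 2 g x) :
    Δ (fun y => f y - g y) x = Δ f x - Δ g x := hf.laplacian_sub hg

lemma lap_const_mul {f : F → ℝ} {x : F} (a : ℝ) (hf : ContDiffAt ℝ 2 f x) :
    Δ (fun y => a * f y) x = a * Δ f x := InnerProductSpace.laplacian_smul a hf

lemma lap_const (a : ℝ) (x : F) : Δ (fun _ : F => a) x = 0 := by
  rw [InnerProductSpace.laplacian_const]; rfl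

lemma fderiv_normsq (x e : F) : fderiv ℝ (fun y : F => ‖y‖ ^ 2) x e = 2 * inner ℝ x e := by
  rw [fderiv_norm_sq_apply]; simp

lemma lap_normsq (x : F) : Δ (fun y : F => ‖y‖ ^ 2) x = 2 * Module.finrank ℝ F := by
  rw [lap_eq_sum (contDiff_norm_sq ℝ).contDiffAt]
  have : ∀ i, fderiv ℝ (fun y => fderiv ℝ (fun y : F => ‖y‖ ^ 2) y (stdOrthonormalBasis ℝ F i)) x
      (stdOrthonormalBasis ℝ F i) = 2 := fun i => by
    have h1 : (fun y => fderiv ℝ (fun y : F => ‖y‖ ^ 2) y (stdOrthonormalBasis ℝ F i))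
      = fun y => 2 * (innerSL ℝ (stdOrthonormalBasis ℝ F i)) y := by
      ext y; rw [fderiv_normsq, innerSL_apply_apply, real_inner_comm]
    rw [h1, fderiv_const_mul (by fun_prop), ContinuousLinearMap.fderiv]
    simp
  rw [Finset.sum_congr rfl fun i _ => this i]
  simp [mul_comm]

/-- Weak maximum principle. -/
lemma max_principle {D : Set F} (hDo : IsOpen D) (hDb : Bornology.IsBounded D)
    (hF : 0 < Module.finrank ℝ F) {z : F → ℝ}
    (hzc : ContinuousOn z (closure D)) (hzd : ContDiffOn ℝ 2 z D)
    (hbd : ∀ x ∈ frontier D, z x ≤ 0) (hsub : ∀ x ∈ D, 0 < z x → 0 ≤ Δ z x) :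
    ∀ x ∈ D, z x ≤ 0 := by
  by_contra! hcon
  obtain ⟨x₁, hx₁, hlt⟩ := hcon
  obtain ⟨R, hR0, hR⟩ := hDb.closure.exists_pos_norm_le
  set δ := z x₁ / (2 * R ^ 2) with hδ
  have hδ0 : 0 < δ := by positivity
  have hδR : δ * R ^ 2 = z x₁ / 2 := by rw [hδ]; field_simp
  set y : F → ℝ := fun x => z x + δ * ‖x‖ ^ 2 with hy
  have hyc : ContinuousOn y (closure D) := hzc.add (by fun_prop)
  obtain ⟨x, hxc, hxm⟩ := hDb.isCompact_closure.exists_isMaxOn ⟨x₁, subset_closure hx₁⟩ hyc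
  have hnx : ‖x‖ ^ 2 ≤ R ^ 2 := by
    have := hR x hxc; gcongr
  have h1 : y x₁ ≤ y x := hxm (subset_closure hx₁)
  have hzx : 0 < z x := by
    have h2 : δ * ‖x‖ ^ 2 ≤ δ * R ^ 2 := by gcongr
    have h3 : 0 ≤ δ * ‖x₁‖ ^ 2 := by positivity
    simp only [hy] at h1
    linarith
  have hxD : x ∈ D := by
    by_contra h
    have := hbd x (by rw [hDo.frontier_eq]; exact ⟨hxc, h⟩)
    linarith
  have hz2 := hzd.contDiffAt (hDo.mem_nhds hxD)
  have hn2 : ContDiffAt ℝ 2 (fun x : F => ‖x‖ ^ 2) x := (contDiff_norm_sq ℝ).contDiffAt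
  have hloc : IsLocalMax y x := by
    filter_upwards [hDo.mem_nhds hxD] with a ha
    exact hxm (subset_closure ha)
  have hle := lap_nonpos_of_isLocalMax (hz2.add (contDiffAt_const.mul hn2)) hloc
  rw [lap_add hz2 (contDiffAt_const.mul hn2), lap_const_mul δ hn2, lap_normsq] at hle
  have := hsub x hxD hzx
  have h4 : (0:ℝ) < Module.finrank ℝ F := by exact_mod_cast hF
  have h5 : 0 < δ * (2 * Module.finrank ℝ F) := by positivity
  linarith

end basics

open Set MeasureTheory Filter Topology
set_option linter.unusedSectionVars false

section ibp
open scoped Laplacian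

variable {F : Type*} [NormedAddCommGroup F] [InnerProductSpace ℝ F] [FiniteDimensional ℝ F]
  [MeasurableSpace F] [BorelSpace F]

lemma integrable_of_supp {f : F → ℝ} {K : Set F} (hK : IsCompact K) (hf : ContinuousOn f K)
    (h0 : ∀ x ∉ K, f x = 0) : Integrable f := by
  rw [← integrableOn_iff_integrable_of_support_subset (s := K)]
  · exact hf.integrableOn_compact hK
  · intro x hx
    by_contra h
    exact hx (h0 x h)

lemma cd2_of_supp {D K : Set F} (hD : IsOpen D) (hK : IsClosed K) (hKD : K ⊆ D) {φ : F → ℝ}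
    (hφ : ContDiffOn ℝ 2 φ D) (h0 : ∀ x ∉ K, φ x = 0) : ContDiff ℝ 2 φ := by
  rw [contDiff_iff_contDiffAt]
  intro x
  by_cases hx : x ∈ K
  · exact hφ.contDiffAt (hD.mem_nhds (hKD hx))
  · have : φ =ᶠ[𝓝 x] fun _ => 0 := by
      filter_upwards [hK.isOpen_compl.mem_nhds hx] with y hy using h0 y hy
    exact contDiffAt_const.congr_of_eventuallyEq this

lemma fderiv_zero_of_supp {K : Set F} (hK : IsClosed K) {φ : F → ℝ}
    (h0 : ∀ x ∉ K, φ x = 0) : ∀ x ∉ K, fderiv ℝ φ x = 0 := fun x hx => by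
  have : φ =ᶠ[𝓝 x] fun _ => 0 := by
    filter_upwards [hK.isOpen_compl.mem_nhds hx] with y hy using h0 y hy
  rw [this.fderiv_eq]; simp

lemma lap_zero_of_supp {K : Set F} (hK : IsClosed K) {φ : F → ℝ}
    (h0 : ∀ x ∉ K, φ x = 0) : ∀ x ∉ K, Δ φ x = 0 := fun x hx => by
  have : φ =ᶠ[𝓝 x] fun _ => 0 := by
    filter_upwards [hK.isOpen_compl.mem_nhds hx] with y hy using h0 y hy
  rw [InnerProductSpace.laplacian_congr_nhds this |>.self_of_nhds, lap_const]

lemma tsupport_sub_of_supp {K : Set F} (hK : IsClosed K) {φ : F → ℝ}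
    (h0 : ∀ x ∉ K, φ x = 0) : tsupport φ ⊆ K :=
  closure_minimal (fun x hx => by by_contra h; exact hx (h0 x h)) hK

lemma cdOn_fderiv_apply {D : Set F} (hD : IsOpen D) {u : F → ℝ} (hu : ContDiffOn ℝ 2 u D) (e : F) :
    ContDiffOn ℝ 1 (fun y => fderiv ℝ u y e) D :=
  (hu.fderiv_of_isOpen hD (by norm_num)).clm_apply contDiffOn_const

lemma lap_continuousOn {D : Set F} (hD : IsOpen D) {u : F → ℝ} (hu : ContDiffOn ℝ 2 u D) :
    ContinuousOn (fun x => Δ u x) D := by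
  have h : ∀ x ∈ D, Δ u x = ∑ i, fderiv ℝ (fun y => fderiv ℝ u y (stdOrthonormalBasis ℝ F i)) x
      (stdOrthonormalBasis ℝ F i) := fun x hx => lap_eq_sum (hu.contDiffAt (hD.mem_nhds hx))
  refine ContinuousOn.congr ?_ h
  refine continuousOn_finsetSum _ fun i _ => ?_
  exact ((cdOn_fderiv_apply hD hu _).fderiv_of_isOpen hD (m := 0) (by norm_num)).continuousOn.clm_apply
    continuousOn_const

/-- Green's identity. -/
lemma green_ibp {D K : Set F} (hD : IsOpen D) (hK : IsCompact K) (hKD : K ⊆ D) {φ u : F → ℝ}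
    (hφ : ContDiffOn ℝ 2 φ D) (h0 : ∀ x ∉ K, φ x = 0) (hu : ContDiffOn ℝ 2 u D) :
    ∫ x, u x * Δ φ x = ∫ x, φ x * Δ u x := by
  have hφ2 := cd2_of_supp hD hK.isClosed hKD hφ h0
  have hf0 := fderiv_zero_of_supp hK.isClosed h0
  have hDe0 : ∀ e : F, ∀ x ∉ K, (fun y => fderiv ℝ φ y e) x = 0 := fun e x hx => by
    simp [hf0 x hx]
  have key : ∀ e : F, ∫ x, u x * fderiv ℝ (fun y => fderiv ℝ φ y e) x e
      = ∫ x, fderiv ℝ (fun y => fderiv ℝ u y e) x e * φ x := fun e => by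
    have hue := cdOn_fderiv_apply hD hu e
    have hφe := cdOn_fderiv_apply hD hφ e
    have hff0 := fderiv_zero_of_supp hK.isClosed (hDe0 e)
    have cu := hu.continuousOn.mono hKD
    have cφ := hφ.continuousOn.mono hKD
    have cue := hue.continuousOn.mono hKD
    have cφe := hφe.continuousOn.mono hKD
    have cuee : ContinuousOn (fun x => fderiv ℝ (fun y => fderiv ℝ u y e) x e) K :=
      ((hue.fderiv_of_isOpen hD (m := 0) (by norm_num)).continuousOn.clm_apply
        continuousOn_const).mono hKD
    have cφee : ContinuousOn (fun x => fderiv ℝ (fun y => fderiv ℝ φ y e) x e) K :=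
      ((hφe.fderiv_of_isOpen hD (m := 0) (by norm_num)).continuousOn.clm_apply
        continuousOn_const).mono hKD
    have hdφe : ∀ x, DifferentiableAt ℝ (fun y => fderiv ℝ φ y e) x := fun x =>
      cd2_diff_fderiv_apply hφ2.contDiffAt e
    rw [integral_mul_fderiv_eq_neg_fderiv_mul_of_integrable (f := u)
      (g := fun y => fderiv ℝ φ y e) (v := e),
      integral_mul_fderiv_eq_neg_fderiv_mul_of_integrable (f := fun y => fderiv ℝ u y e)
      (g := φ) (v := e), neg_neg]
    · exact integrable_of_supp hK (cuee.mul cφ) fun x hx => by simp [h0 x hx]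
    · exact integrable_of_supp hK (cue.mul cφe) fun x hx => by simp [hf0 x hx]
    · exact integrable_of_supp hK (cue.mul cφ) fun x hx => by simp [h0 x hx]
    · intro x hx
      have hx' := hKD (tsupport_sub_of_supp hK.isClosed h0 hx)
      exact (hue.contDiffAt (hD.mem_nhds hx')).differentiableAt (by norm_num)
    · intro x _
      exact hφ2.contDiffAt.differentiableAt (by norm_num)
    · exact integrable_of_supp hK (cue.mul cφe) fun x hx => by simp [hf0 x hx]
    · exact integrable_of_supp hK (cu.mul cφee) fun x hx => by simp [hff0 x hx]
    · exact integrable_of_supp hK (cu.mul cφe) fun x hx => by simp [hf0 x hx]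
    · intro x hx
      have hx' := hKD (tsupport_sub_of_supp hK.isClosed (hDe0 e) hx)
      exact (hu.contDiffAt (hD.mem_nhds hx')).differentiableAt (by norm_num)
    · intro x _
      exact hdφe x
  have hI1 : ∀ i, Integrable (fun x => u x * fderiv ℝ (fun y => fderiv ℝ φ y
      (stdOrthonormalBasis ℝ F i)) x (stdOrthonormalBasis ℝ F i)) := fun i => by
    set e := stdOrthonormalBasis ℝ F i
    refine integrable_of_supp hK ((hu.continuousOn.mono hKD).mul
      ((((cdOn_fderiv_apply hD hφ e).fderiv_of_isOpen hD (m := 0) (by norm_num)).continuousOn.clm_apply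
        continuousOn_const).mono hKD)) fun x hx => ?_
    simp [fderiv_zero_of_supp hK.isClosed (hDe0 e) x hx]
  have hI2 : ∀ i, Integrable (fun x => fderiv ℝ (fun y => fderiv ℝ u y
      (stdOrthonormalBasis ℝ F i)) x (stdOrthonormalBasis ℝ F i) * φ x) := fun i => by
    set e := stdOrthonormalBasis ℝ F i
    refine integrable_of_supp hK (((((cdOn_fderiv_apply hD hu e).fderiv_of_isOpen hD (m := 0)
      (by norm_num)).continuousOn.clm_apply continuousOn_const).mono hKD).mul
      (hφ.continuousOn.mono hKD)) fun x hx => ?_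
    simp [h0 x hx]
  have e1 : ∀ x, u x * Δ φ x = ∑ i, u x * fderiv ℝ (fun y => fderiv ℝ φ y
      (stdOrthonormalBasis ℝ F i)) x (stdOrthonormalBasis ℝ F i) := fun x => by
    rw [lap_eq_sum hφ2.contDiffAt, Finset.mul_sum]
  have e2 : ∀ x, φ x * Δ u x = ∑ i, fderiv ℝ (fun y => fderiv ℝ u y
      (stdOrthonormalBasis ℝ F i)) x (stdOrthonormalBasis ℝ F i) * φ x := fun x => by
    by_cases hx : x ∈ K
    · rw [lap_eq_sum (hu.contDiffAt (hD.mem_nhds (hKD hx))), mul_comm, Finset.sum_mul]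
    · simp [h0 x hx]
  simp_rw [e1, e2]
  rw [integral_finsetSum _ fun i _ => hI1 i, integral_finsetSum _ fun i _ => hI2 i]
  exact Finset.sum_congr rfl fun i _ => key _

end ibp

section pospow

/-- `(t⁺)^(k+1)` has derivative `(k+1) (t⁺)^k` for `k ≥ 1`. -/
lemma hasDerivAt_pospow (k : ℕ) (hk : 1 ≤ k) (t : ℝ) :
    HasDerivAt (fun s : ℝ => (max s 0) ^ (k+1)) ((k+1) * (max t 0) ^ k) t := by
  rcases lt_trichotomy t 0 with h | h | h
  · have h1 : (fun s : ℝ => (max s 0) ^ (k+1)) =ᶠ[𝓝 t] fun _ => 0 := by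
      filter_upwards [gt_mem_nhds h] with s hs
      rw [max_eq_right hs.le]; simp
    rw [max_eq_right h.le, zero_pow (by omega), mul_zero]
    exact (hasDerivAt_const t (0:ℝ)).congr_of_eventuallyEq h1
  · subst h
    rw [max_self, zero_pow (by omega), mul_zero, hasDerivAt_iff_isLittleO]
    simp only [max_self, ne_eq, Nat.add_eq_zero_iff, one_ne_zero, and_false, not_false_eq_true,
      zero_pow, sub_zero, smul_eq_mul, mul_zero]
    have h2 : (fun s : ℝ => (max s 0) ^ (k+1)) =O[𝓝 0] fun s => s ^ (k+1) := by
      refine Asymptotics.IsBigO.of_bound 1 (Eventually.of_forall fun s => ?_)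
      rw [one_mul, norm_pow, norm_pow]
      gcongr
      rw [Real.norm_eq_abs, Real.norm_eq_abs, abs_of_nonneg (le_max_right _ _)]
      exact max_le (le_abs_self s) (abs_nonneg s)
    refine h2.trans_isLittleO ?_
    have h3 := Asymptotics.isLittleO_pow_pow (𝕜 := ℝ) (show 1 < k + 1 by omega)
    simpa using h3
  · have h1 : (fun s : ℝ => (max s 0) ^ (k+1)) =ᶠ[𝓝 t] fun s => s ^ (k+1) := by
      filter_upwards [lt_mem_nhds h] with s hs
      rw [max_eq_left hs.le]
    rw [max_eq_left h.le]
    refine HasDerivAt.congr_of_eventuallyEq ?_ h1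
    simpa using hasDerivAt_pow (k+1) t

lemma contDiff_pospow (k : ℕ) (hk : 3 ≤ k) : ContDiff ℝ 2 (fun s : ℝ => (max s 0) ^ k) := by
  obtain ⟨j, rfl⟩ : ∃ j, k = j + 3 := ⟨k - 3, by omega⟩
  have h1 : deriv (fun s : ℝ => (max s 0) ^ (j+3)) = fun s : ℝ => (((j+2:ℕ):ℝ)+1) * (max s 0) ^ (j+2) :=
    funext fun t => (hasDerivAt_pospow (j+2) (by omega) t).deriv
  have h2 : deriv (fun s : ℝ => (max s 0) ^ (j+2)) = fun s : ℝ => (((j+1:ℕ):ℝ)+1) * (max s 0) ^ (j+1) :=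
    funext fun t => (hasDerivAt_pospow (j+1) (by omega) t).deriv
  have c1 : ContDiff ℝ 1 (fun s : ℝ => (max s 0) ^ (j+2)) := by
    rw [contDiff_one_iff_deriv]
    refine ⟨fun t => (hasDerivAt_pospow (j+1) (by omega) t).differentiableAt, ?_⟩
    rw [h2]; fun_prop
  rw [show (2 : WithTop ℕ∞) = 1 + 1 by norm_num, contDiff_succ_iff_deriv]
  refine ⟨fun t => (hasDerivAt_pospow (j+2) (by omega) t).differentiableAt, by simp, ?_⟩
  rw [h1]
  exact contDiff_const.mul c1

end pospow

open Set MeasureTheory Filter Topology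

set_option linter.unusedSectionVars false

section kernel
open scoped Laplacian Pointwise

variable {F : Type*} [NormedAddCommGroup F] [InnerProductSpace ℝ F] [FiniteDimensional ℝ F]
  [MeasurableSpace F] [BorelSpace F]

/-- regularised power of the norm -/
noncomputable def rp (ε s : ℝ) (x : F) : ℝ := (‖x‖ ^ 2 + ε ^ 2) ^ s

lemma rp_base_pos {ε : ℝ} (hε : 0 < ε) (x : F) : 0 < ‖x‖ ^ 2 + ε ^ 2 := by positivity

lemma rp_pos {ε : ℝ} (hε : 0 < ε) (s : ℝ) (x : F) : 0 < rp ε s x :=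
  Real.rpow_pos_of_pos (rp_base_pos hε x) s

lemma rp_contDiff {ε : ℝ} (hε : 0 < ε) (s : ℝ) {n : WithTop ℕ∞} :
    ContDiff ℝ n (rp ε s : F → ℝ) := by
  unfold rp
  exact ((contDiff_norm_sq ℝ).add contDiff_const).rpow_const_of_ne
    (fun x => (rp_base_pos hε x).ne')

lemma rp_continuous {ε : ℝ} (hε : 0 < ε) (s : ℝ) : Continuous (rp ε s : F → ℝ) :=
  (rp_contDiff hε s (n := 0)).continuous

lemma rp_aux {ε : ℝ} (_hε : 0 < ε) (s t : ℝ) (ht : -ε^2 < t) :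
    HasDerivAt (fun t : ℝ => (t + ε ^ 2) ^ s) (s * (t + ε ^ 2) ^ (s - 1)) t := by
  have h1 : HasDerivAt (fun t : ℝ => t + ε ^ 2) 1 t := (hasDerivAt_id t).add_const _
  have := h1.rpow_const (p := s) (Or.inl (by linarith))
  convert this using 1; ring

lemma rp_lap {ε : ℝ} (hε : 0 < ε) (s : ℝ) (x : F) :
    Δ (rp ε s : F → ℝ) x = s * (‖x‖ ^ 2 + ε ^ 2) ^ (s - 1) * (2 * Module.finrank ℝ F)
      + s * ((s - 1) * (‖x‖ ^ 2 + ε ^ 2) ^ (s - 1 - 1)) * (4 * ‖x‖ ^ 2) := by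
  have hx : -ε^2 < ‖x‖ ^ 2 := by nlinarith [sq_nonneg ‖x‖, pow_pos hε 2]
  have hev : ∀ᶠ t in 𝓝 (‖x‖ ^ 2), -ε^2 < t := lt_mem_nhds hx
  have h := lap_comp (f := fun y : F => ‖y‖ ^ 2) (h := fun t => (t + ε ^ 2) ^ s)
    (h' := fun t => s * (t + ε ^ 2) ^ (s - 1))
    (h'' := fun t => s * ((s - 1) * (t + ε ^ 2) ^ (s - 1 - 1))) (x := x)
    (contDiff_norm_sq ℝ).contDiffAt
    (by
      apply ContDiffAt.rpow_const_of_ne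
      · fun_prop
      · have := rp_base_pos hε x; exact this.ne')
    (hev.mono fun t ht => rp_aux hε s t ht)
    ((rp_aux hε (s - 1) _ hx).const_mul s)
  have h3 : gdot (fun y : F => ‖y‖ ^ 2) (fun y : F => ‖y‖ ^ 2) x = 4 * ‖x‖ ^ 2 := by
    have := (stdOrthonormalBasis ℝ F).sum_sq_norm_inner_left x
    simp only [gdot, fderiv_normsq, ← this, Finset.mul_sum]
    refine Finset.sum_congr rfl fun i _ => ?_
    rw [Real.norm_eq_abs, sq_abs]; ring
  rw [lap_normsq, h3] at h
  exact h

lemma rp_norm_fderiv {ε : ℝ} (hε : 0 < ε) (s : ℝ) (x : F) :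
    ‖fderiv ℝ (rp ε s : F → ℝ) x‖ ≤ |s| * (‖x‖ ^ 2 + ε ^ 2) ^ (s - 1) * (2 * ‖x‖) := by
  have hx : -ε^2 < ‖x‖ ^ 2 := by nlinarith [sq_nonneg ‖x‖, pow_pos hε 2]
  have h1 : HasFDerivAt (fun y : F => ‖y‖ ^ 2) (fderiv ℝ (fun y : F => ‖y‖ ^ 2) x) x :=
    ((contDiff_norm_sq ℝ (n := 1)).differentiable (by norm_num) x).hasFDerivAt
  have h2 := (rp_aux hε s _ hx).comp_hasFDerivAt x h1
  have h3 : fderiv ℝ (rp ε s : F → ℝ) x = (s * (‖x‖ ^ 2 + ε ^ 2) ^ (s - 1)) •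
      fderiv ℝ (fun y : F => ‖y‖ ^ 2) x := h2.fderiv
  rw [h3, norm_smul, norm_mul, Real.norm_eq_abs, Real.norm_eq_abs,
    abs_of_pos (Real.rpow_pos_of_pos (rp_base_pos hε x) _)]
  gcongr
  · refine ContinuousLinearMap.opNorm_le_bound _ (by positivity) fun e => ?_
    rw [fderiv_normsq, norm_mul, Real.norm_eq_abs, abs_two, mul_assoc]
    gcongr
    exact norm_inner_le_norm x e

/-- regularised Newton kernel -/
noncomputable def Gam (ε : ℝ) (x : F) : ℝ := rp ε (-((Module.finrank ℝ F : ℝ) - 2) / 2) x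

/-- minus the Laplacian of `Gam` -/
noncomputable def bet (ε : ℝ) (x : F) : ℝ :=
  (Module.finrank ℝ F : ℝ) * ((Module.finrank ℝ F : ℝ) - 2) * ε ^ 2 *
    rp ε (-((Module.finrank ℝ F : ℝ) + 2) / 2) x

lemma Gam_pos {ε : ℝ} (hε : 0 < ε) (x : F) : 0 < Gam ε x := rp_pos hε _ x

lemma Gam_contDiff {ε : ℝ} (hε : 0 < ε) {n : WithTop ℕ∞} : ContDiff ℝ n (Gam ε : F → ℝ) :=
  rp_contDiff hε _

lemma Gam_continuous {ε : ℝ} (hε : 0 < ε) : Continuous (Gam ε : F → ℝ) := rp_continuous hε _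

lemma bet_continuous {ε : ℝ} (hε : 0 < ε) : Continuous (bet ε : F → ℝ) :=
  continuous_const.mul (rp_continuous hε _)

lemma bet_nonneg (hM : 3 ≤ Module.finrank ℝ F) {ε : ℝ} (hε : 0 < ε) (x : F) : 0 ≤ bet ε x := by
  have : (3:ℝ) ≤ Module.finrank ℝ F := by exact_mod_cast hM
  have h2 := (rp_pos hε (-((Module.finrank ℝ F : ℝ) + 2) / 2) x).le
  have : 0 ≤ (Module.finrank ℝ F : ℝ) - 2 := by linarith
  unfold bet; positivity

lemma bet_pos (hM : 3 ≤ Module.finrank ℝ F) {ε : ℝ} (hε : 0 < ε) (x : F) : 0 < bet ε x := by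
  have : (3:ℝ) ≤ Module.finrank ℝ F := by exact_mod_cast hM
  have h2 := (rp_pos hε (-((Module.finrank ℝ F : ℝ) + 2) / 2) x)
  have : 0 < (Module.finrank ℝ F : ℝ) - 2 := by linarith
  have : 0 < (Module.finrank ℝ F : ℝ) := by linarith
  unfold bet; positivity

lemma Gam_lap {ε : ℝ} (hε : 0 < ε) (x : F) : Δ (Gam ε : F → ℝ) x = - bet ε x := by
  have h := rp_lap hε (-((Module.finrank ℝ F : ℝ) - 2) / 2) x
  have hA := rp_base_pos hε x
  unfold bet
  change Δ (rp ε (-((Module.finrank ℝ F : ℝ) - 2) / 2) : F → ℝ) x = _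
  rw [h]
  have e1 : (‖x‖ ^ 2 + ε ^ 2) ^ (-((Module.finrank ℝ F : ℝ) - 2) / 2 - 1) =
      (‖x‖ ^ 2 + ε ^ 2) ^ (-((Module.finrank ℝ F : ℝ) + 2) / 2) * (‖x‖ ^ 2 + ε ^ 2) := by
    rw [← Real.rpow_add_one hA.ne']; congr 1; ring
  have e2 : (‖x‖ ^ 2 + ε ^ 2) ^ (-((Module.finrank ℝ F : ℝ) - 2) / 2 - 1 - 1) =
      (‖x‖ ^ 2 + ε ^ 2) ^ (-((Module.finrank ℝ F : ℝ) + 2) / 2) := by congr 1; ring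
  rw [e1, e2, rp]
  ring

lemma Gam_norm_fderiv (hM : 3 ≤ Module.finrank ℝ F) {ε : ℝ} (hε : 0 < ε) (x : F) :
    ‖fderiv ℝ (Gam ε : F → ℝ) x‖ ≤
      ((Module.finrank ℝ F : ℝ) - 2) * rp ε (-(Module.finrank ℝ F : ℝ) / 2) x * ‖x‖ := by
  have : (3:ℝ) ≤ Module.finrank ℝ F := by exact_mod_cast hM
  have h := rp_norm_fderiv hε (-((Module.finrank ℝ F : ℝ) - 2) / 2) x
  refine h.trans (le_of_eq ?_)
  rw [abs_of_nonpos (by linarith), rp,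
    show -((Module.finrank ℝ F : ℝ) - 2) / 2 - 1 = -(Module.finrank ℝ F : ℝ) / 2 by ring]
  ring

/-! potentials -/

lemma pot_hasFDerivAt {V : Type*} [NormedAddCommGroup V] [NormedSpace ℝ V] [CompleteSpace V]
    {g : F → V} (hg : ContDiff ℝ 1 g) (ν : Measure F) [IsFiniteMeasure ν] {E : Set F}
    (hE : IsCompact E) (hν : ν Eᶜ = 0) (x : F) :
    HasFDerivAt (fun x => ∫ y, g (x - y) ∂ν) (∫ y, fderiv ℝ g (x - y) ∂ν) x := by
  have hgc := hg.continuous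
  have hfc : Continuous (fderiv ℝ g) := hg.continuous_fderiv (by norm_num)
  have hae : ∀ᵐ y ∂ν, y ∈ E := by rw [ae_iff]; exact hν
  have hK : IsCompact ((fun q : F × F => q.1 - q.2) '' (Metric.closedBall x 1 ×ˢ E)) :=
    ((isCompact_closedBall x 1).prod hE).image (continuous_fst.sub continuous_snd)
  obtain ⟨C, hC⟩ := hK.exists_bound_of_continuousOn hfc.continuousOn
  obtain ⟨C', hC'⟩ := hK.exists_bound_of_continuousOn hgc.continuousOn
  refine hasFDerivAt_integral_of_dominated_of_fderiv_le (bound := fun _ => C)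
    (F' := fun x y => fderiv ℝ g (x - y)) (Metric.closedBall_mem_nhds x one_pos) ?_ ?_ ?_ ?_ ?_ ?_
  · exact Eventually.of_forall fun x =>
      (hgc.comp (continuous_const.sub continuous_id)).aestronglyMeasurable
  · refine Integrable.of_bound (C := C')
      (hgc.comp (continuous_const.sub continuous_id)).aestronglyMeasurable ?_
    filter_upwards [hae] with y hy
    exact hC' _ ⟨(x, y), ⟨Metric.mem_closedBall_self zero_le_one, hy⟩, rfl⟩
  · exact (hfc.comp (continuous_const.sub continuous_id)).aestronglyMeasurable
  · filter_upwards [hae] with y hy z hz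
    exact hC _ ⟨(z, y), ⟨hz, hy⟩, rfl⟩
  · exact integrable_const _
  · refine Eventually.of_forall fun y z _ => ?_
    have h1 := (hg.differentiable (by norm_num) (z - y)).hasFDerivAt
    have h2 : HasFDerivAt (fun z : F => z - y) (ContinuousLinearMap.id ℝ F) z :=
      (hasFDerivAt_id z).sub_const y
    have h3 := h1.comp z h2
    rw [ContinuousLinearMap.comp_id] at h3
    exact h3

lemma pot_continuous {V : Type*} [NormedAddCommGroup V] [NormedSpace ℝ V]
    {g : F → V} (hg : Continuous g) (ν : Measure F) [IsFiniteMeasure ν] {E : Set F}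
    (hE : IsCompact E) (hν : ν Eᶜ = 0) :
    Continuous (fun x => ∫ y, g (x - y) ∂ν) := by
  have h : ν.restrict E = ν := Measure.restrict_eq_self_of_ae_mem (by rw [ae_iff]; exact hν)
  rw [← h]
  exact continuous_parametric_integral_of_continuous
    (f := fun x y => g (x - y)) (hg.comp (continuous_fst.sub continuous_snd)) hE

/-- regularised potential of a measure -/
noncomputable def pot (ε : ℝ) (ν : Measure F) (x : F) : ℝ := ∫ y, Gam ε (x - y) ∂ν

/-- mollification of a measure -/
noncomputable def mol (ε : ℝ) (ν : Measure F) (x : F) : ℝ := ∫ y, bet ε (x - y) ∂ν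

section

lemma pot_fderiv (ν : Measure F) [IsFiniteMeasure ν] {E : Set F} (hE : IsCompact E) (hν : ν Eᶜ = 0) {ε : ℝ} (hε : 0 < ε) (x : F) : fderiv ℝ (pot ε ν) x = ∫ y, fderiv ℝ (Gam ε) (x - y) ∂ν :=
  (pot_hasFDerivAt (Gam_contDiff hε) ν hE hν x).fderiv

lemma Gam_fderiv_cd (ν : Measure F) [IsFiniteMeasure ν] {E : Set F} (hE : IsCompact E) (hν : ν Eᶜ = 0) {ε : ℝ} (hε : 0 < ε) : ContDiff ℝ 1 (fderiv ℝ (Gam ε : F → ℝ)) :=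
  (Gam_contDiff hε (n := 2)).fderiv_right (by norm_num)

lemma pot_contDiff (ν : Measure F) [IsFiniteMeasure ν] {E : Set F} (hE : IsCompact E) (hν : ν Eᶜ = 0) {ε : ℝ} (hε : 0 < ε) : ContDiff ℝ 2 (pot ε ν) := by
  rw [show (2 : WithTop ℕ∞) = 1 + 1 by norm_num, contDiff_succ_iff_fderiv]
  refine ⟨fun x => (pot_hasFDerivAt (Gam_contDiff hε) ν hE hν x).differentiableAt, by simp, ?_⟩
  rw [funext (pot_fderiv ν hE hν hε)]
  have hc := Gam_fderiv_cd ν hE hν hε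
  rw [contDiff_one_iff_fderiv]
  refine ⟨fun x => (pot_hasFDerivAt hc ν hE hν x).differentiableAt, ?_⟩
  rw [funext fun x => (pot_hasFDerivAt hc ν hE hν x).fderiv]
  exact pot_continuous (hc.continuous_fderiv (by norm_num)) ν hE hν

lemma pot_integrable (ν : Measure F) [IsFiniteMeasure ν] {E : Set F} (hE : IsCompact E) (hν : ν Eᶜ = 0) {ε : ℝ} (hε : 0 < ε) {V : Type*} [NormedAddCommGroup V] {g : F → V} (hg : Continuous g) (x : F) :
    Integrable (fun y => g (x - y)) ν := by
  have hgx : Continuous fun y => g (x - y) := hg.comp (continuous_const.sub continuous_id)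
  obtain ⟨C, hC⟩ := hE.exists_bound_of_continuousOn hgx.continuousOn
  refine Integrable.of_bound (C := C) hgx.aestronglyMeasurable ?_
  have hae : ∀ᵐ y ∂ν, y ∈ E := by rw [ae_iff]; exact hν
  filter_upwards [hae] with y hy using hC y hy

lemma pot_lap (ν : Measure F) [IsFiniteMeasure ν] {E : Set F} (hE : IsCompact E) (hν : ν Eᶜ = 0) {ε : ℝ} (hε : 0 < ε) (x : F) : Δ (pot ε ν) x = - mol ε ν x := by
  rw [lap_eq_sum_fderiv, funext (pot_fderiv ν hE hν hε)]
  have hc := Gam_fderiv_cd ν hE hν hε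
  have hcc : Continuous (fderiv ℝ (fderiv ℝ (Gam ε : F → ℝ))) := hc.continuous_fderiv (by norm_num)
  rw [(pot_hasFDerivAt hc ν hE hν x).fderiv]
  have hi := pot_integrable (V := F →L[ℝ] F →L[ℝ] ℝ) ν hE hν hε hcc x
  have h1 : ∀ i, (∫ y, fderiv ℝ (fderiv ℝ (Gam ε)) (x - y) ∂ν) (stdOrthonormalBasis ℝ F i)
      (stdOrthonormalBasis ℝ F i) = ∫ y, fderiv ℝ (fderiv ℝ (Gam ε)) (x - y)
        (stdOrthonormalBasis ℝ F i) (stdOrthonormalBasis ℝ F i) ∂ν := fun i => by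
    rw [ContinuousLinearMap.integral_apply hi, ContinuousLinearMap.integral_apply]
    exact hi.apply_continuousLinearMap _
  rw [Finset.sum_congr rfl fun i _ => h1 i, ← integral_finsetSum, mol, ← integral_neg]
  · refine integral_congr_ae (Eventually.of_forall fun y => ?_)
    simp only
    rw [← lap_eq_sum_fderiv, Gam_lap hε]
  · intro i _
    exact (hi.apply_continuousLinearMap _).apply_continuousLinearMap _

lemma mol_continuous (ν : Measure F) [IsFiniteMeasure ν] {E : Set F} (hE : IsCompact E) (hν : ν Eᶜ = 0) {ε : ℝ} (hε : 0 < ε) : Continuous (mol ε ν) := pot_continuous (bet_continuous hε) ν hE hν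

end

end kernel

open Set MeasureTheory Filter Topology

set_option linter.unusedSectionVars false

section approx

variable {F : Type*} [NormedAddCommGroup F] [InnerProductSpace ℝ F] [FiniteDimensional ℝ F]
  [MeasurableSpace F] [BorelSpace F]

/-- the mass of the mollifier `bet` -/
noncomputable def cM (F : Type*) [NormedAddCommGroup F] [InnerProductSpace ℝ F]
    [FiniteDimensional ℝ F] [MeasurableSpace F] [BorelSpace F] : ℝ := ∫ x : F, bet 1 x

lemma bet_one_integrable : Integrable (bet 1 : F → ℝ) := by
  have h := integrable_rpow_neg_one_add_norm_sq (E := F) (μ := volume)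
    (r := (Module.finrank ℝ F : ℝ) + 2) (by linarith)
  refine (h.const_mul ((Module.finrank ℝ F : ℝ) * ((Module.finrank ℝ F : ℝ) - 2) * 1 ^ 2)).congr
    (Eventually.of_forall fun x => ?_)
  simp only [bet, rp, one_pow]
  rw [add_comm 1]

lemma cM_pos (hM : 3 ≤ Module.finrank ℝ F) : 0 < cM F := by
  unfold cM
  rw [integral_pos_iff_support_of_nonneg (fun x => bet_nonneg hM one_pos x) bet_one_integrable]
  have : Function.support (bet 1 : F → ℝ) = univ := by
    ext x; simp [(bet_pos hM one_pos x).ne']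
  rw [this]; exact isOpen_univ.measure_pos volume univ_nonempty

lemma bet_scale {ε : ℝ} (hε : 0 < ε) (x : F) :
    bet ε (ε • x) = (ε ^ Module.finrank ℝ F)⁻¹ * bet 1 x := by
  unfold bet rp
  have h0 : ‖ε • x‖ ^ 2 + ε ^ 2 = ε ^ 2 * (‖x‖ ^ 2 + 1 ^ 2) := by
    rw [norm_smul, Real.norm_eq_abs, abs_of_pos hε]; ring
  rw [h0, Real.mul_rpow (by positivity) (by positivity)]
  have h1 : (ε ^ 2) ^ (-((Module.finrank ℝ F : ℝ) + 2) / 2)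
      = (ε ^ Module.finrank ℝ F)⁻¹ * (ε ^ 2)⁻¹ := by
    rw [← Real.rpow_natCast ε 2, ← Real.rpow_mul hε.le, ← Real.rpow_natCast, ← Real.rpow_neg hε.le,
      ← Real.rpow_neg hε.le, ← Real.rpow_add hε]
    congr 1; push_cast; ring
  rw [h1]
  field_simp

/-- change of variables -/
lemma bet_integral {ε : ℝ} (hε : 0 < ε) (g : F → ℝ) :
    ∫ z, bet ε z * g z = ∫ y, bet 1 y * g (ε • y) := by
  have h := Measure.integral_comp_smul (volume : Measure F) (fun z => bet ε z * g z) ε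
  rw [abs_of_pos (by positivity), smul_eq_mul] at h
  have h2 : ∫ y, bet 1 y * g (ε • y) =
      ε ^ Module.finrank ℝ F * ∫ y, bet ε (ε • y) * g (ε • y) := by
    rw [← integral_const_mul]
    refine integral_congr_ae (Eventually.of_forall fun y => ?_)
    simp only
    rw [bet_scale hε]
    field_simp
  rw [h2, h]
  field_simp

lemma bet_integrable {ε : ℝ} (hε : 0 < ε) : Integrable (bet ε : F → ℝ) := by
  rw [← integrable_comp_smul_iff volume _ hε.ne']
  exact (bet_one_integrable.const_mul _).congr (Eventually.of_forall fun x => (bet_scale hε x).symm)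

lemma bet_mass {ε : ℝ} (hε : 0 < ε) : ∫ z : F, bet ε z = cM F := by
  have h := bet_integral (F := F) hε (fun _ => 1)
  simpa [cM] using h

lemma bet_tail (η : ℝ) (hη : 0 < η) : ∃ R > 0, ∫ y in (Metric.ball (0:F) R)ᶜ, |bet 1 y| ≤ η := by
  have h := tendsto_setIntegral_of_antitone (μ := volume) (f := fun y : F => |bet 1 y|)
    (s := fun n : ℕ => (Metric.ball (0:F) n)ᶜ) (fun n => Metric.isOpen_ball.measurableSet.compl)
    (fun m n hmn => compl_subset_compl.2 (Metric.ball_subset_ball (by exact_mod_cast hmn)))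
    ⟨0, bet_one_integrable.abs.integrableOn⟩
  have h2 : ⋂ n : ℕ, (Metric.ball (0:F) n)ᶜ = ∅ := by
    rw [← compl_iUnion, Metric.iUnion_ball_nat, compl_univ]
  rw [h2, setIntegral_empty] at h
  obtain ⟨n, hn⟩ := ((h.eventually (gt_mem_nhds hη)).and (eventually_gt_atTop 0)).exists
  exact ⟨n, by exact_mod_cast hn.2, hn.1.le⟩

/-- approximation of the identity, uniformly on compact sets -/
lemma bet_approx {g : F → ℝ} (hg : Continuous g) {L : ℝ} (hL : ∀ x, |g x| ≤ L) {A : Set F}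
    (hA : IsCompact A) {η : ℝ} (hη : 0 < η) :
    ∃ ε₀ > 0, ∀ ε, 0 < ε → ε < ε₀ → ∀ x ∈ A, |(∫ z, bet ε z * g (x - z)) - cM F * g x| ≤ η := by
  have hL0 : 0 ≤ L := (abs_nonneg _).trans (hL 0)
  set T : ℝ := ∫ y : F, |bet 1 y| with hT
  have hT0 : 0 ≤ T := integral_nonneg fun _ => abs_nonneg _
  obtain ⟨R, hR, htail⟩ := bet_tail (F := F) (η / (4 * (L + 1))) (by positivity)
  -- uniform continuity
  have hUC : ∃ r > 0, ∀ x ∈ A, ∀ z : F, ‖z‖ < r → |g (x - z) - g x| ≤ η / (2 * (T + 1)) := by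
    have h1 := hA.uniformContinuousAt_of_continuousAt g (fun a _ => hg.continuousAt)
      (Metric.dist_mem_uniformity (show 0 < η / (2 * (T + 1)) by positivity))
    obtain ⟨r, hr, h⟩ := Metric.mem_uniformity_dist.1 h1
    refine ⟨r, hr, fun x hx z hz => ?_⟩
    have := h (show dist x (x - z) < r by simpa [dist_eq_norm] using hz) hx
    have h3 : dist (g x) (g (x - z)) < η / (2 * (T + 1)) := this
    rw [Real.dist_eq, abs_sub_comm] at h3
    exact h3.le
  obtain ⟨r, hr, hUC⟩ := hUC
  refine ⟨r / R, by positivity, fun ε hε hεr x hx => ?_⟩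
  rw [bet_integral hε (fun z => g (x - z)), cM, mul_comm, ← integral_const_mul]
  have hi1 : Integrable (fun y : F => bet 1 y * g (x - ε • y)) := by
    refine bet_one_integrable.mul_bdd (c := L) ?_ (Eventually.of_forall fun y => hL _)
    exact (hg.comp (by fun_prop)).aestronglyMeasurable
  have hi2 : Integrable (fun y : F => g x * bet 1 y) := bet_one_integrable.const_mul _
  rw [← integral_sub hi1 hi2]
  have hb : ∀ y : F, |bet 1 y * g (x - ε • y) - g x * bet 1 y| ≤
      η / (2 * (T + 1)) * |bet 1 y| + (Metric.ball (0:F) R)ᶜ.indicator (fun y => 2 * L * |bet 1 y|) y := by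
    intro y
    rw [show bet 1 y * g (x - ε • y) - g x * bet 1 y = (g (x - ε • y) - g x) * bet 1 y by ring,
      abs_mul]
    by_cases hy : ‖y‖ < R
    · have : y ∉ (Metric.ball (0:F) R)ᶜ := by simpa using hy
      rw [indicator_of_notMem this, add_zero]
      gcongr
      apply hUC x hx
      rw [norm_smul, Real.norm_eq_abs, abs_of_pos hε]
      calc ε * ‖y‖ ≤ ε * R := by gcongr
        _ < r / R * R := by gcongr
        _ = r := by field_simp
    · have : y ∈ (Metric.ball (0:F) R)ᶜ := by simpa using hy
      rw [indicator_of_mem this]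
      have h4 : |g (x - ε • y) - g x| ≤ 2 * L := by
        have := abs_sub (g (x - ε • y)) (g x)
        linarith [hL (x - ε • y), hL x]
      have h5 : 0 ≤ η / (2 * (T + 1)) * |bet 1 y| := by positivity
      have h6 := mul_le_mul_of_nonneg_right h4 (abs_nonneg (bet 1 y))
      linarith
  have hms : MeasurableSet (Metric.ball (0:F) R)ᶜ := Metric.isOpen_ball.measurableSet.compl
  have hi3 : Integrable (fun y : F => η / (2 * (T + 1)) * |bet 1 y|) :=
    bet_one_integrable.abs.const_mul _
  have hi4 : Integrable ((Metric.ball (0:F) R)ᶜ.indicator (fun y => 2 * L * |bet 1 y|)) :=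
    (bet_one_integrable.abs.const_mul _).indicator hms
  refine (abs_integral_le_integral_abs).trans ?_
  refine (integral_mono_of_nonneg (Eventually.of_forall fun _ => abs_nonneg _) (hi3.add hi4)
    (Eventually.of_forall hb)).trans ?_
  simp only [Pi.add_apply]
  rw [integral_add hi3 hi4, integral_indicator hms, integral_const_mul, integral_const_mul, ← hT]
  have e1 : η / (2 * (T + 1)) * T ≤ η / 2 := by
    rw [div_mul_eq_mul_div, div_le_div_iff₀ (by positivity) (by positivity)]; nlinarith
  have e2 : 2 * L * ∫ y in (Metric.ball (0:F) R)ᶜ, |bet 1 y| ≤ η / 2 := by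
    calc 2 * L * ∫ y in (Metric.ball (0:F) R)ᶜ, |bet 1 y| ≤ 2 * L * (η / (4 * (L + 1))) := by gcongr
      _ ≤ η / 2 := by
        rw [mul_div_assoc', div_le_div_iff₀ (by positivity) (by positivity)]; nlinarith
  linarith

end approx

open Set MeasureTheory Filter Topology

set_option linter.unusedSectionVars false

section radial
open scoped ENNReal

variable {F : Type*} [NormedAddCommGroup F] [InnerProductSpace ℝ F] [FiniteDimensional ℝ F]
  [MeasurableSpace F] [BorelSpace F]

lemma lint_smul {R : ℝ} (hR : 0 < R) {f : F → ℝ≥0∞} (hf : Measurable f) :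
    ∫⁻ y, f y = ENNReal.ofReal (R ^ Module.finrank ℝ F) * ∫⁻ y, f (R • y) := by
  have h := Measure.map_addHaar_smul (volume : Measure F) hR.ne'
  have h1 : ∫⁻ y, f (R • y) = ∫⁻ y, f y ∂(Measure.map (R • ·) (volume : Measure F)) :=
    (lintegral_map hf (measurable_const_smul R)).symm
  rw [h1, h, lintegral_smul_measure, smul_eq_mul, ← mul_assoc, ← ENNReal.ofReal_mul (by positivity),
    abs_of_pos (by positivity), mul_inv_cancel₀ (by positivity), ENNReal.ofReal_one, one_mul]

lemma meas_pw (s : ℝ) : Measurable (fun y : F => ‖y‖ₑ ^ s) := by fun_prop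

lemma enorm_pw_smul {R : ℝ} (hR : 0 < R) (s : ℝ) (y : F) :
    ‖R • y‖ₑ ^ s = ENNReal.ofReal R ^ s * ‖y‖ₑ ^ s := by
  have : ‖R • y‖ₑ = ENNReal.ofReal R * ‖y‖ₑ := by
    rw [enorm_smul, Real.enorm_eq_ofReal hR.le]
  rw [this, ENNReal.mul_rpow_of_ne_top ENNReal.ofReal_ne_top enorm_ne_top]
  
lemma scale_pw {R : ℝ} (hR : 0 < R) (s : ℝ) {A B : Set F} (hA : MeasurableSet A)
    (hAB : ∀ y, R • y ∈ A ↔ y ∈ B) (hB : MeasurableSet B) :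
    ∫⁻ y in A, ‖y‖ₑ ^ (-s) =
      (∫⁻ y in B, ‖y‖ₑ ^ (-s)) * ENNReal.ofReal R ^ ((Module.finrank ℝ F : ℝ) - s) := by
  rw [← lintegral_indicator hA, lint_smul hR ((meas_pw (-s)).indicator hA)]
  have : ∀ y : F, A.indicator (fun y : F => ‖y‖ₑ ^ (-s)) (R • y) =
      ENNReal.ofReal R ^ (-s) * B.indicator (fun y : F => ‖y‖ₑ ^ (-s)) y := fun y => by
    by_cases hy : y ∈ B
    · rw [indicator_of_mem hy, indicator_of_mem ((hAB y).2 hy), enorm_pw_smul hR]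
    · rw [indicator_of_notMem hy, indicator_of_notMem (mt (hAB y).1 hy), mul_zero]
  simp_rw [this]
  rw [lintegral_const_mul _ ((meas_pw (-s)).indicator hB), lintegral_indicator hB, ← mul_assoc,
    mul_comm, sub_eq_add_neg, ENNReal.rpow_add _ _ (by simpa using hR) ENNReal.ofReal_ne_top,
    ENNReal.rpow_natCast, ENNReal.ofReal_pow hR.le]

lemma enorm_pw_real {y : F} (hy : y ≠ 0) (s : ℝ) : ‖y‖ₑ ^ s = ‖‖y‖ ^ s‖ₑ := by
  have h := norm_pos_iff.2 hy
  rw [Real.enorm_eq_ofReal (by positivity), ← ENNReal.ofReal_rpow_of_pos h, ofReal_norm]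

lemma ae_ne_zero (hM : 1 ≤ Module.finrank ℝ F) : ∀ᵐ y : F, y ≠ 0 := by
  have : Nontrivial F := Module.nontrivial_of_finrank_pos (R := ℝ) hM
  exact Measure.ae_ne volume 0

lemma rad_in (hM : 1 ≤ Module.finrank ℝ F) {s : ℝ} (hs : s < Module.finrank ℝ F) :
    ∃ A : ℝ≥0∞, A ≠ ∞ ∧ ∀ R : ℝ, 0 < R → ∫⁻ y in Metric.ball (0:F) R, ‖y‖ₑ ^ (-s) =
      A * ENNReal.ofReal R ^ ((Module.finrank ℝ F : ℝ) - s) := by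
  refine ⟨∫⁻ y in Metric.ball (0:F) 1, ‖y‖ₑ ^ (-s), ?_, fun R hR => ?_⟩
  · have h1 : LocallyIntegrable (fun y : F => ‖y‖ ^ (-s)) volume := by
      refine locallyIntegrable_of_norm_le_rpow (C := 1) hM hs ?_ (by
        exact (measurable_norm.pow_const _).aestronglyMeasurable)
      filter_upwards with y
      rw [Real.norm_of_nonneg (by positivity), one_mul]
    have h2 : IntegrableOn (fun y : F => ‖y‖ ^ (-s)) (Metric.ball (0:F) 1) volume :=
      (h1.integrableOn_isCompact (isCompact_closedBall (0:F) 1)).mono_set Metric.ball_subset_closedBall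
    refine ne_of_lt (lt_of_le_of_lt (le_of_eq ?_) h2.2)
    refine setLIntegral_congr_fun_ae Metric.isOpen_ball.measurableSet ?_
    filter_upwards [ae_ne_zero hM] with y hy _
    exact enorm_pw_real hy _
  · refine scale_pw hR s Metric.isOpen_ball.measurableSet (fun y => ?_)
      Metric.isOpen_ball.measurableSet
    rw [mem_ball_zero_iff, mem_ball_zero_iff, norm_smul, Real.norm_eq_abs, abs_of_pos hR]
    constructor
    · intro h; by_contra h2; push Not at h2; nlinarith
    · intro h; nlinarith

lemma rad_out {s : ℝ} (hs : (Module.finrank ℝ F : ℝ) < s) :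
    ∃ A : ℝ≥0∞, A ≠ ∞ ∧ ∀ R : ℝ, 0 < R → ∫⁻ y in (Metric.ball (0:F) R)ᶜ, ‖y‖ₑ ^ (-s) =
      A * ENNReal.ofReal R ^ ((Module.finrank ℝ F : ℝ) - s) := by
  refine ⟨∫⁻ y in (Metric.ball (0:F) 1)ᶜ, ‖y‖ₑ ^ (-s), ?_, fun R hR => ?_⟩
  · have h1 := finite_integral_one_add_norm (E := F) (μ := volume) hs
    have h2 : ∫⁻ y in (Metric.ball (0:F) 1)ᶜ, ‖y‖ₑ ^ (-s) ≤
        ∫⁻ y : F, ENNReal.ofReal (2 ^ s) * ENNReal.ofReal ((1 + ‖y‖) ^ (-s)) := by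
      rw [← lintegral_indicator Metric.isOpen_ball.measurableSet.compl]
      refine lintegral_mono (indicator_le (fun y hy => ?_))
      have hy1 : 1 ≤ ‖y‖ := by simpa using hy
      rw [enorm_pw_real (norm_pos_iff.1 (by linarith)), Real.enorm_eq_ofReal (by positivity),
        ← ENNReal.ofReal_mul (by positivity)]
      apply ENNReal.ofReal_le_ofReal
      have hs0 : 0 < s := lt_of_le_of_lt (by positivity) hs
      have : (2 * ‖y‖) ^ (-s) ≤ (1 + ‖y‖) ^ (-s) :=
        Real.rpow_le_rpow_of_nonpos (by positivity) (by linarith) (by linarith)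
      rw [Real.mul_rpow (by norm_num) (by positivity)] at this
      calc ‖y‖ ^ (-s) = 2 ^ s * (2 ^ (-s) * ‖y‖ ^ (-s)) := by
            rw [← mul_assoc, ← Real.rpow_add (by norm_num)]; simp
        _ ≤ _ := by gcongr
    refine ne_of_lt (lt_of_le_of_lt h2 ?_)
    rw [lintegral_const_mul _ (by fun_prop)]
    exact ENNReal.mul_lt_top ENNReal.ofReal_lt_top h1
  · refine scale_pw hR s Metric.isOpen_ball.measurableSet.compl (fun y => ?_)
      Metric.isOpen_ball.measurableSet.compl
    rw [mem_compl_iff, mem_compl_iff, not_iff_not]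
    rw [mem_ball_zero_iff, mem_ball_zero_iff, norm_smul, Real.norm_eq_abs, abs_of_pos hR]
    constructor
    · intro h; by_contra h2; push Not at h2; nlinarith
    · intro h; nlinarith

lemma rpow_anti {x y : ℝ≥0∞} (h : x ≤ y) {s : ℝ} (hs : 0 ≤ s) : y ^ (-s) ≤ x ^ (-s) := by
  rw [ENNReal.rpow_neg, ENNReal.rpow_neg]
  exact ENNReal.inv_le_inv.2 (ENNReal.rpow_le_rpow h hs)

/-- Newtonian kernel exponent: `nk x = |x|^{-(M-2)}`. -/
noncomputable def nk (x : F) : ℝ≥0∞ := ‖x‖ₑ ^ (-((Module.finrank ℝ F : ℝ) - 2))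

lemma nk_meas : Measurable (nk : F → ℝ≥0∞) := meas_pw _

lemma nk_neg (x : F) : nk (-x) = nk x := by rw [nk, nk, enorm_neg]

lemma schur_kernel (hM : 3 ≤ Module.finrank ℝ F) {s : ℝ} (hs : 2 < s)
    (hsM : s < Module.finrank ℝ F) :
    ∃ C : ℝ≥0∞, C ≠ ∞ ∧ ∀ x : F, x ≠ 0 →
      ∫⁻ y, nk (x - y) * ‖y‖ₑ ^ (-s) ≤ C * ‖x‖ₑ ^ (2 - s) := by
  have hM' : (3:ℝ) ≤ Module.finrank ℝ F := by exact_mod_cast hM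
  set M : ℝ := (Module.finrank ℝ F : ℝ) with hMdef
  obtain ⟨A1, hA1, h1⟩ := rad_in (F := F) (by omega) hsM
  obtain ⟨A2, hA2, h2⟩ := rad_in (F := F) (by omega) (s := M - 2) (by linarith)
  obtain ⟨A3, hA3, h3⟩ := rad_out (F := F) (s := M - 2 + s) (by linarith)
  refine ⟨(A1 + A2 + 3 ^ (M - 2) * A3) * (ENNReal.ofReal (1/2)) ^ (2 - s), ?_, fun x hx => ?_⟩
  · refine ENNReal.mul_ne_top (ENNReal.add_ne_top.2 ⟨ENNReal.add_ne_top.2 ⟨hA1, hA2⟩,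
      ENNReal.mul_ne_top (ENNReal.rpow_ne_top_of_nonneg (by linarith) (by norm_num)) hA3⟩) ?_
    exact ENNReal.rpow_ne_top_of_nonneg' (by simp) (by simp)
  have hx0 : 0 < ‖x‖ := norm_pos_iff.2 hx
  set R := ‖x‖ / 2 with hR
  have hR0 : 0 < R := by positivity
  set r := ENNReal.ofReal R with hr
  have hr0 : r ≠ 0 := by simp [hr, hR0]
  have hrt : r ≠ ∞ := ENNReal.ofReal_ne_top
  have hrx : r ^ (2 - s) = ENNReal.ofReal (1/2) ^ (2 - s) * ‖x‖ₑ ^ (2 - s) := by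
    rw [← ENNReal.mul_rpow_of_ne_top ENNReal.ofReal_ne_top enorm_ne_top, ← ofReal_norm,
      ← ENNReal.ofReal_mul (by norm_num), hr, hR]
    congr 2; ring
  have hle : ∀ y : F, R ≤ ‖y‖ → r ≤ ‖y‖ₑ := fun y hy => by
    rw [← ofReal_norm]; exact ENNReal.ofReal_le_ofReal hy
  have i1 : ∫⁻ y in Metric.ball (0:F) R, nk (x - y) * ‖y‖ₑ ^ (-s) ≤ A1 * r ^ (2 - s) := by
    calc _ ≤ ∫⁻ y in Metric.ball (0:F) R, r ^ (-(M - 2)) * ‖y‖ₑ ^ (-s) := by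
          refine setLIntegral_mono (by fun_prop) fun y hy => ?_
          gcongr
          refine rpow_anti (hle _ ?_) (by linarith)
          have := norm_sub_norm_le x y
          rw [mem_ball_zero_iff] at hy
          linarith
      _ = r ^ (-(M - 2)) * (A1 * r ^ (M - s)) := by
          rw [lintegral_const_mul _ (by fun_prop), h1 R hR0]
      _ = A1 * r ^ (2 - s) := by
          rw [mul_left_comm, ← ENNReal.rpow_add _ _ hr0 hrt]; congr 2; ring
  have i2 : ∫⁻ y in Metric.ball x R, nk (x - y) * ‖y‖ₑ ^ (-s) ≤ A2 * r ^ (2 - s) := by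
    calc _ ≤ ∫⁻ y in Metric.ball x R, r ^ (-s) * nk (x - y) := by
          refine setLIntegral_mono (by unfold nk; fun_prop) fun y hy => ?_
          rw [mul_comm]
          refine mul_le_mul_left (rpow_anti (hle _ ?_) (by linarith)) _
          have := norm_sub_norm_le x y
          rw [mem_ball_iff_norm'] at hy
          linarith
      _ = r ^ (-s) * (A2 * r ^ (M - (M - 2))) := by
          rw [lintegral_const_mul _ (by unfold nk; fun_prop), ← h2 R hR0,
            ← lintegral_indicator Metric.isOpen_ball.measurableSet,
            ← lintegral_indicator Metric.isOpen_ball.measurableSet,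
            ← lintegral_sub_left_eq_self (μ := volume)
              (indicator (Metric.ball (0:F) R) fun y : F => ‖y‖ₑ ^ (-(M - 2))) x]
          congr 2; ext y
          by_cases hy : y ∈ Metric.ball x R
          · rw [indicator_of_mem hy, indicator_of_mem]
            · rfl
            · rw [mem_ball_zero_iff]; exact mem_ball_iff_norm'.1 hy
          · rw [indicator_of_notMem hy, indicator_of_notMem]
            rw [mem_ball_zero_iff]; exact fun h => hy (mem_ball_iff_norm'.2 h)
      _ = A2 * r ^ (2 - s) := by
          rw [mul_left_comm, ← ENNReal.rpow_add _ _ hr0 hrt]; congr 2; ring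
  have i3 : ∫⁻ y in (Metric.ball (0:F) R)ᶜ \ Metric.ball x R, nk (x - y) * ‖y‖ₑ ^ (-s) ≤
      3 ^ (M - 2) * A3 * r ^ (2 - s) := by
    calc _ ≤ ∫⁻ y in (Metric.ball (0:F) R)ᶜ \ Metric.ball x R,
            3 ^ (M - 2) * ‖y‖ₑ ^ (-(M - 2 + s)) := by
          refine setLIntegral_mono (by fun_prop) fun y hy => ?_
          have hy1 : R ≤ ‖y‖ := by simpa using hy.1
          have hy2 : R ≤ ‖x - y‖ := by
            have := hy.2; rw [mem_ball_iff_norm'] at this; linarith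
          have hy3 : ‖y‖ₑ ≤ 3 * ‖x - y‖ₑ := by
            rw [← ofReal_norm, ← ofReal_norm, show (3:ℝ≥0∞) = ENNReal.ofReal 3 by simp,
              ← ENNReal.ofReal_mul (by norm_num)]
            apply ENNReal.ofReal_le_ofReal
            have := norm_sub_norm_le y x
            rw [norm_sub_rev] at this; linarith
          have hy0 : ‖y‖ₑ ≠ 0 := by
            rw [enorm_ne_zero]; exact norm_pos_iff.1 (by linarith)
          rw [neg_add, ENNReal.rpow_add _ _ hy0 enorm_ne_top, ← mul_assoc]
          gcongr
          have := rpow_anti hy3 (s := M - 2) (by linarith)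
          rw [ENNReal.mul_rpow_of_ne_top (by norm_num) enorm_ne_top] at this
          calc nk (x - y) = 3 ^ (M - 2) * (3 ^ (-(M - 2)) * ‖x - y‖ₑ ^ (-(M - 2))) := by
                rw [← mul_assoc, ← ENNReal.rpow_add _ _ (by norm_num) (by norm_num), nk]; simp [hMdef]
            _ ≤ _ := by gcongr
      _ ≤ ∫⁻ y in (Metric.ball (0:F) R)ᶜ, 3 ^ (M - 2) * ‖y‖ₑ ^ (-(M - 2 + s)) :=
          lintegral_mono_set sdiff_subset
      _ = 3 ^ (M - 2) * A3 * r ^ (2 - s) := by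
          rw [lintegral_const_mul _ (by fun_prop), h3 R hR0, mul_assoc]; congr 3; ring
  calc ∫⁻ y, nk (x - y) * ‖y‖ₑ ^ (-s)
      ≤ ∫⁻ y in Metric.ball (0:F) R ∪ (Metric.ball x R ∪
          ((Metric.ball (0:F) R)ᶜ \ Metric.ball x R)), nk (x - y) * ‖y‖ₑ ^ (-s) := by
        rw [← setLIntegral_univ]
        refine lintegral_mono_set fun y _ => ?_
        by_cases h : y ∈ Metric.ball (0:F) R
        · exact Or.inl h
        · by_cases h' : y ∈ Metric.ball x R
          · exact Or.inr (Or.inl h')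
          · exact Or.inr (Or.inr ⟨h, h'⟩)
    _ ≤ A1 * r ^ (2 - s) + (A2 * r ^ (2 - s) + 3 ^ (M - 2) * A3 * r ^ (2 - s)) :=
        (lintegral_union_le _ _ _).trans (add_le_add i1
          ((lintegral_union_le _ _ _).trans (add_le_add i2 i3)))
    _ = _ := by rw [hrx]; ring

/-- Newtonian potential. -/
noncomputable def np (f : F → ℝ≥0∞) (x : F) : ℝ≥0∞ := ∫⁻ y, nk (x - y) * f y

lemma np_meas {f : F → ℝ≥0∞} (hf : Measurable f) : Measurable (np f) := by
  unfold np
  refine Measurable.lintegral_prod_right ?_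
  exact (nk_meas.comp (by fun_prop)).mul (hf.comp measurable_snd)

lemma schur_ineq {p q : ℝ} (hpq : p.HolderConjugate q) (hM : 4 ≤ Module.finrank ℝ F)
    (hMq : 2 * q < Module.finrank ℝ F) :
    ∃ C : ℝ≥0∞, C ≠ ∞ ∧ ∀ f : F → ℝ≥0∞, Measurable f →
      ∫⁻ x : F, ‖x‖ₑ ^ (((Module.finrank ℝ F : ℝ) - 2) * (q - 1) - 2 * q) * (np f x) ^ q ≤
      C * ∫⁻ x : F, ‖x‖ₑ ^ (((Module.finrank ℝ F : ℝ) - 2) * (q - 1)) * (f x) ^ q := by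
  have hM' : (4:ℝ) ≤ Module.finrank ℝ F := by exact_mod_cast hM
  have hq1 : 1 < q := hpq.symm.lt
  have hp1 : 1 < p := hpq.lt
  have hqp : q / p = q - 1 := by
    have := hpq.symm.sub_one_mul_conj; field_simp; linarith
  set M : ℝ := (Module.finrank ℝ F : ℝ) with hMdef
  obtain ⟨C1, hC1, h1⟩ := schur_kernel (F := F) (by omega) (s := M - 1) (by linarith)
    (by linarith)
  obtain ⟨C2, hC2, h2⟩ := schur_kernel (F := F) (by omega) (s := q + 1) (by linarith)
    (by linarith)
  refine ⟨C1 ^ (q - 1) * C2, ENNReal.mul_ne_top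
    (ENNReal.rpow_ne_top_of_nonneg (by linarith) hC1) hC2, fun f hf => ?_⟩
  have hnk : ∀ x : F, Measurable fun y => nk (x - y) := fun x => nk_meas.comp (by fun_prop)
  have hnk2 : ∀ y : F, Measurable fun x => nk (x - y) := fun x => nk_meas.comp (by fun_prop)
  set σ := (M - 1) * (q - 1) with hσ
  have key : ∀ x : F, x ≠ 0 → (np f x) ^ q ≤ C1 ^ (q - 1) * ‖x‖ₑ ^ ((2 - (M - 1)) * (q - 1)) *
      ∫⁻ y, nk (x - y) * (‖y‖ₑ ^ σ * f y ^ q) := fun x hx => by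
    have e1 : np f x = ∫⁻ y, (nk (x - y) ^ (1 / p) * ‖y‖ₑ ^ (-((M - 1) / p))) *
        (nk (x - y) ^ (1 / q) * ‖y‖ₑ ^ ((M - 1) / p) * f y) := by
      refine lintegral_congr_ae ?_
      filter_upwards [ae_ne_zero (F := F) (by omega)] with y hy
      have : nk (x - y) = nk (x - y) ^ (1 / p) * nk (x - y) ^ (1 / q) := by
        rw [← ENNReal.rpow_add_of_nonneg _ _ (by positivity) (by positivity)]
        have := hpq.inv_add_inv_eq_one
        rw [one_div, one_div, this, ENNReal.rpow_one]
      have h3 : ‖y‖ₑ ^ (-((M - 1) / p)) * ‖y‖ₑ ^ ((M - 1) / p) = 1 := by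
        rw [← ENNReal.rpow_add _ _ (enorm_ne_zero.2 hy) enorm_ne_top]; simp
      calc nk (x - y) * f y = nk (x - y) ^ (1 / p) * nk (x - y) ^ (1 / q) * 1 * f y := by
            rw [← this, mul_one]
        _ = _ := by rw [← h3]; ring
    have e2 := ENNReal.lintegral_mul_le_Lp_mul_Lq volume hpq
      (f := fun y => nk (x - y) ^ (1 / p) * ‖y‖ₑ ^ (-((M - 1) / p)))
      (g := fun y => nk (x - y) ^ (1 / q) * ‖y‖ₑ ^ ((M - 1) / p) * f y)
      (((hnk x).pow_const _).mul (by fun_prop)).aemeasurable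
      ((((hnk x).pow_const _).mul (by fun_prop)).mul hf).aemeasurable
    have e3 : ∀ y, (nk (x - y) ^ (1 / p) * ‖y‖ₑ ^ (-((M - 1) / p))) ^ p =
        nk (x - y) * ‖y‖ₑ ^ (-(M - 1)) := fun y => by
      rw [ENNReal.mul_rpow_of_nonneg _ _ (by linarith), ← ENNReal.rpow_mul, ← ENNReal.rpow_mul,
        one_div, inv_mul_cancel₀ (by linarith), ENNReal.rpow_one]
      congr 2; field_simp
    have e4 : ∀ y, (nk (x - y) ^ (1 / q) * ‖y‖ₑ ^ ((M - 1) / p) * f y) ^ q =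
        nk (x - y) * (‖y‖ₑ ^ σ * f y ^ q) := fun y => by
      rw [ENNReal.mul_rpow_of_nonneg _ _ (by linarith), ENNReal.mul_rpow_of_nonneg _ _ (by linarith),
        ← ENNReal.rpow_mul, ← ENNReal.rpow_mul,
        one_div, inv_mul_cancel₀ (by linarith), ENNReal.rpow_one, mul_assoc, hσ, ← hqp]
      congr 3; field_simp
    simp only [Pi.mul_apply] at e2
    simp_rw [e3, e4] at e2
    rw [← e1] at e2
    calc (np f x) ^ q ≤ ((∫⁻ y, nk (x - y) * ‖y‖ₑ ^ (-(M - 1))) ^ (1 / p) *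
          (∫⁻ y, nk (x - y) * (‖y‖ₑ ^ σ * f y ^ q)) ^ (1 / q)) ^ q :=
          ENNReal.rpow_le_rpow e2 (by linarith)
      _ = (∫⁻ y, nk (x - y) * ‖y‖ₑ ^ (-(M - 1))) ^ (q - 1) *
          (∫⁻ y, nk (x - y) * (‖y‖ₑ ^ σ * f y ^ q)) := by
          rw [ENNReal.mul_rpow_of_nonneg _ _ (by linarith), ← ENNReal.rpow_mul, ← ENNReal.rpow_mul,
            one_div_mul_cancel (by linarith), ENNReal.rpow_one, ← hqp, one_div_mul_eq_div]
      _ ≤ (C1 * ‖x‖ₑ ^ (2 - (M - 1))) ^ (q - 1) *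
          (∫⁻ y, nk (x - y) * (‖y‖ₑ ^ σ * f y ^ q)) := by
          gcongr
          exact h1 x hx
      _ = _ := by rw [ENNReal.mul_rpow_of_nonneg _ _ (by linarith), ← ENNReal.rpow_mul]
  calc ∫⁻ x : F, ‖x‖ₑ ^ ((M - 2) * (q - 1) - 2 * q) * (np f x) ^ q
      ≤ ∫⁻ x : F, C1 ^ (q - 1) *
          ∫⁻ y, ‖x‖ₑ ^ (-(q + 1)) * (nk (x - y) * (‖y‖ₑ ^ σ * f y ^ q)) := by
        refine lintegral_mono_ae ?_
        filter_upwards [ae_ne_zero (F := F) (by omega)] with x hx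
        refine (mul_le_mul_right (key x hx) _).trans (le_of_eq ?_)
        rw [lintegral_const_mul _ (show Measurable fun y => nk (x - y) * (‖y‖ₑ ^ σ * f y ^ q) from
          (hnk x).mul (by fun_prop))]
        have : ‖x‖ₑ ^ (-(q + 1)) =
            ‖x‖ₑ ^ ((M - 2) * (q - 1) - 2 * q) * ‖x‖ₑ ^ ((2 - (M - 1)) * (q - 1)) := by
          rw [← ENNReal.rpow_add _ _ (enorm_ne_zero.2 hx) enorm_ne_top]
          congr 1; ring
        rw [this]; ring
    _ = C1 ^ (q - 1) *
          ∫⁻ y, ∫⁻ x, ‖x‖ₑ ^ (-(q + 1)) * (nk (x - y) * (‖y‖ₑ ^ σ * f y ^ q)) := by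
        have hm : Measurable (Function.uncurry fun (x y : F) =>
            ‖x‖ₑ ^ (-(q + 1)) * (nk (x - y) * (‖y‖ₑ ^ σ * f y ^ q))) := by
          have : Measurable fun z : F × F => nk (z.1 - z.2) := nk_meas.comp (by fun_prop)
          unfold Function.uncurry
          fun_prop
        rw [lintegral_const_mul _ (Measurable.lintegral_prod_right hm),
          lintegral_lintegral_swap hm.aemeasurable]
    _ ≤ C1 ^ (q - 1) * ∫⁻ y, C2 * (‖y‖ₑ ^ ((M - 2) * (q - 1)) * f y ^ q) := by
        gcongr 1
        refine lintegral_mono_ae ?_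
        filter_upwards [ae_ne_zero (F := F) (by omega)] with y hy
        calc _ = (‖y‖ₑ ^ σ * f y ^ q) * ∫⁻ x, nk (y - x) * ‖x‖ₑ ^ (-(q + 1)) := by
              rw [← lintegral_const_mul _ (show Measurable fun x => nk (y - x) * ‖x‖ₑ ^ (-(q + 1)) from (hnk y).mul (by fun_prop))]
              congr 1; ext x
              rw [← nk_neg (y - x), neg_sub]; ring
          _ ≤ (‖y‖ₑ ^ σ * f y ^ q) * (C2 * ‖y‖ₑ ^ (2 - (q + 1))) := by gcongr; exact h2 y hy
          _ = C2 * ((‖y‖ₑ ^ σ * ‖y‖ₑ ^ (2 - (q + 1))) * f y ^ q) := by ring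
          _ = _ := by
              rw [← ENNReal.rpow_add _ _ (enorm_ne_zero.2 hy) enorm_ne_top]
              congr 3; rw [hσ]; ring
    _ = _ := by rw [lintegral_const_mul _ (by fun_prop), mul_assoc]

end radial

open Set MeasureTheory Filter Topology

set_option linter.unusedSectionVars false

section maximal
open scoped ENNReal

variable {F : Type*} [NormedAddCommGroup F] [InnerProductSpace ℝ F] [FiniteDimensional ℝ F]
  [MeasurableSpace F] [BorelSpace F]

/-- local maximal function, radii `< |x|/4` -/
noncomputable def ML (f : F → ℝ≥0∞) (x : F) : ℝ≥0∞ :=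
  ⨆ (r : ℝ) (_ : 0 < r ∧ r < ‖x‖ / 4), (∫⁻ y in Metric.ball x r, f y) / volume (Metric.ball (0:F) r)

lemma lt_ML_iff {f : F → ℝ≥0∞} {x : F} {t : ℝ≥0∞} :
    t < ML f x ↔ ∃ r : ℝ, (0 < r ∧ r < ‖x‖ / 4) ∧
      t * volume (Metric.ball (0:F) r) < ∫⁻ y in Metric.ball x r, f y := by
  unfold ML
  simp only [lt_iSup_iff]
  refine exists_congr fun r => ?_
  constructor
  · rintro ⟨h, h1⟩
    exact ⟨h, (ENNReal.lt_div_iff_mul_lt (Or.inl (Metric.measure_ball_pos _ _ h.1).ne')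
      (Or.inl measure_ball_lt_top.ne)).1 h1⟩
  · rintro ⟨h, h1⟩
    exact ⟨h, (ENNReal.lt_div_iff_mul_lt (Or.inl (Metric.measure_ball_pos _ _ h.1).ne')
      (Or.inl measure_ball_lt_top.ne)).2 h1⟩

lemma ML_le {f : F → ℝ≥0∞} {x : F} {r : ℝ} (h0 : 0 < r) (h1 : r < ‖x‖ / 4) :
    ∫⁻ y in Metric.ball x r, f y ≤ ML f x * volume (Metric.ball (0:F) r) := by
  have : (∫⁻ y in Metric.ball x r, f y) / volume (Metric.ball (0:F) r) ≤ ML f x :=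
    le_iSup₂_of_le r ⟨h0, h1⟩ le_rfl
  exact (ENNReal.div_le_iff (Metric.measure_ball_pos _ _ h0).ne' measure_ball_lt_top.ne).1 this

lemma ML_isOpen (f : F → ℝ≥0∞) (t : ℝ≥0∞) : IsOpen {x | t < ML f x} := by
  rw [Metric.isOpen_iff]
  intro x hx
  obtain ⟨r, ⟨h0, h1⟩, h2⟩ := lt_ML_iff.1 hx
  obtain ⟨r', hr', h3⟩ : ∃ r' < r, t * volume (Metric.ball (0:F) r) <
      ∫⁻ y in Metric.ball x r', f y := by
    rw [← withDensity_apply _ Metric.isOpen_ball.measurableSet] at h2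
    have hm : Monotone fun n : ℕ => Metric.ball x (r - 1 / ((n:ℝ) + 1)) := by
      intro m n hmn
      apply Metric.ball_subset_ball
      have : 1 / ((n:ℝ) + 1) ≤ 1 / ((m:ℝ) + 1) := Nat.one_div_le_one_div hmn
      linarith
    have hU : Metric.ball x r = ⋃ n : ℕ, Metric.ball x (r - 1 / ((n:ℝ) + 1)) := by
      ext y
      simp only [mem_iUnion, Metric.mem_ball]
      constructor
      · intro h
        obtain ⟨n, hn⟩ := exists_nat_one_div_lt (sub_pos.2 h)
        exact ⟨n, by linarith⟩
      · rintro ⟨n, hn⟩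
        have : 0 < 1 / ((n:ℝ) + 1) := Nat.one_div_pos_of_nat
        linarith
    rw [hU, hm.measure_iUnion, lt_iSup_iff] at h2
    obtain ⟨n, hn⟩ := h2
    refine ⟨r - 1 / ((n:ℝ) + 1), ?_, ?_⟩
    · have : 0 < 1 / ((n:ℝ) + 1) := Nat.one_div_pos_of_nat
      linarith
    · rw [← withDensity_apply _ Metric.isOpen_ball.measurableSet]
      exact hn
  refine ⟨min (r - r') (‖x‖ - 4 * r), lt_min (by linarith) (by linarith), fun x' hx' => ?_⟩
  rw [Metric.mem_ball] at hx'
  have a1 := lt_of_lt_of_le hx' (min_le_left _ _)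
  have a2 := lt_of_lt_of_le hx' (min_le_right _ _)
  refine lt_ML_iff.2 ⟨r, ⟨h0, ?_⟩, lt_of_lt_of_le h3 (lintegral_mono_set ?_)⟩
  · have := norm_sub_norm_le x x'
    rw [dist_comm, dist_eq_norm] at a2
    linarith
  · refine Metric.ball_subset_ball' ?_
    rw [dist_comm] at a1; linarith

lemma ML_meas (f : F → ℝ≥0∞) : Measurable (ML f) :=
  measurable_of_Ioi fun t => (ML_isOpen f t).measurableSet

lemma ML_weak (hM : 1 ≤ Module.finrank ℝ F) (f : F → ℝ≥0∞) (t : ℝ≥0∞) :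
    t * volume {x | t < ML f x} ≤ 5 ^ Module.finrank ℝ F * ∫⁻ y, f y := by
  have : Nontrivial F := Module.nontrivial_of_finrank_pos (R := ℝ) hM
  have main : ∀ n : ℕ, t * volume ({x | t < ML f x} ∩ Metric.ball (0:F) n) ≤
      5 ^ Module.finrank ℝ F * ∫⁻ y, f y := by
    intro n
    set A := {x | t < ML f x} ∩ Metric.ball (0:F) n with hA
    have hex : ∀ x : F, ∃ r : ℝ, x ∈ A → (0 < r ∧ r ≤ n / 4) ∧
        t * volume (Metric.ball (0:F) r) ≤ ∫⁻ y in Metric.ball x r, f y := by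
      intro x
      by_cases hx : x ∈ A
      · obtain ⟨r, ⟨h0, h1⟩, h2⟩ := lt_ML_iff.1 hx.1
        refine ⟨r, fun _ => ⟨⟨h0, ?_⟩, h2.le⟩⟩
        have := mem_ball_zero_iff.1 hx.2
        linarith
      · exact ⟨0, fun h => absurd h hx⟩
    choose r hr using hex
    obtain ⟨u, huA, hdisj, hcov⟩ := Vitali.exists_disjoint_subfamily_covering_enlargement_closedBall
      A (fun x => x) r (n / 4) (fun a ha => (hr a ha).1.2) 5 (by norm_num)
    have hcount : u.Countable := by
      refine hdisj.countable_of_nonempty_interior fun i hi => ?_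
      exact ⟨i, (interior_mono Metric.ball_subset_closedBall)
        (by rw [Metric.isOpen_ball.interior_eq]
            exact Metric.mem_ball_self (hr i (huA hi)).1.1)⟩
    have hsub : A ⊆ ⋃ b ∈ u, Metric.closedBall b (5 * r b) := fun a ha => by
      obtain ⟨b, hb, h⟩ := hcov a ha
      exact mem_biUnion hb (h (Metric.mem_closedBall_self (hr a ha).1.1.le))
    calc t * volume A ≤ t * ∑' b : u, volume (Metric.closedBall (b:F) (5 * r b)) := by
          gcongr
          exact (measure_mono hsub).trans (measure_biUnion_le _ hcount _)
      _ = ∑' b : u, t * volume (Metric.closedBall (b:F) (5 * r b)) := ENNReal.tsum_mul_left.symm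
      _ ≤ ∑' b : u, 5 ^ Module.finrank ℝ F * ∫⁻ y in Metric.closedBall (b:F) (r b), f y := by
          refine ENNReal.tsum_le_tsum fun b => ?_
          have hb := hr b (huA b.2)
          rw [Measure.addHaar_closedBall_mul _ _ (by norm_num) hb.1.1.le,
            Measure.addHaar_closedBall_eq_addHaar_ball, mul_left_comm,
            show ENNReal.ofReal (5 ^ Module.finrank ℝ F) = 5 ^ Module.finrank ℝ F by
              rw [ENNReal.ofReal_pow (by norm_num)]; norm_num]
          gcongr 1
          exact hb.2.trans (lintegral_mono_set Metric.ball_subset_closedBall)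
      _ = 5 ^ Module.finrank ℝ F * ∫⁻ y in ⋃ b ∈ u, Metric.closedBall b (r b), f y := by
          rw [ENNReal.tsum_mul_left, lintegral_biUnion hcount
            (fun i _ => Metric.isClosed_closedBall.measurableSet) hdisj]
      _ ≤ _ := by gcongr 1; exact setLIntegral_le_lintegral _ _
  have hU : {x | t < ML f x} = ⋃ n : ℕ, {x | t < ML f x} ∩ Metric.ball (0:F) n := by
    rw [← inter_iUnion, Metric.iUnion_ball_nat, inter_univ]
  have hm : Monotone fun n : ℕ => {x | t < ML f x} ∩ Metric.ball (0:F) n := by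
    intro m n h
    exact inter_subset_inter_right _ (Metric.ball_subset_ball (by exact_mod_cast h))
  rw [hU, hm.measure_iUnion, ENNReal.mul_iSup]
  exact iSup_le main

lemma ML_trunc {f : F → ℝ≥0∞} (hf : Measurable f) (t : ℝ≥0∞) :
    {x | 2 * t < ML f x} ⊆ {x | t < ML ({y | t < f y}.indicator f) x} := by
  intro x hx
  obtain ⟨r, hr, h⟩ := lt_ML_iff.1 hx
  refine lt_ML_iff.2 ⟨r, hr, ?_⟩
  have hv : volume (Metric.ball x r) = volume (Metric.ball (0:F) r) :=
    Measure.addHaar_ball_center _ _ _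
  by_contra hcon
  push Not at hcon
  have : ∫⁻ y in Metric.ball x r, f y ≤ 2 * t * volume (Metric.ball (0:F) r) := by
    calc ∫⁻ y in Metric.ball x r, f y
        ≤ ∫⁻ y in Metric.ball x r, ({y | t < f y}.indicator f y + t) := by
          refine lintegral_mono fun y => ?_
          by_cases hy : t < f y
          · rw [indicator_of_mem (by exact hy)]; exact le_self_add
          · exact (not_lt.1 hy).trans le_add_self
      _ = (∫⁻ y in Metric.ball x r, {y | t < f y}.indicator f y) +
            t * volume (Metric.ball (0:F) r) := by
          rw [lintegral_add_right _ measurable_const, setLIntegral_const, hv]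
      _ ≤ _ := by rw [two_mul, add_mul]; gcongr
  exact absurd h (not_lt.2 this)

lemma lc_int_fin {s : ℝ} (hs : 0 < s) {X : ℝ} (hX : 0 ≤ X) :
    ∫⁻ t in Ioo (0:ℝ) X, ENNReal.ofReal (t ^ (s - 1)) = ENNReal.ofReal X ^ s / ENNReal.ofReal s := by
  have h1 : ∫ t in (0:ℝ)..X, t ^ (s - 1) = X ^ s / s := by
    rw [integral_rpow (Or.inl (by linarith)), sub_add_cancel, Real.zero_rpow hs.ne', sub_zero]
  have h2 : IntegrableOn (fun t : ℝ => t ^ (s - 1)) (Ioc 0 X) volume := by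
    have := intervalIntegral.intervalIntegrable_rpow' (a := 0) (b := X) (r := s - 1) (by linarith)
    exact (intervalIntegrable_iff_integrableOn_Ioc_of_le hX).1 this
  rw [Measure.restrict_congr_set Ioo_ae_eq_Ioc, ← ofReal_integral_eq_lintegral_ofReal h2,
    ← intervalIntegral.integral_of_le hX, h1, ENNReal.ofReal_div_of_pos hs,
    ENNReal.ofReal_rpow_of_nonneg hX hs.le]
  filter_upwards [ae_restrict_mem measurableSet_Ioc] with t ht
  exact Real.rpow_nonneg ht.1.le _

lemma lc_int {s : ℝ} (hs : 0 < s) (X : ℝ≥0∞) :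
    ∫⁻ t in Ioi (0:ℝ), {t : ℝ | ENNReal.ofReal t < X}.indicator
      (fun t => ENNReal.ofReal (t ^ (s - 1))) t = X ^ s / ENNReal.ofReal s := by
  have hmeas : ∀ X : ℝ≥0∞, MeasurableSet {t : ℝ | ENNReal.ofReal t < X} := fun X =>
    measurableSet_lt ENNReal.measurable_ofReal measurable_const
  have fin : ∀ X : ℝ≥0∞, X ≠ ∞ → ∫⁻ t in Ioi (0:ℝ), {t : ℝ | ENNReal.ofReal t < X}.indicator
      (fun t => ENNReal.ofReal (t ^ (s - 1))) t = X ^ s / ENNReal.ofReal s := by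
    intro X hX
    have h1 := lc_int_fin hs (X := X.toReal) ENNReal.toReal_nonneg
    rw [ENNReal.ofReal_toReal hX] at h1
    rw [← h1, setLIntegral_indicator (hmeas X)]
    congr 2
    ext t
    simp only [mem_inter_iff, mem_setOf_eq, mem_Ioi, mem_Ioo]
    constructor
    · rintro ⟨h, h0⟩
      exact ⟨h0, (ENNReal.ofReal_lt_iff_lt_toReal h0.le hX).1 h⟩
    · rintro ⟨h0, h⟩
      exact ⟨(ENNReal.ofReal_lt_iff_lt_toReal h0.le hX).2 h, h0⟩
  by_cases hX : X = ∞
  · rw [hX, ENNReal.top_rpow_of_pos hs, ENNReal.top_div_of_ne_top ENNReal.ofReal_ne_top]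
    refine ENNReal.eq_top_of_forall_nnreal_le fun r => ?_
    set Y : ℝ≥0∞ := (ENNReal.ofReal s * r) ^ (1 / s) with hY
    have hYt : Y ≠ ∞ := ENNReal.rpow_ne_top_of_nonneg (by positivity)
      (ENNReal.mul_ne_top ENNReal.ofReal_ne_top ENNReal.coe_ne_top)
    have h1 := fin Y hYt
    rw [hY, ← ENNReal.rpow_mul, one_div_mul_cancel hs.ne', ENNReal.rpow_one,
      mul_comm, ENNReal.mul_div_cancel_right (by simpa using hs) ENNReal.ofReal_ne_top] at h1
    rw [← h1]
    refine lintegral_mono fun t => indicator_le_indicator_of_subset ?_ (fun _ => zero_le) t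
    intro t ht
    exact ENNReal.ofReal_lt_top
  · exact fin X hX

lemma lc_swap {s : ℝ} (hs : 0 < s) {g h : F → ℝ≥0∞} (hg : Measurable g) (hh : Measurable h) :
    ∫⁻ x, h x * ((g x) ^ s / ENNReal.ofReal s) =
      ∫⁻ t in Ioi (0:ℝ), ENNReal.ofReal (t ^ (s - 1)) *
        ∫⁻ x in {x | ENNReal.ofReal t < g x}, h x := by
  have hS : MeasurableSet {z : F × ℝ | ENNReal.ofReal z.2 < g z.1} :=
    measurableSet_lt (by fun_prop) (by fun_prop)
  have hm : Measurable (Function.uncurry fun (x : F) (t : ℝ) =>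
      h x * {t : ℝ | ENNReal.ofReal t < g x}.indicator
        (fun t => ENNReal.ofReal (t ^ (s - 1))) t) := by
    have h2 : Measurable ({z : F × ℝ | ENNReal.ofReal z.2 < g z.1}.indicator
        (fun z => ENNReal.ofReal (z.2 ^ (s - 1)))) := by
      refine Measurable.indicator ?_ hS
      exact ENNReal.measurable_ofReal.comp (measurable_snd.pow_const _)
    exact (hh.comp measurable_fst).mul h2
  have hm1 : ∀ x, Measurable ({t : ℝ | ENNReal.ofReal t < g x}.indicator
        (fun t => ENNReal.ofReal (t ^ (s - 1)))) := fun x =>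
    (ENNReal.measurable_ofReal.comp (measurable_id.pow_const _)).indicator
      (measurableSet_lt ENNReal.measurable_ofReal measurable_const)
  calc _ = ∫⁻ x, ∫⁻ t in Ioi (0:ℝ), h x * {t : ℝ | ENNReal.ofReal t < g x}.indicator
        (fun t => ENNReal.ofReal (t ^ (s - 1))) t := by
        congr 1; ext x
        rw [lintegral_const_mul _ (hm1 x), lc_int hs]
    _ = ∫⁻ t in Ioi (0:ℝ), ∫⁻ x, h x * {t : ℝ | ENNReal.ofReal t < g x}.indicator
        (fun t => ENNReal.ofReal (t ^ (s - 1))) t := lintegral_lintegral_swap hm.aemeasurable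
    _ = _ := by
        congr 1; ext t
        rw [← lintegral_const_mul _ hh, ← lintegral_indicator (measurableSet_lt measurable_const hg)]
        congr 1; ext x
        by_cases hx : ENNReal.ofReal t < g x
        · rw [indicator_of_mem (by exact hx), indicator_of_mem (by exact hx), mul_comm]
        · rw [indicator_of_notMem (by exact hx), indicator_of_notMem (by exact hx), mul_zero]

lemma ML_strong (hM : 1 ≤ Module.finrank ℝ F) {q : ℝ} (hq : 1 < q) :
    ∃ C : ℝ≥0∞, C ≠ ∞ ∧ ∀ f : F → ℝ≥0∞, Measurable f →
      ∫⁻ x, (ML f x) ^ q ≤ C * ∫⁻ x, (f x) ^ q := by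
  refine ⟨2 ^ q * (ENNReal.ofReal q * (5 ^ Module.finrank ℝ F * (ENNReal.ofReal (q - 1))⁻¹)),
    ?_, fun f hf => ?_⟩
  · refine ENNReal.mul_ne_top (ENNReal.rpow_ne_top_of_nonneg (by linarith) (by norm_num))
      (ENNReal.mul_ne_top ENNReal.ofReal_ne_top (ENNReal.mul_ne_top (by simp) ?_))
    rw [ENNReal.inv_ne_top]
    simpa using hq
  have hq0 : ENNReal.ofReal q ≠ 0 := by simp; linarith
  have e1 : ∀ x, (ML f x) ^ q =
      2 ^ q * (ENNReal.ofReal q * (1 * ((ML f x / 2) ^ q / ENNReal.ofReal q))) := fun x => by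
    rw [one_mul, ENNReal.mul_div_cancel hq0 ENNReal.ofReal_ne_top,
      ← ENNReal.mul_rpow_of_nonneg _ _ (by linarith), ENNReal.mul_div_cancel (by norm_num) (by norm_num)]
  have hMLm : Measurable fun x => ML f x / 2 := (ML_meas f).div_const 2
  simp_rw [e1]
  rw [lintegral_const_mul _ (by fun_prop), lintegral_const_mul _ (by fun_prop),
    lc_swap (by linarith) hMLm measurable_const]
  simp only [mul_assoc]
  gcongr 2
  calc ∫⁻ t in Ioi (0:ℝ), ENNReal.ofReal (t ^ (q - 1)) *
        ∫⁻ x in {x | ENNReal.ofReal t < ML f x / 2}, 1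
      ≤ ∫⁻ t in Ioi (0:ℝ), 5 ^ Module.finrank ℝ F * (ENNReal.ofReal (t ^ (q - 1 - 1)) *
        ∫⁻ x in {x | ENNReal.ofReal t < f x}, f x) := by
        refine lintegral_mono_ae ?_
        filter_upwards [ae_restrict_mem measurableSet_Ioi] with t ht
        rw [setLIntegral_const, one_mul]
        have ht' : (0:ℝ) < t := ht
        have hsub : {x | ENNReal.ofReal t < ML f x / 2} ⊆ {x | ENNReal.ofReal t <
            ML ({y | ENNReal.ofReal t < f y}.indicator f) x} := by
          refine Subset.trans ?_ (ML_trunc hf (ENNReal.ofReal t))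
          intro x hx
          rw [mem_setOf_eq, ENNReal.lt_div_iff_mul_lt (by simp) (by simp)] at hx
          rw [mem_setOf_eq, mul_comm]; exact hx
        have hw := ML_weak hM ({y | ENNReal.ofReal t < f y}.indicator f) (ENNReal.ofReal t)
        rw [lintegral_indicator (measurableSet_lt measurable_const hf)] at hw
        have ht2 : ENNReal.ofReal (t ^ (q - 1)) = ENNReal.ofReal (t ^ (q - 1 - 1)) * ENNReal.ofReal t := by
          rw [← ENNReal.ofReal_mul (by positivity)]
          congr 1
          conv_rhs => rw [← Real.rpow_one t, ← Real.rpow_mul ht'.le, one_mul, ← Real.rpow_add ht']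
          congr 1; ring
        calc _ = ENNReal.ofReal (t ^ (q - 1 - 1)) *
              (ENNReal.ofReal t * volume {x | ENNReal.ofReal t < ML f x / 2}) := by
              rw [ht2, mul_assoc]
          _ ≤ ENNReal.ofReal (t ^ (q - 1 - 1)) * (5 ^ Module.finrank ℝ F *
              ∫⁻ x in {x | ENNReal.ofReal t < f x}, f x) := by
              gcongr 1
              exact le_trans (by gcongr) hw
          _ = _ := by ring
    _ = 5 ^ Module.finrank ℝ F * ∫⁻ t in Ioi (0:ℝ), (ENNReal.ofReal (t ^ (q - 1 - 1)) *
        ∫⁻ x in {x | ENNReal.ofReal t < f x}, f x) := lintegral_const_mul' _ _ (by simp)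
    _ = _ := by
        rw [← lc_swap (by linarith) hf hf]; congr 1
        rw [← lintegral_const_mul _ (by fun_prop)]; congr 1; ext x
        rw [div_eq_mul_inv, ← mul_assoc, mul_comm]
        congr 1
        conv_rhs => rw [show q = 1 + (q - 1) by ring,
          ENNReal.rpow_add_of_nonneg _ _ (by norm_num) (by linarith), ENNReal.rpow_one]

lemma ML_weighted (hM : 1 ≤ Module.finrank ℝ F) {q a : ℝ} (hq : 1 < q) (ha : 0 ≤ a) :
    ∃ C : ℝ≥0∞, C ≠ ∞ ∧ ∀ f : F → ℝ≥0∞, Measurable f →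
      ∫⁻ x : F, ‖x‖ₑ ^ a * (ML f x) ^ q ≤ C * ∫⁻ x : F, ‖x‖ₑ ^ a * (f x) ^ q := by
  obtain ⟨C, hC, h⟩ := ML_strong (F := F) hM hq
  refine ⟨2 ^ a * C, ENNReal.mul_ne_top (ENNReal.rpow_ne_top_of_nonneg ha (by norm_num)) hC,
    fun f hf => ?_⟩
  have hq0 : 0 < q := by linarith
  have hgm : Measurable fun y : F => ‖y‖ₑ ^ (a / q) * f y := by fun_prop
  have key : ∀ x : F, ‖x‖ₑ ^ (a / q) * ML f x ≤
      2 ^ (a / q) * ML (fun y => ‖y‖ₑ ^ (a / q) * f y) x := by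
    intro x
    unfold ML
    simp_rw [ENNReal.mul_iSup]
    refine iSup₂_mono fun r hr => ?_
    rw [← mul_div_assoc, ← mul_div_assoc]
    gcongr 1
    rw [← lintegral_const_mul _ hf, ← lintegral_const_mul _ hgm]
    refine setLIntegral_mono (by fun_prop) fun y hy => ?_
    rw [← mul_assoc]
    gcongr 1
    rw [← ENNReal.mul_rpow_of_nonneg _ _ (by positivity)]
    refine ENNReal.rpow_le_rpow ?_ (by positivity)
    rw [← ofReal_norm, ← ofReal_norm, show (2:ℝ≥0∞) = ENNReal.ofReal 2 by simp,
      ← ENNReal.ofReal_mul (by norm_num)]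
    apply ENNReal.ofReal_le_ofReal
    have h1 := norm_sub_norm_le x y
    have h2 := mem_ball_iff_norm'.1 hy
    have := norm_nonneg x
    linarith
  have hpw : ∀ (x : F) (X : ℝ≥0∞), ‖x‖ₑ ^ a * X ^ q = (‖x‖ₑ ^ (a / q) * X) ^ q := fun x X => by
    rw [ENNReal.mul_rpow_of_nonneg _ _ hq0.le, ← ENNReal.rpow_mul, div_mul_cancel₀ _ hq0.ne']
  simp_rw [hpw]
  calc _ ≤ ∫⁻ x, 2 ^ a * (ML (fun y : F => ‖y‖ₑ ^ (a / q) * f y) x) ^ q := by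
        refine lintegral_mono fun x => ?_
        refine (ENNReal.rpow_le_rpow (key x) hq0.le).trans (le_of_eq ?_)
        rw [ENNReal.mul_rpow_of_nonneg _ _ hq0.le, ← ENNReal.rpow_mul, div_mul_cancel₀ _ hq0.ne']
    _ = 2 ^ a * ∫⁻ x, (ML (fun y : F => ‖y‖ₑ ^ (a / q) * f y) x) ^ q :=
        lintegral_const_mul _ ((ML_meas _).pow_const _)
    _ ≤ 2 ^ a * (C * _) := by gcongr 1; exact h _ hgm
    _ = _ := by rw [mul_assoc]

end maximal

open Set MeasureTheory Filter Topology

set_option linter.unusedSectionVars false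

section pointwise
open scoped ENNReal

variable {F : Type*} [NormedAddCommGroup F] [InnerProductSpace ℝ F] [FiniteDimensional ℝ F]
  [MeasurableSpace F] [BorelSpace F]

lemma rad_ML (hM : 1 ≤ Module.finrank ℝ F) {k : F → ℝ≥0∞} (hkm : Measurable k)
    (hk : ∀ z z' : F, ‖z‖ ≤ ‖z'‖ → k z' ≤ k z) {f : F → ℝ≥0∞} (hf : Measurable f)
    {x : F} {ρ : ℝ} (hρ : 0 < ρ) (hρx : ρ < ‖x‖ / 4) :
    ∫⁻ y in Metric.ball x ρ, k (x - y) * f y ≤ (∫⁻ z in Metric.ball (0:F) ρ, k z) * ML f x := by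
  have : Nontrivial F := Module.nontrivial_of_finrank_pos (R := ℝ) hM
  have hbx : MeasurableSet (Metric.ball x ρ) := Metric.isOpen_ball.measurableSet
  have hb0 : MeasurableSet (Metric.ball (0:F) ρ) := Metric.isOpen_ball.measurableSet
  have hkx : Measurable fun y => k (x - y) := hkm.comp (by fun_prop)
  have e1 : ∫⁻ y in Metric.ball x ρ, k (x - y) * f y =
      ∫⁻ y, (Metric.ball x ρ).indicator f y * ((k (x - y)) ^ (1:ℝ) / ENNReal.ofReal 1) := by
    rw [← lintegral_indicator hbx]
    congr 1; ext y
    rw [ENNReal.rpow_one, ENNReal.ofReal_one, div_one]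
    by_cases hy : y ∈ Metric.ball x ρ
    · rw [indicator_of_mem hy, indicator_of_mem hy, mul_comm]
    · rw [indicator_of_notMem hy, indicator_of_notMem hy, zero_mul]
  have e2 : ∫⁻ z in Metric.ball (0:F) ρ, k z =
      ∫⁻ z, (Metric.ball (0:F) ρ).indicator (fun _ => (1:ℝ≥0∞)) z *
        ((k z) ^ (1:ℝ) / ENNReal.ofReal 1) := by
    rw [← lintegral_indicator hb0]
    congr 1; ext y
    rw [ENNReal.rpow_one, ENNReal.ofReal_one, div_one]
    by_cases hy : y ∈ Metric.ball (0:F) ρ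
    · rw [indicator_of_mem hy, indicator_of_mem hy, one_mul]
    · rw [indicator_of_notMem hy, indicator_of_notMem hy, zero_mul]
  rw [e1, e2, lc_swap one_pos hkx (hf.indicator hbx),
    lc_swap one_pos hkm (measurable_const.indicator hb0)]
  refine le_trans (b := ∫⁻ t in Ioi (0:ℝ), (ENNReal.ofReal (t ^ ((1:ℝ) - 1)) *
      ∫⁻ z in {z | ENNReal.ofReal t < k z}, (Metric.ball (0:F) ρ).indicator
        (fun _ => (1:ℝ≥0∞)) z) * ML f x) ?_ ?_
  swap
  · refine le_of_eq (lintegral_mul_const _ ?_)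
    refine Measurable.mul (by fun_prop) (Antitone.measurable ?_)
    intro t t' htt
    refine lintegral_mono_set ?_
    intro z hz
    exact lt_of_le_of_lt (ENNReal.ofReal_le_ofReal htt) hz
  refine lintegral_mono fun t => ?_
  simp only []
  rw [mul_assoc]
  gcongr 1
  rw [setLIntegral_indicator hbx, setLIntegral_indicator hb0, setLIntegral_const, one_mul]
  set S : Set F := Metric.ball (0:F) ρ ∩ {z | ENNReal.ofReal t < k z} with hS
  by_cases hne : S.Nonempty
  swap
  · have : Metric.ball x ρ ∩ {y | ENNReal.ofReal t < k (x - y)} = ∅ := by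
      by_contra h
      obtain ⟨y, hy⟩ := nonempty_iff_ne_empty.2 h
      exact hne ⟨x - y, by rw [mem_ball_zero_iff]; exact mem_ball_iff_norm'.1 hy.1, hy.2⟩
    rw [this]; simp
  have hbdd : BddAbove (norm '' S) := ⟨ρ, by
    rintro _ ⟨z, hz, rfl⟩
    exact (mem_ball_zero_iff.1 hz.1).le⟩
  set r := sSup (norm '' S) with hr
  have hrρ : r ≤ ρ := csSup_le (hne.image _) (by
    rintro _ ⟨z, hz, rfl⟩
    exact (mem_ball_zero_iff.1 hz.1).le)
  have hbS : Metric.ball (0:F) r ⊆ S := by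
    intro z hz
    obtain ⟨_, ⟨z', hz', rfl⟩, hlt⟩ := exists_lt_of_lt_csSup (hne.image _) (mem_ball_zero_iff.1 hz)
    exact ⟨mem_ball_zero_iff.2 (hlt.trans (mem_ball_zero_iff.1 hz'.1)),
      lt_of_lt_of_le hz'.2 (hk _ _ hlt.le)⟩
  have hSb : Metric.ball x ρ ∩ {y | ENNReal.ofReal t < k (x - y)} ⊆ Metric.closedBall x r := by
    intro y hy
    rw [mem_closedBall_iff_norm']
    refine le_csSup hbdd ⟨x - y, ⟨?_, hy.2⟩, rfl⟩
    rw [mem_ball_zero_iff]; exact mem_ball_iff_norm'.1 hy.1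
  have hcb : ∫⁻ y in Metric.closedBall x r, f y = ∫⁻ y in Metric.ball x r, f y := by
    refine setLIntegral_congr ?_
    refine (ae_eq_of_subset_of_measure_ge Metric.ball_subset_closedBall ?_
      Metric.isOpen_ball.nullMeasurableSet ?_).symm
    · rw [Measure.addHaar_closedBall_eq_addHaar_ball]
    · exact measure_closedBall_lt_top.ne
  calc _ ≤ ∫⁻ y in Metric.closedBall x r, f y := lintegral_mono_set hSb
    _ = ∫⁻ y in Metric.ball x r, f y := hcb
    _ ≤ ML f x * volume (Metric.ball (0:F) r) := by
        rcases le_or_gt r 0 with h0 | h0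
        · rw [Metric.ball_eq_empty.2 h0]; simp
        · exact ML_le h0 (by linarith)
    _ ≤ volume S * ML f x := by
        rw [mul_comm]; gcongr

/-- gradient potential -/
noncomputable def gp (f : F → ℝ≥0∞) (x : F) : ℝ≥0∞ :=
  ∫⁻ y, ‖x - y‖ₑ ^ (-((Module.finrank ℝ F : ℝ) - 1)) * f y

lemma gp_split (hM : 3 ≤ Module.finrank ℝ F) :
    ∃ A : ℝ≥0∞, A ≠ ∞ ∧ ∀ f : F → ℝ≥0∞, Measurable f → ∀ x : F, ∀ ρ : ℝ, 0 < ρ → ρ < ‖x‖ / 4 →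
      gp f x ≤ A * ENNReal.ofReal ρ * ML f x + (ENNReal.ofReal ρ)⁻¹ * np f x := by
  have hM' : (3:ℝ) ≤ Module.finrank ℝ F := by exact_mod_cast hM
  set M : ℝ := (Module.finrank ℝ F : ℝ) with hMdef
  obtain ⟨A, hA, h1⟩ := rad_in (F := F) (by omega) (s := M - 1) (by linarith)
  refine ⟨A, hA, fun f hf x ρ hρ hρx => ?_⟩
  have hmb : MeasurableSet (Metric.ball x ρ) := Metric.isOpen_ball.measurableSet
  unfold gp
  rw [← lintegral_add_compl _ hmb]
  gcongr ?_ + ?_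
  · have := rad_ML (F := F) (by omega) (k := fun z => ‖z‖ₑ ^ (-(M - 1))) (meas_pw _)
      (fun z z' hz => rpow_anti (by
        rw [← ofReal_norm, ← ofReal_norm]; exact ENNReal.ofReal_le_ofReal hz) (by linarith)) hf hρ hρx
    refine this.trans (le_of_eq ?_)
    rw [h1 ρ hρ]
    congr 2
    rw [show (M - (M - 1)) = 1 by ring, ENNReal.rpow_one]
  · calc _ ≤ ∫⁻ y in (Metric.ball x ρ)ᶜ, (ENNReal.ofReal ρ)⁻¹ * (nk (x - y) * f y) := by
          refine setLIntegral_mono' hmb.compl fun y hy => ?_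
          rw [← mul_assoc]
          gcongr 1
          have hy1 : ρ ≤ ‖x - y‖ := by
            rw [mem_compl_iff, mem_ball_iff_norm'] at hy; exact not_lt.1 hy
          have hy0 : ‖x - y‖ₑ ≠ 0 := enorm_ne_zero.2 (norm_pos_iff.1 (by linarith))
          rw [show -(M - 1) = -1 + -(M - 2) by ring, ENNReal.rpow_add _ _ hy0 enorm_ne_top]
          unfold nk
          gcongr 1
          rw [ENNReal.rpow_neg_one, ENNReal.inv_le_inv, ← ofReal_norm]
          exact ENNReal.ofReal_le_ofReal hy1
      _ ≤ ∫⁻ y, (ENNReal.ofReal ρ)⁻¹ * (nk (x - y) * f y) := setLIntegral_le_lintegral _ _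
      _ = _ := by
          rw [lintegral_const_mul _ ?_]
          · rfl
          · exact (nk_meas.comp (by fun_prop)).mul hf

lemma hed_real {g A m n R : ℝ} (hg : 0 ≤ g) (hA : 0 ≤ A) (hm : 0 ≤ m) (hn : 0 ≤ n) (hR : 0 < R)
    (h : ∀ ρ, 0 < ρ → ρ < R → g ≤ A * ρ * m + ρ⁻¹ * n) :
    g ^ 2 ≤ (A + 2) ^ 2 * (n * m + n ^ 2 / R ^ 2) := by
  have hlast : m * R ^ 2 ≤ n → g ^ 2 ≤ (A + 2) ^ 2 * (n * m + n ^ 2 / R ^ 2) := by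
    intro hmn
    have h1 := h (R / 2) (by linarith) (by linarith)
    have h2 : m ≤ n / R ^ 2 := by rw [le_div_iff₀ (by positivity)]; exact hmn
    have h3 : g ≤ (A + 2) * (n / R) := by
      calc g ≤ A * (R / 2) * m + (R / 2)⁻¹ * n := h1
        _ ≤ A * (R / 2) * (n / R ^ 2) + (R / 2)⁻¹ * n := by gcongr
        _ = (A / 2 + 2) * (n / R) := by field_simp
        _ ≤ _ := by gcongr; linarith
    calc g ^ 2 ≤ ((A + 2) * (n / R)) ^ 2 := by gcongr
      _ = (A + 2) ^ 2 * (0 + n ^ 2 / R ^ 2) := by ring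
      _ ≤ _ := by gcongr; positivity
  rcases hn.eq_or_lt with h0 | h0
  · subst h0
    have : g ≤ 0 := by
      refine le_of_forall_pos_le_add fun e he => ?_
      have h1 := h (min (R / 2) (e / (A * m + 1))) (by positivity)
        (lt_of_le_of_lt (min_le_left _ _) (by linarith))
      have h2 : A * min (R / 2) (e / (A * m + 1)) * m ≤ e := by
        calc A * min (R / 2) (e / (A * m + 1)) * m ≤ A * (e / (A * m + 1)) * m := by
              gcongr; exact min_le_right _ _
          _ = e * (A * m / (A * m + 1)) := by ring
          _ ≤ e * 1 := by
              gcongr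
              rw [div_le_one (by positivity)]; linarith
          _ = e := mul_one e
      linarith
    have : g = 0 := le_antisymm this hg
    subst this
    simp
  rcases le_or_gt (m * R ^ 2) n with h1 | h1
  · exact hlast h1
  have hm0 : 0 < m := by
    by_contra hc
    have : m = 0 := le_antisymm (not_lt.1 hc) hm
    subst this; linarith
  have hs : 0 < √(n / m) := Real.sqrt_pos.2 (by positivity)
  have hsq : √(n / m) ^ 2 = n / m := Real.sq_sqrt (by positivity)
  have hsR : √(n / m) < R := by
    rw [Real.sqrt_lt' hR, div_lt_iff₀ hm0]; linarith
  have h2 := h _ hs hsR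
  have h3 : g ≤ (A + 1) * (√(n / m) * m) := by
    have : (√(n / m))⁻¹ * n = √(n / m) * m := by
      field_simp
      rw [hsq]; field_simp
    rw [this] at h2
    linarith
  calc g ^ 2 ≤ ((A + 1) * (√(n / m) * m)) ^ 2 := by gcongr
    _ = (A + 1) ^ 2 * (√(n / m) ^ 2 * m ^ 2) := by ring
    _ = (A + 1) ^ 2 * (n * m) := by rw [hsq]; field_simp
    _ ≤ (A + 2) ^ 2 * (n * m + n ^ 2 / R ^ 2) := by
        gcongr
        · linarith
        · have : 0 ≤ n ^ 2 / R ^ 2 := by positivity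
          linarith

lemma hedberg (hM : 3 ≤ Module.finrank ℝ F) :
    ∃ C : ℝ, 0 < C ∧ ∀ f : F → ℝ≥0∞, Measurable f → ∀ x : F, x ≠ 0 → np f x ≠ ∞ → ML f x ≠ ∞ →
      gp f x ≠ ∞ ∧ (gp f x).toReal ^ 2 ≤ C * ((np f x).toReal * (ML f x).toReal +
        (np f x).toReal ^ 2 / ‖x‖ ^ 2) := by
  obtain ⟨A, hA, h⟩ := gp_split (F := F) hM
  refine ⟨(A.toReal + 2) ^ 2 * 16, by positivity, fun f hf x hx hn hm => ?_⟩
  have hx0 : 0 < ‖x‖ := norm_pos_iff.2 hx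
  have hfin : ∀ ρ : ℝ, 0 < ρ →
      A * ENNReal.ofReal ρ * ML f x + (ENNReal.ofReal ρ)⁻¹ * np f x ≠ ∞ := fun ρ hρ =>
    ENNReal.add_ne_top.2 ⟨ENNReal.mul_ne_top (ENNReal.mul_ne_top hA ENNReal.ofReal_ne_top) hm,
      ENNReal.mul_ne_top (by simpa using hρ) hn⟩
  have hg : gp f x ≠ ∞ := ne_top_of_le_ne_top (hfin (‖x‖ / 8) (by positivity))
    (h f hf x (‖x‖ / 8) (by positivity) (by linarith))
  refine ⟨hg, ?_⟩
  have h1 := hed_real (g := (gp f x).toReal) (A := A.toReal) (m := (ML f x).toReal)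
    (n := (np f x).toReal) (R := ‖x‖ / 4) ENNReal.toReal_nonneg ENNReal.toReal_nonneg
    ENNReal.toReal_nonneg ENNReal.toReal_nonneg (by positivity) (fun ρ hρ hρ2 => by
      have h2 := ENNReal.toReal_mono (hfin ρ hρ) (h f hf x ρ hρ hρ2)
      rw [ENNReal.toReal_add (ENNReal.mul_ne_top (ENNReal.mul_ne_top hA ENNReal.ofReal_ne_top) hm)
        (ENNReal.mul_ne_top (by simpa using hρ) hn)] at h2
      simpa [ENNReal.toReal_mul, ENNReal.toReal_inv, ENNReal.toReal_ofReal hρ.le] using h2)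
  refine h1.trans ?_
  rw [mul_assoc]
  gcongr
  have : 0 ≤ (np f x).toReal * (ML f x).toReal := by positivity
  have h4 : (np f x).toReal ^ 2 / (‖x‖ / 4) ^ 2 = 16 * ((np f x).toReal ^ 2 / ‖x‖ ^ 2) := by
    field_simp; norm_num
  rw [h4]; linarith

end pointwise

open Set MeasureTheory Filter Topology

set_option linter.unusedSectionVars false

section adm
open scoped ENNReal

variable {F : Type*} [NormedAddCommGroup F] [InnerProductSpace ℝ F] [FiniteDimensional ℝ F]
  [MeasurableSpace F] [BorelSpace F]

/-- admissible densities -/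
structure Adm (f : F → ℝ≥0∞) (L r R : ℝ) : Prop where
  meas : Measurable f
  L0 : 0 ≤ L
  r0 : 0 < r
  le : ∀ x, f x ≤ ENNReal.ofReal L
  zin : ∀ x, ‖x‖ < r → f x = 0
  zout : ∀ x, R < ‖x‖ → f x = 0

lemma lint_kern {k : F → ℝ≥0∞} (hk : Measurable k) {f : F → ℝ≥0∞} (hf : Measurable f) (x : F) :
    ∫⁻ y, k (x - y) ∂(volume.withDensity f) = ∫⁻ y, k (x - y) * f y := by
  rw [lintegral_withDensity_eq_lintegral_mul _ hf (g := fun y => k (x - y)) (hk.comp (by fun_prop))]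
  refine lintegral_congr fun y => ?_
  simp [mul_comm]

namespace Adm
variable {f : F → ℝ≥0∞} {L r R : ℝ}

lemma supp (h : Adm f L r R) : (volume.withDensity f) (Metric.closedBall (0:F) R)ᶜ = 0 := by
  rw [withDensity_apply _ Metric.isClosed_closedBall.measurableSet.compl]
  rw [setLIntegral_congr_fun (g := fun _ => 0) Metric.isClosed_closedBall.measurableSet.compl]
  · simp
  · intro x hx
    refine h.zout x ?_
    simpa using hx

lemma mass (h : Adm f L r R) : ∫⁻ x, f x ≠ ∞ := by
  have h1 : ∫⁻ x, f x ≤ ∫⁻ x in Metric.closedBall (0:F) R, ENNReal.ofReal L := by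
    rw [← lintegral_indicator Metric.isClosed_closedBall.measurableSet]
    refine lintegral_mono fun x => ?_
    by_cases hx : x ∈ Metric.closedBall (0:F) R
    · rw [indicator_of_mem hx]; exact h.le x
    · rw [h.zout x (by simpa using hx)]; exact zero_le
  refine ne_top_of_le_ne_top ?_ h1
  rw [setLIntegral_const]
  exact ENNReal.mul_ne_top ENNReal.ofReal_ne_top (isCompact_closedBall _ _).measure_lt_top.ne

lemma fin (h : Adm f L r R) : IsFiniteMeasure (volume.withDensity f) :=
  isFiniteMeasure_withDensity h.mass

lemma ker_ofReal (h : Adm f L r R) {g : F → ℝ} (hg : Continuous g) (h0 : ∀ x, 0 ≤ g x) (x : F) :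
    ENNReal.ofReal (∫ y, g (x - y) ∂(volume.withDensity f)) =
      ∫⁻ y, ENNReal.ofReal (g (x - y)) * f y := by
  have := h.fin
  rw [ofReal_integral_eq_lintegral_ofReal
    (pot_integrable _ (isCompact_closedBall _ _) h.supp one_pos hg x)
    (Eventually.of_forall fun y => h0 _)]
  exact lint_kern (k := fun z => ENNReal.ofReal (g z)) (by fun_prop) h.meas x

lemma near (h : Adm f L r R) (hM : 3 ≤ Module.finrank ℝ F) :
    ∃ A : ℝ, 0 < A ∧ ∀ x : F, ∀ s : ℝ, 0 < s → 
      ∫⁻ y in Metric.ball x s, nk (x - y) * f y ≤ ENNReal.ofReal (A * s ^ 2) := by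
  have hM' : (3:ℝ) ≤ Module.finrank ℝ F := by exact_mod_cast hM
  set M : ℝ := (Module.finrank ℝ F : ℝ) with hMdef
  obtain ⟨A, hA, h1⟩ := rad_in (F := F) (by omega) (s := M - 2) (by linarith)
  refine ⟨A.toReal * L + 1, by have := h.L0; positivity, fun x s hs => ?_⟩
  have e : ∫⁻ y in Metric.ball x s, nk (x - y) = ∫⁻ z in Metric.ball (0:F) s, nk z := by
    rw [← lintegral_indicator Metric.isOpen_ball.measurableSet,
      ← lintegral_indicator Metric.isOpen_ball.measurableSet,
      ← lintegral_sub_left_eq_self _ x]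
    refine lintegral_congr fun y => ?_
    by_cases hy : y ∈ Metric.ball (0:F) s
    · rw [indicator_of_mem hy, indicator_of_mem, sub_sub_cancel]
      rw [mem_ball_iff_norm', sub_sub_cancel]; exact mem_ball_zero_iff.1 hy
    · rw [indicator_of_notMem hy, indicator_of_notMem]
      rw [mem_ball_iff_norm', sub_sub_cancel]; exact fun h => hy (mem_ball_zero_iff.2 h)
  calc ∫⁻ y in Metric.ball x s, nk (x - y) * f y 
      ≤ ∫⁻ y in Metric.ball x s, nk (x - y) * ENNReal.ofReal L := by
        refine lintegral_mono fun y => ?_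
        exact mul_le_mul_right (h.le y) _
    _ = A * ENNReal.ofReal s ^ (2:ℝ) * ENNReal.ofReal L := by
        rw [lintegral_mul_const _ (show Measurable fun y => nk (x - y) from nk_meas.comp (by fun_prop)), e]
        change (∫⁻ z in Metric.ball (0:F) s, ‖z‖ₑ ^ (-(M - 2))) * _ = _
        rw [h1 s hs]; congr 3; ring
    _ = ENNReal.ofReal (A.toReal * s ^ 2 * L) := by
        rw [ENNReal.ofReal_mul (by positivity), ENNReal.ofReal_mul (by positivity),
          ENNReal.ofReal_toReal hA, ENNReal.ofReal_rpow_of_pos hs, Real.rpow_two]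
    _ ≤ _ := ENNReal.ofReal_le_ofReal (by nlinarith [sq_nonneg s])

lemma nk_out {z : F} (hM : 3 ≤ Module.finrank ℝ F) {s : ℝ} (hs : 0 < s) (hz : s ≤ ‖z‖) :
    nk z ≤ ENNReal.ofReal (s ^ (-((Module.finrank ℝ F : ℝ) - 2))) := by
  have hM' : (3:ℝ) ≤ Module.finrank ℝ F := by exact_mod_cast hM
  rw [← ENNReal.ofReal_rpow_of_pos hs]
  refine rpow_anti ?_ (by linarith)
  rw [← ofReal_norm]; exact ENNReal.ofReal_le_ofReal hz

lemma np_bdd (h : Adm f L r R) (hM : 3 ≤ Module.finrank ℝ F) :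
    ∃ N : ℝ, 0 < N ∧ ∀ x : F, np f x ≤ ENNReal.ofReal N := by
  obtain ⟨A, hA, h1⟩ := h.near hM
  refine ⟨A * 1 ^ 2 + (∫⁻ x, f x).toReal, by positivity, fun x => ?_⟩
  unfold np
  rw [← lintegral_add_compl _ (Metric.isOpen_ball (x := x) (ε := 1)).measurableSet,
    ENNReal.ofReal_add (by positivity) (by positivity), ENNReal.ofReal_toReal h.mass]
  gcongr 1
  · exact h1 x 1 one_pos
  · refine le_trans (setLIntegral_mono' (Metric.isOpen_ball).measurableSet.compl 
      (g := f) fun y hy => ?_) (setLIntegral_le_lintegral _ _)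
    have := nk_out (z := x - y) hM one_pos (by 
      rw [mem_compl_iff, mem_ball_iff_norm'] at hy; exact not_lt.1 hy)
    rw [Real.one_rpow, ENNReal.ofReal_one] at this
    calc _ ≤ 1 * f y := mul_le_mul_left this _
      _ = _ := one_mul _

end Adm

lemma Gam_le (hM : 3 ≤ Module.finrank ℝ F) {ε : ℝ} (hε : 0 < ε) {x : F} (hx : x ≠ 0) :
    Gam ε x ≤ ‖x‖ ^ (-((Module.finrank ℝ F : ℝ) - 2)) := by
  have hM' : (3:ℝ) ≤ Module.finrank ℝ F := by exact_mod_cast hM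
  have hx' := norm_pos_iff.2 hx
  unfold Gam rp
  rw [show ‖x‖ ^ (-((Module.finrank ℝ F : ℝ) - 2)) = 
    (‖x‖ ^ 2) ^ (-((Module.finrank ℝ F : ℝ) - 2) / 2) by
      rw [← Real.rpow_natCast, ← Real.rpow_mul hx'.le]; congr 1; push_cast; ring]
  exact Real.rpow_le_rpow_of_nonpos (by positivity) (by nlinarith) (by linarith)

lemma nk_real {x : F} (hx : x ≠ 0) :
    nk x = ENNReal.ofReal (‖x‖ ^ (-((Module.finrank ℝ F : ℝ) - 2))) := by
  rw [nk, enorm_pw_real hx, Real.enorm_eq_ofReal (by positivity)]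

lemma Gam_le_nk (hM : 3 ≤ Module.finrank ℝ F) {ε : ℝ} (hε : 0 < ε) (x : F) :
    ENNReal.ofReal (Gam ε x) ≤ nk x := by
  have hM' : (3:ℝ) ≤ Module.finrank ℝ F := by exact_mod_cast hM
  by_cases hx : x = 0
  · have : nk x = ∞ := by
      rw [nk, hx, enorm_zero, ENNReal.zero_rpow_of_neg (by linarith)]
    rw [this]; exact le_top
  · rw [nk_real hx]
    exact ENNReal.ofReal_le_ofReal (Gam_le hM hε hx)

lemma pot_le_np (hM : 3 ≤ Module.finrank ℝ F) {f : F → ℝ≥0∞} {L r R : ℝ} (h : Adm f L r R)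
    {κ : ℝ} (hκ : 0 < κ) (x : F) : 
    ENNReal.ofReal (pot κ (volume.withDensity f) x) ≤ np f x := by
  unfold pot
  rw [h.ker_ofReal (Gam_continuous hκ) (fun z => (Gam_pos hκ z).le)]
  refine lintegral_mono fun y => mul_le_mul_left (Gam_le_nk hM hκ _) _

lemma nk_le_Gam (hM : 3 ≤ Module.finrank ℝ F) {κ s : ℝ} (hκ : 0 < κ) (hs : 0 < s) {x : F} 
    (hx : s ≤ ‖x‖) :
    nk x ≤ ENNReal.ofReal ((1 + κ ^ 2 / s ^ 2) ^ (((Module.finrank ℝ F : ℝ) - 2) / 2)) * 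
      ENNReal.ofReal (Gam κ x) := by
  have hM' : (3:ℝ) ≤ Module.finrank ℝ F := by exact_mod_cast hM
  have hx' : 0 < ‖x‖ := by linarith
  rw [nk_real (norm_pos_iff.1 hx'), ← ENNReal.ofReal_mul (by positivity)]
  refine ENNReal.ofReal_le_ofReal ?_
  unfold Gam rp
  set e := ((Module.finrank ℝ F : ℝ) - 2) / 2 with he
  rw [show -((Module.finrank ℝ F : ℝ) - 2) / 2 = -e by rw [he]; ring,
    show -((Module.finrank ℝ F : ℝ) - 2) = 2 * (-e) by rw [he]; ring, Real.rpow_mul hx'.le,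
    Real.rpow_two, Real.rpow_neg (by positivity), Real.rpow_neg (by positivity),
    inv_le_iff_one_le_mul₀ (by positivity)]
  rw [mul_assoc, mul_comm, mul_assoc, inv_mul_eq_div, one_le_div (by positivity),
    ← Real.mul_rpow (by positivity) (by positivity)]
  refine Real.rpow_le_rpow (by positivity) ?_ (by rw [he]; linarith)
  have : κ ^ 2 ≤ ‖x‖ ^ 2 * (κ ^ 2 / s ^ 2) := by
    rw [mul_div_assoc', le_div_iff₀ (by positivity), mul_comm]
    have : s ^ 2 ≤ ‖x‖ ^ 2 := by gcongr
    nlinarith [sq_nonneg κ]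
  nlinarith

lemma np_le_pot (hM : 3 ≤ Module.finrank ℝ F) {f : F → ℝ≥0∞} {L r R : ℝ} (h : Adm f L r R) 
    {δ : ℝ} (hδ : 0 < δ) :
    ∃ κ₀ > 0, ∀ κ, 0 < κ → κ < κ₀ → ∀ x, 
      np f x ≤ ENNReal.ofReal (pot κ (volume.withDensity f) x + δ) := by
  obtain ⟨A, hA, h1⟩ := h.near hM
  obtain ⟨N, hN, hN1⟩ := h.np_bdd hM
  obtain ⟨s, hs, hs1⟩ : ∃ s : ℝ, 0 < s ∧ A * s ^ 2 ≤ δ / 2 := by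
    refine ⟨Real.sqrt (δ / 2 / A), by positivity, ?_⟩
    rw [Real.sq_sqrt (by positivity)]; field_simp; rfl
  have hc : Tendsto (fun κ : ℝ => (1 + κ ^ 2 / s ^ 2) ^ (((Module.finrank ℝ F : ℝ) - 2) / 2)) 
      (𝓝 0) (𝓝 1) := by
    have : ContinuousAt (fun κ : ℝ => (1 + κ ^ 2 / s ^ 2) ^ (((Module.finrank ℝ F : ℝ) - 2) / 2)) 0 := by
      refine ContinuousAt.rpow_const (by fun_prop) (Or.inl (by positivity))
    simpa [ContinuousAt] using this
  have hev := hc.eventually (eventually_le_nhds (show (1:ℝ) < 1 + δ / (2 * N) by 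
    have : 0 < δ / (2 * N) := by positivity
    linarith))
  obtain ⟨κ₀, hκ₀, hb⟩ := Metric.eventually_nhds_iff.1 hev
  refine ⟨κ₀, hκ₀, fun κ hκ hκκ x => ?_⟩
  have hb' := hb (y := κ) (by simpa [abs_of_pos hκ] using hκκ)
  have hP : 0 ≤ pot κ (volume.withDensity f) x := integral_nonneg fun y => (Gam_pos hκ _).le
  have hPN : pot κ (volume.withDensity f) x ≤ N := by
    have := (pot_le_np hM h hκ x).trans (hN1 x)
    exact (ENNReal.ofReal_le_ofReal_iff hN.le).1 this
  have h3 : ∫⁻ y in (Metric.ball x s)ᶜ, nk (x - y) * f y ≤ 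
      ENNReal.ofReal ((1 + δ / (2 * N)) * pot κ (volume.withDensity f) x) := by
    rw [ENNReal.ofReal_mul (by positivity)]
    unfold pot
    rw [h.ker_ofReal (Gam_continuous hκ) (fun z => (Gam_pos hκ z).le), ← lintegral_const_mul]
    · refine le_trans (setLIntegral_mono' (Metric.isOpen_ball).measurableSet.compl 
        fun y hy => ?_) (setLIntegral_le_lintegral _ _)
      have := nk_le_Gam (x := x - y) hM hκ hs (by 
        rw [mem_compl_iff, mem_ball_iff_norm'] at hy; exact not_lt.1 hy)
      rw [← mul_assoc]
      refine mul_le_mul_left (this.trans ?_) _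
      exact mul_le_mul_left (ENNReal.ofReal_le_ofReal hb') _
    · have := h.meas
      have h5 := Gam_continuous (F := F) hκ
      exact ((h5.measurable.comp (by fun_prop)).ennreal_ofReal).mul this
  unfold np
  rw [← lintegral_add_compl _ (Metric.isOpen_ball (x := x) (ε := s)).measurableSet]
  calc _ ≤ ENNReal.ofReal (A * s ^ 2) + 
        ENNReal.ofReal ((1 + δ / (2 * N)) * pot κ (volume.withDensity f) x) := add_le_add (h1 x s hs) h3
    _ = ENNReal.ofReal (A * s ^ 2 + (1 + δ / (2 * N)) * pot κ (volume.withDensity f) x) := by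
        rw [ENNReal.ofReal_add (by positivity) (by positivity)]
    _ ≤ _ := by
        refine ENNReal.ofReal_le_ofReal ?_
        have : δ / (2 * N) * pot κ (volume.withDensity f) x ≤ δ / (2 * N) * N := by gcongr
        have e : δ / (2 * N) * N = δ / 2 := by field_simp
        nlinarith

end adm

open Set MeasureTheory Filter Topology

set_option linter.unusedSectionVars false

section admtwo
open scoped ENNReal
open scoped Laplacian

variable {F : Type*} [NormedAddCommGroup F] [InnerProductSpace ℝ F] [FiniteDimensional ℝ F]
  [MeasurableSpace F] [BorelSpace F]

lemma ML_le_const (hM : 1 ≤ Module.finrank ℝ F) {f : F → ℝ≥0∞} {L : ℝ≥0∞} (h : ∀ x, f x ≤ L)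
    (x : F) : ML f x ≤ L := by
  unfold ML
  refine iSup₂_le fun r hr => ?_
  refine ENNReal.div_le_of_le_mul ?_
  calc _ ≤ ∫⁻ y in Metric.ball x r, L := lintegral_mono fun y => h y
    _ = L * volume (Metric.ball x r) := by rw [setLIntegral_const]
    _ = _ := by rw [Measure.addHaar_ball_center]

lemma bet_le_out (hM : 3 ≤ Module.finrank ℝ F) {κ s : ℝ} (hκ : 0 < κ) (hs : 0 < s) {z : F}
    (hz : s ≤ ‖z‖) : bet κ z ≤ (Module.finrank ℝ F : ℝ) * ((Module.finrank ℝ F : ℝ) - 2) * κ ^ 2 *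
      (s ^ 2) ^ (-((Module.finrank ℝ F : ℝ) + 2) / 2) := by
  have hM' : (3:ℝ) ≤ Module.finrank ℝ F := by exact_mod_cast hM
  unfold bet rp
  refine mul_le_mul_of_nonneg_left ?_ (by 
    have : 0 ≤ (Module.finrank ℝ F : ℝ) - 2 := by linarith
    positivity)
  refine Real.rpow_le_rpow_of_nonpos (by positivity) ?_ (by linarith)
  have : s ^ 2 ≤ ‖z‖ ^ 2 := by gcongr
  nlinarith [sq_nonneg κ]

lemma bet_anti (hM : 3 ≤ Module.finrank ℝ F) {κ : ℝ} (hκ : 0 < κ) {z z' : F}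
    (hz : ‖z‖ ≤ ‖z'‖) : bet κ z' ≤ bet κ z := by
  have hM' : (3:ℝ) ≤ Module.finrank ℝ F := by exact_mod_cast hM
  unfold bet rp
  refine mul_le_mul_of_nonneg_left ?_ (by 
    have : 0 ≤ (Module.finrank ℝ F : ℝ) - 2 := by linarith
    positivity)
  refine Real.rpow_le_rpow_of_nonpos (by positivity) ?_ (by linarith)
  gcongr

lemma mol_le (hM : 3 ≤ Module.finrank ℝ F) {f : F → ℝ≥0∞} {L r R : ℝ} (h : Adm f L r R) :
    ∃ κ₀ > 0, ∀ κ, 0 < κ → κ < κ₀ → ∀ x : F, x ≠ 0 →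
      mol κ (volume.withDensity f) x ≤ cM F * (ML f x).toReal + 1 := by
  have hM' : (3:ℝ) ≤ Module.finrank ℝ F := by exact_mod_cast hM
  have hr := h.r0
  set m := (∫⁻ y, f y).toReal with hm
  set A := (Module.finrank ℝ F : ℝ) * ((Module.finrank ℝ F : ℝ) - 2) * 
      ((r / 9) ^ 2) ^ (-((Module.finrank ℝ F : ℝ) + 2) / 2) with hA
  have hA0 : 0 ≤ A := by
    have : 0 ≤ (Module.finrank ℝ F : ℝ) - 2 := by linarith
    positivity
  have hm0 : 0 ≤ m := ENNReal.toReal_nonneg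
  refine ⟨Real.sqrt (1 / (A * m + 1)), by positivity, fun κ hκ hκκ x hx => ?_⟩
  have hκ2 : κ ^ 2 * (A * m) ≤ 1 := by
    have : κ ^ 2 ≤ 1 / (A * m + 1) := by
      rw [← Real.sq_sqrt (show 0 ≤ 1 / (A * m + 1) by positivity)]; gcongr
    rw [le_div_iff₀ (by positivity)] at this
    nlinarith [sq_nonneg κ]
  have hMLf : ML f x ≠ ∞ := ne_top_of_le_ne_top ENNReal.ofReal_ne_top 
    (ML_le_const (by omega) h.le x)
  have hx' := norm_pos_iff.2 hx
  have hbm : Measurable fun z : F => ENNReal.ofReal (bet κ z) :=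
    (bet_continuous hκ).measurable.ennreal_ofReal
  have key : ENNReal.ofReal (mol κ (volume.withDensity f) x) ≤ 
      ENNReal.ofReal (cM F * (ML f x).toReal + 1) := by
    unfold mol
    rw [h.ker_ofReal (bet_continuous hκ) (fun z => bet_nonneg hM hκ z),
      ← lintegral_add_compl _ (Metric.isOpen_ball (x := x) (ε := ‖x‖ / 8)).measurableSet,
      ENNReal.ofReal_add (by have := cM_pos hM (F := F); positivity) zero_le_one]
    refine add_le_add ?_ ?_
    · refine (rad_ML (F := F) (by omega) hbm ?_ h.meas (by positivity) (by linarith)).trans ?_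
      · intro z z' hz
        exact ENNReal.ofReal_le_ofReal (bet_anti hM hκ hz)
      · rw [ENNReal.ofReal_mul (cM_pos hM).le, ENNReal.ofReal_toReal hMLf]
        refine mul_le_mul_left ?_ _
        refine (setLIntegral_le_lintegral _ _).trans ?_
        rw [← bet_mass hκ, ofReal_integral_eq_lintegral_ofReal (bet_integrable hκ) 
          (Eventually.of_forall fun y => bet_nonneg hM hκ y)]
    · calc _ ≤ ∫⁻ y in (Metric.ball x (‖x‖ / 8))ᶜ, ENNReal.ofReal (A * κ ^ 2) * f y := by
            refine setLIntegral_mono' Metric.isOpen_ball.measurableSet.compl fun y hy => ?_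
            rw [mem_compl_iff, mem_ball_iff_norm', not_lt] at hy
            by_cases hyr : ‖y‖ < r
            · rw [h.zin y hyr]; simp
            refine mul_le_mul_left (ENNReal.ofReal_le_ofReal ?_) _
            refine (bet_le_out hM hκ (s := r / 9) (by positivity) ?_).trans (le_of_eq ?_)
            · have : ‖y‖ ≤ ‖x‖ + ‖x - y‖ := by
                have := norm_sub_le x (x - y)
                rwa [sub_sub_cancel] at this
              linarith
            · rw [hA]; ring
        _ ≤ ∫⁻ y, ENNReal.ofReal (A * κ ^ 2) * f y := setLIntegral_le_lintegral _ _
        _ = ENNReal.ofReal (A * κ ^ 2 * m) := by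
            rw [lintegral_const_mul _ h.meas, ENNReal.ofReal_mul (by positivity) (q := m), hm, 
              ENNReal.ofReal_toReal h.mass]
        _ ≤ _ := ENNReal.ofReal_le_ofReal (by linarith)
  exact (ENNReal.ofReal_le_ofReal_iff (by have := cM_pos hM (F := F); positivity)).1 key

lemma pot_grad (hM : 3 ≤ Module.finrank ℝ F) {f : F → ℝ≥0∞} {L r R : ℝ} (h : Adm f L r R) 
    {κ : ℝ} (hκ : 0 < κ) (x : F) (hg : gp f x ≠ ∞) :
    ‖fderiv ℝ (pot κ (volume.withDensity f)) x‖ ≤ 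
      ((Module.finrank ℝ F : ℝ) - 2) * (gp f x).toReal := by
  have hM' : (3:ℝ) ≤ Module.finrank ℝ F := by exact_mod_cast hM
  have := h.fin
  have hM2 : 0 ≤ (Module.finrank ℝ F : ℝ) - 2 := by linarith
  rw [pot_fderiv _ (isCompact_closedBall _ _) h.supp hκ]
  refine (norm_integral_le_integral_norm _).trans ?_
  have hc : Continuous fun z : F => ‖fderiv ℝ (Gam κ : F → ℝ) z‖ :=
    ((Gam_contDiff hκ (n := 1)).continuous_fderiv (by norm_num)).norm
  have key := h.ker_ofReal hc (fun z => norm_nonneg _) x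
  refine (ENNReal.ofReal_le_ofReal_iff (by positivity)).1 ?_
  rw [key, ENNReal.ofReal_mul hM2, ENNReal.ofReal_toReal hg]
  unfold gp
  rw [← lintegral_const_mul]
  swap
  · exact (show Measurable fun y => ‖x - y‖ₑ ^ (-((Module.finrank ℝ F : ℝ) - 1)) from 
      (meas_pw _).comp (by fun_prop)).mul h.meas
  refine lintegral_mono_ae ?_
  have hne : ∀ᵐ y : F, x - y ≠ 0 := by
    have : Nontrivial F := Module.nontrivial_of_finrank_pos (R := ℝ) (by omega)
    filter_upwards [Measure.ae_ne volume x] with y hy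
    exact sub_ne_zero.2 hy.symm
  filter_upwards [hne] with y hy
  rw [← mul_assoc]
  refine mul_le_mul_left ?_ _
  have hz := norm_pos_iff.2 hy
  rw [enorm_pw_real hy, Real.enorm_eq_ofReal (by positivity), ← ENNReal.ofReal_mul hM2]
  refine ENNReal.ofReal_le_ofReal ((Gam_norm_fderiv hM hκ _).trans ?_)
  rw [mul_assoc]
  refine mul_le_mul_of_nonneg_left ?_ hM2
  rw [show (-((Module.finrank ℝ F : ℝ) - 1)) = -(Module.finrank ℝ F : ℝ) + 1 by ring, 
    Real.rpow_add_one hz.ne']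
  refine mul_le_mul_of_nonneg_right ?_ hz.le
  unfold rp
  rw [show ‖x - y‖ ^ (-(Module.finrank ℝ F : ℝ)) = 
    (‖x - y‖ ^ 2) ^ (-(Module.finrank ℝ F : ℝ) / 2) by
      rw [← Real.rpow_natCast, ← Real.rpow_mul hz.le]; congr 1; push_cast; ring]
  exact Real.rpow_le_rpow_of_nonpos (by positivity) (by nlinarith) (by linarith)

lemma Gam_grad (hM : 3 ≤ Module.finrank ℝ F) {ε : ℝ} (hε : 0 < ε) {x : F} (hx : x ≠ 0) :
    ‖fderiv ℝ (Gam ε : F → ℝ) x‖ ≤ ((Module.finrank ℝ F : ℝ) - 2) * Gam ε x / ‖x‖ := by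
  have hM' : (3:ℝ) ≤ Module.finrank ℝ F := by exact_mod_cast hM
  have hM2 : 0 ≤ (Module.finrank ℝ F : ℝ) - 2 := by linarith
  have hx' := norm_pos_iff.2 hx
  refine (Gam_norm_fderiv hM hε x).trans ?_
  rw [le_div_iff₀ hx', mul_assoc, mul_assoc]
  refine mul_le_mul_of_nonneg_left ?_ hM2
  have hA := rp_base_pos hε x
  unfold Gam rp
  rw [show -((Module.finrank ℝ F : ℝ) - 2) / 2 = -(Module.finrank ℝ F : ℝ) / 2 + 1 by ring,
    Real.rpow_add_one hA.ne']
  refine mul_le_mul_of_nonneg_left ?_ (by positivity)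
  nlinarith [sq_nonneg ε]

lemma gdot_comp {G σ : F → ℝ} {P : ℝ → ℝ} {P' : ℝ} {x : F} (hσ : DifferentiableAt ℝ σ x)
    (hP : HasDerivAt P P' (σ x)) : gdot G (fun y => P (σ y)) x = P' * gdot G σ x := by
  have : fderiv ℝ (fun y => P (σ y)) x = P' • fderiv ℝ σ x :=
    (hP.comp_hasFDerivAt x hσ.hasFDerivAt).fderiv
  unfold gdot
  rw [this, Finset.mul_sum]
  refine Finset.sum_congr rfl fun i _ => ?_
  simp only [ContinuousLinearMap.smul_apply, smul_eq_mul]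
  ring

/-- Laplacian of `G * P(σ)` in terms of `D = G σ`. -/
lemma lap_quot {G D σ : F → ℝ} {P P' P'' : ℝ → ℝ} {x : F} (hG : ContDiffAt ℝ 2 G x) 
    (hσ : ContDiffAt ℝ 2 σ x) (hD : ∀ y, D y = G y * σ y) (hP : ContDiffAt ℝ 2 P (σ x))
    (h1 : ∀ t, HasDerivAt P (P' t) t) (h2 : ∀ t, HasDerivAt P' (P'' t) t) :
    Δ (fun y => G y * P (σ y)) x = P' (σ x) * (Δ D x - σ x * Δ G x) + 
      G x * P'' (σ x) * gdot σ σ x + P (σ x) * Δ G x := by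
  have e1 : Δ D x = G x * Δ σ x + σ x * Δ G x + 2 * gdot G σ x := by
    rw [show D = fun y => G y * σ y from funext hD]; exact lap_mul hG hσ
  have e2 := lap_mul (g := fun y => P (σ y)) hG (hP.comp x hσ)
  rw [e2, lap_comp hσ hP (Eventually.of_forall h1) (h2 _), 
    gdot_comp (hσ.differentiableAt (by norm_num)) (h1 _), e1]
  ring

end admtwo

open Set MeasureTheory Filter Topology

set_option linter.unusedSectionVars false

section young
open scoped ENNReal
open scoped Laplacian

lemma young_pt {p q : ℝ} (hpq : p.HolderConjugate q) {j : ℕ} (hj : 2 * q ≤ (j:ℝ) + 3) {v G τ Z c : ℝ}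
    (hv : 0 < v) (hG : 0 < G) (hτ : 0 < τ) (hτ1 : τ ≤ 1) (hZ : 0 ≤ Z) (hc : 0 ≤ c) :
    v * (c * τ ^ (j+1) * Z) ≤ G * τ ^ (j+3) * v ^ p + c ^ q * (G ^ (1 - q) * Z ^ q) := by
  have hp := hpq.pos
  have hq := hpq.symm.pos
  have hp1 := hpq.lt
  have hq1 := hpq.symm.lt
  have hb := hpq.inv_add_inv_eq_one
  set B := G * τ ^ (j+3) with hB
  have hB0 : 0 < B := by positivity
  have h1 := Real.young_inequality_of_nonneg (a := v * B ^ (1/p)) (b := c * τ ^ (j+1) * Z * B ^ (-(1/p)))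
    (by positivity) (by positivity) hpq
  have e1 : v * B ^ (1/p) * (c * τ ^ (j+1) * Z * B ^ (-(1/p))) = v * (c * τ ^ (j+1) * Z) := by
    have : B ^ (1/p) * B ^ (-(1/p)) = 1 := by rw [← Real.rpow_add hB0]; simp
    linear_combination (v * (c * τ ^ (j+1) * Z)) * this
  have e2 : (v * B ^ (1/p)) ^ p = B * v ^ p := by
    rw [Real.mul_rpow hv.le (by positivity), ← Real.rpow_mul hB0.le, one_div, inv_mul_cancel₀ hp.ne',
      Real.rpow_one, mul_comm]
  have e3 : (c * τ ^ (j+1) * Z * B ^ (-(1/p))) ^ q ≤ c ^ q * (G ^ (1 - q) * Z ^ q) := by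
    rw [Real.mul_rpow (by positivity) (by positivity), Real.mul_rpow (by positivity) hZ,
      Real.mul_rpow hc (by positivity), ← Real.rpow_mul hB0.le]
    have : -(1/p) * q = 1 - q := by
      have := hpq.symm.sub_one_mul_conj
      field_simp
      nlinarith
    rw [this, hB, Real.mul_rpow hG.le (by positivity), ← Real.rpow_natCast τ (j+1), 
      ← Real.rpow_natCast τ (j+3), ← Real.rpow_mul hτ.le, ← Real.rpow_mul hτ.le]
    have h4 : τ ^ (((j+1:ℕ):ℝ) * q) * τ ^ (((j+3:ℕ):ℝ) * (1 - q)) ≤ 1 := by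
      rw [← Real.rpow_add hτ]
      refine Real.rpow_le_one hτ.le hτ1 ?_
      push_cast
      nlinarith
    calc _ = c ^ q * (G ^ (1 - q) * Z ^ q) * (τ ^ (((j+1:ℕ):ℝ) * q) * τ ^ (((j+3:ℕ):ℝ) * (1 - q))) := by ring
      _ ≤ c ^ q * (G ^ (1 - q) * Z ^ q) * 1 := by gcongr
      _ = _ := mul_one _
  rw [e1, e2] at h1
  refine h1.trans (add_le_add ?_ (le_trans ?_ e3))
  · exact div_le_self (by positivity) hp1.le
  · exact div_le_self (by positivity) hq1.le

lemma three_pow {q a b c : ℝ} (hq : 0 < q) (ha : 0 ≤ a) (hb : 0 ≤ b) (hc : 0 ≤ c) :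
    (a + b + c) ^ q ≤ 3 ^ q * (a ^ q + b ^ q + c ^ q) := by
  have key : ∀ m : ℝ, 0 ≤ m → a ≤ m → b ≤ m → c ≤ m → m ^ q ≤ a ^ q + b ^ q + c ^ q → 
      (a + b + c) ^ q ≤ 3 ^ q * (a ^ q + b ^ q + c ^ q) := by
    intro m hm h1 h2 h3 h4
    calc _ ≤ (3 * m) ^ q := Real.rpow_le_rpow (by positivity) (by linarith) hq.le
      _ = 3 ^ q * m ^ q := Real.mul_rpow (by norm_num) hm
      _ ≤ _ := by gcongr
  have A := Real.rpow_nonneg ha q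
  have B := Real.rpow_nonneg hb q
  have C := Real.rpow_nonneg hc q
  rcases le_total a b with h | h <;> rcases le_total b c with h' | h' <;> 
    rcases le_total a c with h'' | h''
  all_goals first
    | exact key c hc (by linarith) (by linarith) (by linarith) (by linarith)
    | exact key b hb (by linarith) (by linarith) (by linarith) (by linarith)
    | exact key a ha (by linarith) (by linarith) (by linarith) (by linarith)

variable {F : Type*} [NormedAddCommGroup F] [InnerProductSpace ℝ F] [FiniteDimensional ℝ F]
  [MeasurableSpace F] [BorelSpace F]

/-- the cutoff variable -/
noncomputable def sg (ε κ : ℝ) (f : F → ℝ≥0∞) (y : F) : ℝ := 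
  1 - (pot κ (volume.withDensity f) y + 2) / Gam ε y

section sgs

lemma S_cd {f : F → ℝ≥0∞} {L r R ε κ : ℝ} (h : Adm f L r R) (hε : 0 < ε) (hκ : 0 < κ) : ContDiff ℝ 2 (pot κ (volume.withDensity f)) := by
  have := h.fin
  exact pot_contDiff _ (isCompact_closedBall _ _) h.supp hκ

lemma sg_cd {f : F → ℝ≥0∞} {L r R ε κ : ℝ} (h : Adm f L r R) (hε : 0 < ε) (hκ : 0 < κ) : ContDiff ℝ 2 (sg ε κ f) := by
  have h1 := S_cd h hε hκ
  have h2 := Gam_contDiff (F := F) hε (n := 2)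
  exact contDiff_const.sub ((h1.add contDiff_const).div h2 (fun x => (Gam_pos hε x).ne'))

lemma sg_mul {f : F → ℝ≥0∞} {L r R ε κ : ℝ} (h : Adm f L r R) (hε : 0 < ε) (hκ : 0 < κ) (y : F) : Gam ε y - (pot κ (volume.withDensity f) y + 2) = Gam ε y * sg ε κ f y := by
  have := (Gam_pos hε y).ne'
  unfold sg; field_simp

lemma sg_fderiv {f : F → ℝ≥0∞} {L r R ε κ : ℝ} (h : Adm f L r R) (hε : 0 < ε) (hκ : 0 < κ) (x : F) : Gam ε x • fderiv ℝ (sg ε κ f) x = 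
    (1 - sg ε κ f x) • fderiv ℝ (Gam ε) x - fderiv ℝ (pot κ (volume.withDensity f)) x := by
  have d1 := (S_cd h hε hκ).differentiable (by norm_num) x
  have d2 := (Gam_contDiff (F := F) hε (n := 2)).differentiable (by norm_num) x
  have d3 := (sg_cd h hε hκ).differentiable (by norm_num) x
  have e := congrArg (fun g => fderiv ℝ g x) (funext (sg_mul h hε hκ))
  rw [fderiv_fun_sub d2 (d1.add_const _), fderiv_add_const, fderiv_fun_mul d2 d3] at e
  rw [sub_smul, one_smul, sub_right_comm, e]; abel

lemma S_nonneg {f : F → ℝ≥0∞} {L r R ε κ : ℝ} (h : Adm f L r R) (hε : 0 < ε) (hκ : 0 < κ) (x : F) : 0 ≤ pot κ (volume.withDensity f) x := 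
  integral_nonneg fun y => (Gam_pos hκ _).le

end sgs

lemma grad_est (hM : 3 ≤ Module.finrank ℝ F) :
    ∃ C : ℝ, 0 < C ∧ ∀ (f : F → ℝ≥0∞) (L r R ε κ : ℝ), Adm f L r R → 0 < ε → 0 < κ → 
      (∀ x, np f x ≤ ENNReal.ofReal (pot κ (volume.withDensity f) x + 1)) → ∀ x : F, x ≠ 0 → 
      0 < sg ε κ f x → 
      Gam ε x * gdot (sg ε κ f) (sg ε κ f) x ≤ 
        C * ((ML f x).toReal + ((np f x).toReal + 2) / ‖x‖ ^ 2) := by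
  have hM' : (3:ℝ) ≤ Module.finrank ℝ F := by exact_mod_cast hM
  obtain ⟨C, hC, hed⟩ := hedberg (F := F) hM
  set m : ℝ := (Module.finrank ℝ F : ℝ) - 2 with hm
  have hm0 : 0 < m := by linarith
  refine ⟨2 * m ^ 2 * (1 + C), by positivity, ?_⟩
  intro f L r R ε κ h hε hκ hnp x hx hσ
  have hx' := norm_pos_iff.2 hx
  set S := pot κ (volume.withDensity f) x with hS
  have hS0 : 0 ≤ S := S_nonneg h hε hκ x
  have hnpf : np f x ≠ ∞ := ne_top_of_le_ne_top ENNReal.ofReal_ne_top (hnp x)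
  have hMLf : ML f x ≠ ∞ := ne_top_of_le_ne_top ENNReal.ofReal_ne_top (ML_le_const (by omega) h.le x)
  obtain ⟨hg, hg2⟩ := hed f h.meas x hx hnpf hMLf
  set n := (np f x).toReal with hn
  set l := (ML f x).toReal with hl
  have hn0 : 0 ≤ n := ENNReal.toReal_nonneg
  have hl0 : 0 ≤ l := ENNReal.toReal_nonneg
  have hnS : n ≤ S + 1 := ENNReal.toReal_le_of_le_ofReal (by linarith) (hnp x)
  have hSn : S ≤ n := by
    have := pot_le_np hM h hκ x
    exact (ENNReal.ofReal_le_iff_le_toReal hnpf).1 this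
  have hG := Gam_pos (F := F) hε x
  set G := Gam ε x with hGdef
  have hT : G - (S + 2) = G * sg ε κ f x := sg_mul h hε hκ x
  have hTG : S + 2 < G := by nlinarith
  set t := 1 - sg ε κ f x with ht
  have htG : t * G = S + 2 := by rw [ht]; linarith
  have ht0 : 0 < t := by
    by_contra hcon
    nlinarith
  have ht1 : t < 1 := by rw [ht]; linarith
  have hfd := sg_fderiv h hε hκ x
  have g1 := Gam_grad hM hε hx
  have g2 := pot_grad hM h hκ x hg
  rw [← hm] at g1 g2
  rw [gdot_self]
  set A := ‖fderiv ℝ (sg ε κ f) x‖ with hA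
  have hGA : G * A ≤ t * (m * G / ‖x‖) + m * (gp f x).toReal := by
    calc G * A = ‖G • fderiv ℝ (sg ε κ f) x‖ := by rw [norm_smul, Real.norm_eq_abs, abs_of_pos hG]
      _ ≤ ‖t • fderiv ℝ (Gam ε) x‖ + ‖fderiv ℝ (pot κ (volume.withDensity f)) x‖ := by
          rw [hfd]; exact norm_sub_le _ _
      _ ≤ _ := by
          rw [norm_smul, Real.norm_eq_abs, abs_of_pos ht0]
          gcongr
  have hA0 : 0 ≤ A := norm_nonneg _
  have e1 : t * (m * G / ‖x‖) = m * (S + 2) / ‖x‖ := by rw [← htG]; ring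
  rw [e1] at hGA
  set g := (gp f x).toReal with hgd
  have hg0 : 0 ≤ g := ENNReal.toReal_nonneg
  have sq1 : (G * A) ^ 2 ≤ 2 * (m * (S + 2) / ‖x‖) ^ 2 + 2 * (m * g) ^ 2 := by
    have : (G * A) ^ 2 ≤ (m * (S + 2) / ‖x‖ + m * g) ^ 2 := by gcongr
    nlinarith [sq_nonneg (m * (S + 2) / ‖x‖ - m * g)]
  have q1 : (S + 2) ^ 2 ≤ G * (n + 2) := by nlinarith
  have q2 : g ^ 2 ≤ C * (G * (l + n / ‖x‖ ^ 2)) := by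
    refine hg2.trans ?_
    have : n * l + n ^ 2 / ‖x‖ ^ 2 = n * (l + n / ‖x‖ ^ 2) := by ring
    rw [this]
    gcongr
    linarith
  have fin : G * (G * A ^ 2) ≤ G * (2 * m ^ 2 * (1 + C) * (l + (n + 2) / ‖x‖ ^ 2)) := by
    calc G * (G * A ^ 2) = (G * A) ^ 2 := by ring
      _ ≤ 2 * (m * (S + 2) / ‖x‖) ^ 2 + 2 * (m * g) ^ 2 := sq1
      _ = 2 * m ^ 2 * ((S + 2) ^ 2 / ‖x‖ ^ 2 + g ^ 2) := by ring
      _ ≤ 2 * m ^ 2 * (G * (n + 2) / ‖x‖ ^ 2 + C * (G * (l + n / ‖x‖ ^ 2))) := by gcongr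
      _ ≤ 2 * m ^ 2 * (G * (n + 2) / ‖x‖ ^ 2 + C * (G * (l + (n + 2) / ‖x‖ ^ 2)) + G * l) := by
          have : n / ‖x‖ ^ 2 ≤ (n + 2) / ‖x‖ ^ 2 := by gcongr; linarith
          have h5 : 0 ≤ G * l := by positivity
          have h6 : C * (G * (l + n / ‖x‖ ^ 2)) ≤ C * (G * (l + (n + 2) / ‖x‖ ^ 2)) := by gcongr
          refine mul_le_mul_of_nonneg_left (by linarith) (by positivity)
      _ = _ := by ring
  exact le_of_mul_le_mul_left fin hG

end young

open Set MeasureTheory Filter Topology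

set_option linter.unusedSectionVars false

section tst
open scoped ENNReal
open scoped Laplacian

variable {F : Type*} [NormedAddCommGroup F] [InnerProductSpace ℝ F] [FiniteDimensional ℝ F]
  [MeasurableSpace F] [BorelSpace F]

/-- the test function -/
noncomputable def ph (j : ℕ) (ε κ : ℝ) (f : F → ℝ≥0∞) (y : F) : ℝ := 
  Gam ε y * (max (sg ε κ f y) 0) ^ (j+3)

lemma ph_cd {f : F → ℝ≥0∞} {L r R ε κ : ℝ} (h : Adm f L r R) (hε : 0 < ε) (hκ : 0 < κ) (j : ℕ) :
    ContDiff ℝ 2 (ph j ε κ f) :=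
  (Gam_contDiff hε).mul ((contDiff_pospow (j+3) (by omega)).comp (sg_cd h hε hκ))

lemma ph_lap {f : F → ℝ≥0∞} {L r R ε κ : ℝ} (h : Adm f L r R) (hε : 0 < ε) (hκ : 0 < κ) (j : ℕ) 
    (x : F) : Δ (ph j ε κ f) x = 
      (((j+2:ℕ):ℝ)+1) * (max (sg ε κ f x) 0) ^ (j+2) * 
        (-bet ε x + mol κ (volume.withDensity f) x + sg ε κ f x * bet ε x) + 
      Gam ε x * ((((j+2:ℕ):ℝ)+1) * ((((j+1:ℕ):ℝ)+1) * (max (sg ε κ f x) 0) ^ (j+1))) * 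
        gdot (sg ε κ f) (sg ε κ f) x - (max (sg ε κ f x) 0) ^ (j+3) * bet ε x := by
  have := h.fin
  have hG := Gam_contDiff (F := F) hε (n := 2)
  have hS := S_cd h hε hκ
  have hk := lap_quot (G := Gam ε) (D := fun y => Gam ε y - (pot κ (volume.withDensity f) y + 2))
    (σ := sg ε κ f) (P := fun t => (max t 0) ^ (j+3)) 
    (P' := fun t => (((j+2:ℕ):ℝ)+1) * (max t 0) ^ (j+2))
    (P'' := fun t => (((j+2:ℕ):ℝ)+1) * ((((j+1:ℕ):ℝ)+1) * (max t 0) ^ (j+1)))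
    (x := x) hG.contDiffAt (sg_cd h hε hκ).contDiffAt (sg_mul h hε hκ) 
    (contDiff_pospow (j+3) (by omega)).contDiffAt
    (fun t => hasDerivAt_pospow (j+2) (by omega) t) 
    (fun t => (hasDerivAt_pospow (j+1) (by omega) t).const_mul _)
  have e1 : Δ (fun y => Gam ε y - (pot κ (volume.withDensity f) y + 2)) x = 
      - bet ε x + mol κ (volume.withDensity f) x := by
    rw [lap_sub hG.contDiffAt (hS.add contDiff_const).contDiffAt, 
      lap_add hS.contDiffAt contDiff_const.contDiffAt, lap_const, Gam_lap hε, 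
      pot_lap _ (isCompact_closedBall _ _) h.supp hκ]
    ring
  rw [e1, Gam_lap hε] at hk
  change Δ (fun y => Gam ε y * (max (sg ε κ f y) 0) ^ (j+3)) x = _
  rw [hk]; ring

lemma mol_nonneg (hM : 3 ≤ Module.finrank ℝ F) {κ : ℝ} (hκ : 0 < κ) (ν : Measure F) (x : F) : 
    0 ≤ mol κ ν x := integral_nonneg fun y => bet_nonneg hM hκ _

lemma test_scal (j : ℕ) {σ b mo G g2 : ℝ} (hσ : 0 < σ) (hσ1 : σ ≤ 1) (hb0 : 0 ≤ b) (hm0 : 0 ≤ mo)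
    (hG : 0 < G) (hg0 : 0 ≤ g2) : 
    σ ^ (j+3) * b ≤ -(((j:ℝ)+2+1) * σ ^ (j+2) * (-b + mo + σ * b) + 
      G * (((j:ℝ)+2+1) * (((j:ℝ)+1+1) * σ ^ (j+1))) * g2 - σ ^ (j+3) * b) + 
      ((j:ℝ)+3)^2 * σ ^ (j+1) * (mo + G * g2) := by
  have hs2 : σ ^ (j+2) ≤ σ ^ (j+1) := pow_le_pow_of_le_one hσ.le hσ1 (by omega)
  have hj0 : (0:ℝ) ≤ j := Nat.cast_nonneg j
  have c1 : (j:ℝ)+2+1 ≤ ((j:ℝ)+3)^2 := by nlinarith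
  have c2 : ((j:ℝ)+2+1) * ((j:ℝ)+1+1) ≤ ((j:ℝ)+3)^2 := by nlinarith
  have t2 : ((j:ℝ)+2+1) * (σ ^ (j+2) * mo) ≤ ((j:ℝ)+3)^2 * (σ ^ (j+1) * mo) := by gcongr
  have t3 : ((j:ℝ)+2+1) * ((j:ℝ)+1+1) * (σ ^ (j+1) * (G * g2)) ≤ ((j:ℝ)+3)^2 * (σ ^ (j+1) * (G * g2)) := by
    gcongr
  have t4 : 0 ≤ ((j:ℝ)+2+1) * (σ ^ (j+2) * ((1 - σ) * b)) := by
    have : 0 ≤ 1 - σ := by linarith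
    positivity
  linarith

lemma test_pt (hM : 3 ≤ Module.finrank ℝ F) {p q : ℝ} (hpq : p.HolderConjugate q) {j : ℕ} 
    (hj : 2 * q ≤ (j:ℝ) + 3) :
    ∃ C : ℝ, 0 < C ∧ ∀ (f : F → ℝ≥0∞) (L r R ε κ : ℝ), Adm f L r R → 0 < ε → 0 < κ → 
      (∀ x, np f x ≤ ENNReal.ofReal (pot κ (volume.withDensity f) x + 1)) → 
      (∀ x, x ≠ 0 → mol κ (volume.withDensity f) x ≤ cM F * (ML f x).toReal + 1) →
      ∀ x : F, x ≠ 0 → ‖x‖ < 1 → 0 < sg ε κ f x → ∀ V : ℝ, 0 < V → 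
      V * ((max (sg ε κ f x) 0) ^ (j+3) * bet ε x) ≤ -(V * Δ (ph j ε κ f) x) + ph j ε κ f x * V ^ p + 
        C * ((Gam ε x) ^ (1 - q) * ((ML f x).toReal ^ q + (np f x).toReal ^ q * ‖x‖ ^ (-(2*q)) + 
          ‖x‖ ^ (-(2*q)))) := by
  obtain ⟨C1, hC1, hg⟩ := grad_est (F := F) hM
  have hcM := cM_pos (F := F) hM
  have hq := hpq.symm.pos
  set C2 := cM F + 1 + 2 * C1 with hC2
  set c : ℝ := ((j:ℝ)+3)^2 with hc
  refine ⟨c ^ q * (C2 ^ q * 3 ^ q), by positivity, ?_⟩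
  intro f L r R ε κ h hε hκ hnp hmol x hx hx1 hσ V hV
  have hx' := norm_pos_iff.2 hx
  have hl := ph_lap h hε hκ j x
  have hphx : ph j ε κ f x = Gam ε x * (sg ε κ f x) ^ (j+3) := by rw [ph, max_eq_left hσ.le]
  rw [max_eq_left hσ.le] at hl ⊢
  have hG := Gam_pos (F := F) hε x
  have hσ1 : sg ε κ f x ≤ 1 := by
    have : 0 ≤ (pot κ (volume.withDensity f) x + 2) / Gam ε x := by
      have := S_nonneg h hε hκ x
      positivity
    unfold sg; linarith
  have hm0 := mol_nonneg hM hκ (volume.withDensity f) x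
  have hb0 := bet_nonneg hM hε x
  have hg0 := gdot_self_nonneg (sg ε κ f) x
  have hg1 := hg f L r R ε κ h hε hκ hnp x hx hσ
  have hm1 := hmol x hx
  set σ := sg ε κ f x with hσd
  set mo := mol κ (volume.withDensity f) x with hmo
  set g2 := gdot (sg ε κ f) (sg ε κ f) x with hg2
  set n := (np f x).toReal with hn
  set l := (ML f x).toReal with hl'
  set G := Gam ε x with hGd
  have hn0 : 0 ≤ n := ENNReal.toReal_nonneg
  have hl0 : 0 ≤ l := ENNReal.toReal_nonneg
  have hZ0 : 0 ≤ mo + G * g2 := by positivity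
  have hin : 1 ≤ (‖x‖ ^ 2)⁻¹ := by
    rw [one_le_inv₀ (by positivity)]
    nlinarith
  have hZ : mo + G * g2 ≤ C2 * (l + n * (‖x‖ ^ 2)⁻¹ + (‖x‖ ^ 2)⁻¹) := by
    set i := (‖x‖ ^ 2)⁻¹ with hi
    rw [div_eq_mul_inv, ← hi] at hg1
    have : 0 ≤ n * i := by positivity
    rw [hC2]
    nlinarith [mul_nonneg hC1.le hl0, mul_nonneg hC1.le this, mul_nonneg hcM.le this, 
      mul_nonneg hcM.le (zero_le_one.trans hin)]
  have hZq : (mo + G * g2) ^ q ≤ C2 ^ q * 3 ^ q * (l ^ q + n ^ q * ‖x‖ ^ (-(2*q)) + ‖x‖ ^ (-(2*q))) := by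
    have e : ((‖x‖ ^ 2)⁻¹) ^ q = ‖x‖ ^ (-(2*q)) := by
      rw [Real.inv_rpow (by positivity), ← Real.rpow_natCast, ← Real.rpow_mul hx'.le, 
        Real.rpow_neg hx'.le]; norm_num
    calc _ ≤ (C2 * (l + n * (‖x‖ ^ 2)⁻¹ + (‖x‖ ^ 2)⁻¹)) ^ q := Real.rpow_le_rpow hZ0 hZ hq.le
      _ = C2 ^ q * (l + n * (‖x‖ ^ 2)⁻¹ + (‖x‖ ^ 2)⁻¹) ^ q := Real.mul_rpow (by positivity) (by positivity)
      _ ≤ C2 ^ q * (3 ^ q * (l ^ q + (n * (‖x‖ ^ 2)⁻¹) ^ q + ((‖x‖ ^ 2)⁻¹) ^ q)) := by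
          gcongr
          exact three_pow hq hl0 (by positivity) (by positivity)
      _ = _ := by rw [Real.mul_rpow hn0 (by positivity), e]; ring
  have hy := young_pt hpq hj (c := c) hV hG hσ hσ1 hZ0 (by positivity)
  have hmain : V * (σ ^ (j+3) * bet ε x) ≤ -(V * Δ (ph j ε κ f) x) + 
      V * (c * σ ^ (j+1) * (mo + G * g2)) := by
    rw [← mul_neg, ← mul_add]
    refine mul_le_mul_of_nonneg_left ?_ hV.le
    rw [hl]
    push_cast
    exact test_scal j hσ hσ1 hb0 hm0 hG hg0
  refine hmain.trans ?_
  rw [hphx]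
  have : c ^ q * (G ^ (1 - q) * (mo + G * g2) ^ q) ≤ c ^ q * (C2 ^ q * 3 ^ q) * 
      (G ^ (1 - q) * (l ^ q + n ^ q * ‖x‖ ^ (-(2*q)) + ‖x‖ ^ (-(2*q)))) := by
    calc _ ≤ c ^ q * (G ^ (1 - q) * (C2 ^ q * 3 ^ q * (l ^ q + n ^ q * ‖x‖ ^ (-(2*q)) + ‖x‖ ^ (-(2*q))))) := by
          gcongr
      _ = _ := by ring
  linarith

end tst

open Set MeasureTheory Filter Topology

set_option linter.unusedSectionVars false

section rhs
open scoped ENNReal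
open scoped Laplacian

variable {F : Type*} [NormedAddCommGroup F] [InnerProductSpace ℝ F] [FiniteDimensional ℝ F]
  [MeasurableSpace F] [BorelSpace F]

lemma Gam_pow_le (hM : 3 ≤ Module.finrank ℝ F) {q : ℝ} (hq : 1 < q) {ε : ℝ} (hε : 0 < ε) (x : F) :
    (Gam ε x) ^ (1 - q) ≤ 2 ^ (((Module.finrank ℝ F : ℝ) - 2) * (q - 1) / 2) * 
      (‖x‖ ^ (((Module.finrank ℝ F : ℝ) - 2) * (q - 1)) + 
        ε ^ (((Module.finrank ℝ F : ℝ) - 2) * (q - 1))) := by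
  have hM' : (3:ℝ) ≤ Module.finrank ℝ F := by exact_mod_cast hM
  set a := ((Module.finrank ℝ F : ℝ) - 2) * (q - 1) with ha
  have ha0 : 0 < a := mul_pos (by linarith) (by linarith)
  have hA := rp_base_pos hε x
  have e1 : (Gam ε x) ^ (1 - q) = (‖x‖ ^ 2 + ε ^ 2) ^ (a / 2) := by
    unfold Gam rp
    rw [← Real.rpow_mul hA.le]; congr 1; rw [ha]; ring
  have e2 : ∀ t : ℝ, 0 ≤ t → (t ^ 2) ^ (a / 2) = t ^ a := fun t ht => by
    rw [← Real.rpow_natCast, ← Real.rpow_mul ht]; congr 1; push_cast; ring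
  have key : ∀ m : ℝ, 0 ≤ m → ‖x‖ ≤ m → ε ≤ m → (‖x‖ ^ 2 + ε ^ 2) ^ (a / 2) ≤ 2 ^ (a / 2) * m ^ a := by
    intro m hm h1 h2
    rw [← e2 m hm, ← Real.mul_rpow (by norm_num) (by positivity)]
    refine Real.rpow_le_rpow (by positivity) ?_ (by positivity)
    have : ‖x‖ ^ 2 ≤ m ^ 2 := by gcongr
    have : ε ^ 2 ≤ m ^ 2 := by gcongr
    linarith
  rw [e1]
  have b1 := Real.rpow_nonneg (norm_nonneg x) a
  have b2 := Real.rpow_nonneg hε.le a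
  rcases le_total ‖x‖ ε with h | h
  · refine (key ε hε.le h le_rfl).trans ?_
    gcongr; linarith
  · refine (key ‖x‖ (norm_nonneg _) le_rfl h).trans ?_
    gcongr; linarith

lemma rhs_bound (hM : 4 ≤ Module.finrank ℝ F) {p q : ℝ} (hpq : p.HolderConjugate q) 
    (hMq : 2 * q < Module.finrank ℝ F) :
    ∃ C : ℝ≥0∞, C ≠ ∞ ∧ ∀ (f : F → ℝ≥0∞) (L r R : ℝ), Adm f L r R → ∃ Q : ℝ≥0∞, Q ≠ ∞ ∧ 
      ∀ ε : ℝ, 0 < ε → ∫⁻ x in Metric.ball (0:F) 1, ENNReal.ofReal ((Gam ε x) ^ (1 - q) * 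
        ((ML f x).toReal ^ q + (np f x).toReal ^ q * ‖x‖ ^ (-(2*q)) + ‖x‖ ^ (-(2*q)))) ≤ 
      C * ((∫⁻ x : F, ‖x‖ₑ ^ (((Module.finrank ℝ F : ℝ) - 2) * (q - 1)) * (f x) ^ q) + 1 + 
        ENNReal.ofReal (ε ^ (((Module.finrank ℝ F : ℝ) - 2) * (q - 1))) * Q) := by
  have hM' : (4:ℝ) ≤ Module.finrank ℝ F := by exact_mod_cast hM
  have hq := hpq.symm.lt
  set M : ℝ := (Module.finrank ℝ F : ℝ) with hMdef
  set a := (M - 2) * (q - 1) with ha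
  have ha0 : 0 < a := mul_pos (by linarith) (by linarith)
  obtain ⟨C1, hC1, h1⟩ := ML_weighted (F := F) (by omega) hq ha0.le
  obtain ⟨C2, hC2, h2⟩ := schur_ineq (F := F) hpq hM hMq
  obtain ⟨A1, hA1, h3⟩ := rad_in (F := F) (by omega) (s := 2 * q - a) (by linarith)
  obtain ⟨A2, hA2, h4⟩ := rad_in (F := F) (by omega) (s := 2 * q) hMq
  have h3' := h3 1 one_pos
  have h4' := h4 1 one_pos
  rw [ENNReal.ofReal_one, ENNReal.one_rpow, mul_one] at h3' h4'
  set c : ℝ≥0∞ := ENNReal.ofReal (2 ^ (a / 2)) with hc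
  refine ⟨c * (C1 + C2 + A1 + 1), ENNReal.mul_ne_top ENNReal.ofReal_ne_top (by finiteness), ?_⟩
  intro f L r R h
  obtain ⟨N, hN, hnp⟩ := h.np_bdd (by omega)
  set W : F → ℝ≥0∞ := fun x => (ML f x) ^ q + (np f x) ^ q * ‖x‖ₑ ^ (-(2*q)) + ‖x‖ₑ ^ (-(2*q)) with hW
  have mML : Measurable fun x => (ML f x) ^ q := (ML_meas f).pow_const q
  have mnp : Measurable fun x => (np f x) ^ q := (np_meas h.meas).pow_const q
  have mW : Measurable W := (mML.add (mnp.mul (meas_pw _))).add (meas_pw _)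
  refine ⟨∫⁻ x in Metric.ball (0:F) 1, W x, ?_, fun ε hε => ?_⟩
  · have : ∫⁻ x in Metric.ball (0:F) 1, W x ≤ ∫⁻ x in Metric.ball (0:F) 1, 
        (ENNReal.ofReal L ^ q + (ENNReal.ofReal N ^ q + 1) * ‖x‖ₑ ^ (-(2*q))) := by
      refine lintegral_mono fun x => ?_
      simp only [hW]
      rw [add_assoc, add_mul, one_mul]
      gcongr
      · exact ML_le_const (by omega) h.le x
      · exact hnp x
    refine ne_top_of_le_ne_top ?_ this
    rw [lintegral_add_left measurable_const, lintegral_const_mul _ (meas_pw _), h4', setLIntegral_const]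
    have : (volume (Metric.ball (0:F) 1)) ≠ ∞ := measure_ball_lt_top.ne
    have q0 : 0 ≤ q := by linarith
    finiteness
  · set e := ENNReal.ofReal (ε ^ a) with he
    have hpt : ∀ x : F, x ≠ 0 → ENNReal.ofReal ((Gam ε x) ^ (1 - q) * 
        ((ML f x).toReal ^ q + (np f x).toReal ^ q * ‖x‖ ^ (-(2*q)) + ‖x‖ ^ (-(2*q)))) ≤ 
        c * ((‖x‖ₑ ^ a + e) * W x) := by
      intro x hx
      have hx' := norm_pos_iff.2 hx
      have hG := Gam_pos (F := F) hε x
      have o1 : ENNReal.ofReal (‖x‖ ^ a) = ‖x‖ₑ ^ a := by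
        rw [enorm_pw_real hx, Real.enorm_eq_ofReal (by positivity)]
      have o2 : ENNReal.ofReal (‖x‖ ^ (-(2*q))) = ‖x‖ₑ ^ (-(2*q)) := by
        rw [enorm_pw_real hx, Real.enorm_eq_ofReal (by positivity)]
      have o3 : ∀ y : ℝ≥0∞, ENNReal.ofReal (y.toReal ^ q) ≤ y ^ q := fun y => by
        rw [← ENNReal.ofReal_rpow_of_nonneg ENNReal.toReal_nonneg (by linarith)]
        exact ENNReal.rpow_le_rpow ENNReal.ofReal_toReal_le (by linarith)
      rw [ENNReal.ofReal_mul (by positivity), ← mul_assoc]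
      refine mul_le_mul' ?_ ?_
      · rw [hc, he, ← o1, ← ENNReal.ofReal_add (by positivity) (by positivity), 
          ← ENNReal.ofReal_mul (by positivity)]
        exact ENNReal.ofReal_le_ofReal (Gam_pow_le (by omega) hq hε x)
      · rw [ENNReal.ofReal_add (by positivity) (by positivity), 
          ENNReal.ofReal_add (by positivity) (by positivity), ENNReal.ofReal_mul (by positivity), o2]
        simp only [hW]
        gcongr
        · exact o3 _
        · exact o3 _
    have hae : ∀ᵐ x : F, x ≠ 0 := ae_ne_zero (by omega)
    calc _ ≤ ∫⁻ x in Metric.ball (0:F) 1, c * ((‖x‖ₑ ^ a + e) * W x) := by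
          refine lintegral_mono_ae (ae_restrict_of_ae ?_)
          filter_upwards [hae] with x hx using hpt x hx
      _ = c * ((∫⁻ x in Metric.ball (0:F) 1, ‖x‖ₑ ^ a * W x) + e * ∫⁻ x in Metric.ball (0:F) 1, W x) := by
          rw [lintegral_const_mul _ (show Measurable fun x : F => (‖x‖ₑ ^ a + e) * W x from ((meas_pw _).add measurable_const).mul mW)]
          congr 1
          rw [← lintegral_const_mul _ mW, ← lintegral_add_left (show Measurable fun x : F => ‖x‖ₑ ^ a * W x from (meas_pw _).mul mW)]
          refine lintegral_congr fun x => ?_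
          rw [add_mul]
      _ ≤ c * (((C1 + C2 + A1) * ((∫⁻ x : F, ‖x‖ₑ ^ a * (f x) ^ q) + 1)) + 
            e * ∫⁻ x in Metric.ball (0:F) 1, W x) := by
          gcongr 3
          set J := ∫⁻ x : F, ‖x‖ₑ ^ a * (f x) ^ q with hJ
          have s1 : ∫⁻ x in Metric.ball (0:F) 1, ‖x‖ₑ ^ a * W x = 
              ∫⁻ x in Metric.ball (0:F) 1, (‖x‖ₑ ^ a * (ML f x) ^ q + ‖x‖ₑ ^ (a - 2 * q) * (np f x) ^ q + 
                ‖x‖ₑ ^ (-(2 * q - a))) := by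
            refine lintegral_congr_ae (ae_restrict_of_ae ?_)
            filter_upwards [hae] with x hx
            simp only [hW]
            have : ‖x‖ₑ ^ a * ‖x‖ₑ ^ (-(2*q)) = ‖x‖ₑ ^ (a - 2 * q) := by
              rw [← ENNReal.rpow_add _ _ (enorm_ne_zero.2 hx) enorm_ne_top]; rfl
            rw [mul_add, mul_add, mul_left_comm, this, show -(2 * q - a) = a - 2 * q by ring, 
              mul_comm ((np f x) ^ q)]
          rw [s1, lintegral_add_right _ (meas_pw _), lintegral_add_left (show Measurable fun x : F => ‖x‖ₑ ^ a * ML f x ^ q from (meas_pw _).mul mML), h3']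
          have u1 : ∫⁻ x in Metric.ball (0:F) 1, ‖x‖ₑ ^ a * (ML f x) ^ q ≤ C1 * J :=
            (setLIntegral_le_lintegral _ _).trans (h1 f h.meas)
          have u2 : ∫⁻ x in Metric.ball (0:F) 1, ‖x‖ₑ ^ (a - 2 * q) * (np f x) ^ q ≤ C2 * J :=
            (setLIntegral_le_lintegral _ _).trans (h2 f h.meas)
          calc _ ≤ C1 * J + C2 * J + A1 := by gcongr
            _ ≤ C1 * J + C2 * J + A1 + (A1 * J + C1 + C2) := le_self_add
            _ = _ := by ring
      _ ≤ c * (((C1 + C2 + A1 + 1) * ((∫⁻ x : F, ‖x‖ₑ ^ a * (f x) ^ q) + 1)) + 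
            (C1 + C2 + A1 + 1) * (e * ∫⁻ x in Metric.ball (0:F) 1, W x)) := by
          refine mul_le_mul_right (add_le_add ?_ ?_) _
          · exact mul_le_mul_left le_self_add _
          · exact le_mul_of_one_le_left' (le_add_self)
      _ = _ := by ring

lemma ofReal_integral_le {g : F → ℝ} (hg : Integrable g) : 
    ENNReal.ofReal (∫ x, g x) ≤ ∫⁻ x, ENNReal.ofReal (g x) := by
  rw [integral_eq_lintegral_pos_part_sub_lintegral_neg_part hg]
  refine le_trans (ENNReal.ofReal_le_ofReal (sub_le_self _ ENNReal.toReal_nonneg)) ?_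
  exact ENNReal.ofReal_toReal_le

lemma bet_ball {ε : ℝ} (hε : 0 < ε) : 
    ∫ z in Metric.ball (0:F) ε, bet ε z = ∫ z in Metric.ball (0:F) 1, bet 1 z := by
  have h := bet_integral (F := F) hε ((Metric.ball (0:F) ε).indicator fun _ => 1)
  rw [← integral_indicator Metric.isOpen_ball.measurableSet, 
    ← integral_indicator Metric.isOpen_ball.measurableSet]
  convert h using 2
  · ext z
    by_cases hz : z ∈ Metric.ball (0:F) ε
    · rw [indicator_of_mem hz, indicator_of_mem hz, mul_one]
    · rw [indicator_of_notMem hz, indicator_of_notMem hz, mul_zero]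
  · ext z
    have : ε • z ∈ Metric.ball (0:F) ε ↔ z ∈ Metric.ball (0:F) 1 := by
      rw [mem_ball_zero_iff, mem_ball_zero_iff, norm_smul, Real.norm_eq_abs, abs_of_pos hε]
      constructor <;> intro h <;> nlinarith
    by_cases hz : z ∈ Metric.ball (0:F) 1
    · rw [indicator_of_mem hz, indicator_of_mem (this.2 hz), mul_one]
    · rw [indicator_of_notMem hz, indicator_of_notMem (fun h => hz (this.1 h)), mul_zero]

lemma bet_ball_pos (hM : 3 ≤ Module.finrank ℝ F) : 0 < ∫ z in Metric.ball (0:F) 1, bet 1 z := by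
  rw [setIntegral_pos_iff_support_of_nonneg_ae (Eventually.of_forall fun x => bet_nonneg hM one_pos x)
    bet_one_integrable.integrableOn]
  have : Function.support (bet 1 : F → ℝ) = univ := by
    ext x; simp [(bet_pos hM one_pos x).ne']
  rw [this, univ_inter]; exact Metric.measure_ball_pos _ _ one_pos

end rhs

open Set MeasureTheory Filter Topology

set_option linter.unusedSectionVars false

section tbd
open scoped ENNReal
open scoped Laplacian

variable {F : Type*} [NormedAddCommGroup F] [InnerProductSpace ℝ F] [FiniteDimensional ℝ F]
  [MeasurableSpace F] [BorelSpace F]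

/-- choice of the regularisation parameter -/
lemma eps_choice (hM : 3 ≤ Module.finrank ℝ F) {a N δ : ℝ} (ha : 0 < a) (hδ : 0 < δ) {Q : ℝ≥0∞} 
    (hQ : Q ≠ ∞) : ∃ ε : ℝ, 0 < ε ∧ ε < δ ∧ (∀ y ∈ Metric.ball (0:F) ε, N ≤ Gam ε y) ∧ 
      ENNReal.ofReal (ε ^ a) * Q ≤ 1 := by
  have hM' : (3:ℝ) ≤ Module.finrank ℝ F := by exact_mod_cast hM
  have t1 : Tendsto (fun ε : ℝ => (2 * ε ^ 2) ^ (((Module.finrank ℝ F : ℝ) - 2) / 2)) (𝓝[>] 0) (𝓝[>] 0) := by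
    refine tendsto_nhdsWithin_iff.2 ⟨?_, ?_⟩
    · have : ContinuousAt (fun ε : ℝ => (2 * ε ^ 2) ^ (((Module.finrank ℝ F : ℝ) - 2) / 2)) 0 :=
        ContinuousAt.rpow_const (by fun_prop) (Or.inr (by linarith))
      have h0 : (2 * (0:ℝ) ^ 2) ^ (((Module.finrank ℝ F : ℝ) - 2) / 2) = 0 := by
        rw [show (2 * (0:ℝ) ^ 2) = 0 by ring, Real.zero_rpow (by linarith)]
      rw [ContinuousAt, h0] at this
      exact this.mono_left nhdsWithin_le_nhds
    · filter_upwards [self_mem_nhdsWithin] with ε hε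
      have : (0:ℝ) < ε := hε
      exact Set.mem_Ioi.2 (by positivity)
  have t2 := (tendsto_inv_nhdsGT_zero.comp t1).eventually (eventually_ge_atTop N)
  have t3 : Tendsto (fun ε : ℝ => ε ^ a * Q.toReal) (𝓝[>] 0) (𝓝 0) := by
    have : ContinuousAt (fun ε : ℝ => ε ^ a * Q.toReal) 0 :=
      (ContinuousAt.rpow_const (by fun_prop) (Or.inr ha.le)).mul continuousAt_const
    rw [ContinuousAt, Real.zero_rpow ha.ne', zero_mul] at this
    exact this.mono_left nhdsWithin_le_nhds
  have t4 := t3.eventually (eventually_le_nhds zero_lt_one)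
  have t5 : ∀ᶠ ε : ℝ in 𝓝[>] 0, ε < δ := nhdsWithin_le_nhds (eventually_lt_nhds hδ)
  obtain ⟨ε, h1, h2, h3, h4⟩ := (t2.and (t4.and (t5.and self_mem_nhdsWithin))).exists
  have hε : 0 < ε := h4
  refine ⟨ε, hε, h3, fun y hy => h1.trans ?_, ?_⟩
  · rw [mem_ball_zero_iff] at hy
    simp only [Function.comp]
    unfold Gam rp
    rw [show -((Module.finrank ℝ F : ℝ) - 2) / 2 = -(((Module.finrank ℝ F : ℝ) - 2) / 2) by ring, 
      ← Real.rpow_neg (by positivity)]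
    refine Real.rpow_le_rpow_of_nonpos (by positivity) ?_ (by linarith)
    have : ‖y‖ ^ 2 ≤ ε ^ 2 := by gcongr
    linarith
  · rw [← ENNReal.ofReal_toReal hQ, ← ENNReal.ofReal_mul (by positivity), ← ENNReal.ofReal_one]
    exact ENNReal.ofReal_le_ofReal h2

lemma test_bound (hM : 4 ≤ Module.finrank ℝ F) {p q : ℝ} (hpq : p.HolderConjugate q) 
    (hMq : 2 * q < Module.finrank ℝ F) :
    ∃ C : ℝ, 0 < C ∧ ∀ (f : F → ℝ≥0∞) (L r R : ℝ), Adm f L r R → ∀ B : ℝ, 0 ≤ B → 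
      (∫⁻ x : F, ‖x‖ₑ ^ (((Module.finrank ℝ F : ℝ) - 2) * (q - 1)) * (f x) ^ q) ≤ ENNReal.ofReal B →
      ∀ (D : Set F) (v : F → ℝ), IsOpen D → 0 ∈ D → ContDiffOn ℝ 2 v D → (∀ x ∈ D, 0 < v x) → 
      (∀ x ∈ D, Δ v x = v x ^ p) → (∀ x, x ∉ D → ‖x‖ ≤ 2 → nk x < np f x + 1) → 
      v 0 ≤ C * (B + 1) := by
  have hM3 : 3 ≤ Module.finrank ℝ F := by omega
  have hM' : (4:ℝ) ≤ Module.finrank ℝ F := by exact_mod_cast hM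
  have hq := hpq.symm.lt
  have hp := hpq.lt
  set j := ⌈2 * q⌉₊ with hj
  have hj3 : 2 * q ≤ (j:ℝ) + 3 := by have := Nat.le_ceil (2 * q); linarith
  obtain ⟨C1, hC1, hpt⟩ := test_pt (F := F) hM3 hpq hj3
  obtain ⟨C2, hC2, hrhs⟩ := rhs_bound (F := F) hM hpq hMq
  set c1 := ∫ z in Metric.ball (0:F) 1, bet 1 z with hc1
  have hc1p : 0 < c1 := bet_ball_pos hM3
  set c0 : ℝ := 1 / 2 * (1/2) ^ (j+3) * c1 with hc0
  have hc0p : 0 < c0 := by positivity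
  refine ⟨2 * C1 * (C2.toReal + 1) / c0, by positivity, ?_⟩
  intro f L r R h B hB hJ D v hD h0D hv hvpos hvl hE
  obtain ⟨κ1, hκ1, hnp⟩ := np_le_pot hM3 h one_pos
  obtain ⟨κ2, hκ2, hmol⟩ := mol_le hM3 h
  obtain ⟨κ, hκ, hκ1', hκ2'⟩ : ∃ κ : ℝ, 0 < κ ∧ κ < κ1 ∧ κ < κ2 := 
    ⟨min κ1 κ2 / 2, by positivity, by have := min_le_left κ1 κ2; have : 0 < min κ1 κ2 := by positivity
                                      linarith, by have := min_le_right κ1 κ2; have : 0 < min κ1 κ2 := by positivity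
                                                   linarith⟩
  replace hnp := hnp κ hκ hκ1'
  replace hmol := hmol κ hκ hκ2'
  obtain ⟨N, hN, hnpN⟩ := h.np_bdd hM3
  set S := pot κ (volume.withDensity f) with hSdef
  have hS0 : ∀ x, 0 ≤ S x := fun x => S_nonneg h one_pos hκ x
  have hSN : ∀ x, S x ≤ N := fun x => 
    (ENNReal.ofReal_le_ofReal_iff hN.le).1 ((pot_le_np hM3 h hκ x).trans (hnpN x))
  obtain ⟨Q, hQ, hrhs⟩ := hrhs f L r R h
  have hv0 := hvpos 0 h0D
  obtain ⟨δ, hδ, hδD⟩ : ∃ δ > 0, ∀ y ∈ Metric.ball (0:F) δ, y ∈ D ∧ v 0 / 2 ≤ v y := by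
    have e1 : ∀ᶠ y in 𝓝 (0:F), y ∈ D := hD.mem_nhds h0D
    have e2 : ∀ᶠ y in 𝓝 (0:F), v 0 / 2 ≤ v y := 
      (hv.continuousOn.continuousAt (hD.mem_nhds h0D)).eventually (eventually_ge_nhds (by linarith))
    exact Metric.eventually_nhds_iff_ball.1 (e1.and e2)
  have ha0 : 0 < ((Module.finrank ℝ F : ℝ) - 2) * (q - 1) := mul_pos (by linarith) (by linarith)
  obtain ⟨ε, hε, hεδ, hεG, hεQ⟩ := eps_choice (F := F) hM3 (N := 2 * (N + 2)) ha0 hδ hQ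
  replace hrhs := hrhs ε hε
  have hsgc := sg_cd h hε hκ
  set K : Set F := {x | 0 ≤ sg ε κ f x} with hK
  have hKT : ∀ x ∈ K, S x + 2 ≤ Gam ε x := by
    intro x hx
    have := sg_mul h hε hκ x
    have h2 := mul_nonneg (Gam_pos hε x).le hx
    linarith
  have hK1 : ∀ x ∈ K, ‖x‖ < 1 := by
    intro x hx
    by_contra hcon
    rw [not_lt] at hcon
    have hx0 : x ≠ 0 := norm_pos_iff.1 (by linarith)
    have h1 := Gam_le hM3 hε hx0
    have h2 : ‖x‖ ^ (-((Module.finrank ℝ F : ℝ) - 2)) ≤ 1 := 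
      Real.rpow_le_one_of_one_le_of_nonpos hcon (by linarith)
    have := hKT x hx
    linarith [hS0 x]
  have hKc : IsCompact K := by
    refine Metric.isCompact_of_isClosed_isBounded (isClosed_le continuous_const hsgc.continuous) ?_
    exact Metric.isBounded_ball.subset (fun x hx => mem_ball_zero_iff.2 (hK1 x hx))
  have hKD : K ⊆ D := by
    intro x hx
    by_contra hcon
    have h1 := hE x hcon (by linarith [hK1 x hx])
    have h2 : np f x + 1 ≤ ENNReal.ofReal (Gam ε x) := by
      calc np f x + 1 ≤ ENNReal.ofReal (S x + 1) + 1 := by gcongr; exact hnp x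
        _ = ENNReal.ofReal (S x + 2) := by
            rw [← ENNReal.ofReal_one, ← ENNReal.ofReal_add (by linarith [hS0 x]) zero_le_one]
            congr 1; ring
        _ ≤ _ := ENNReal.ofReal_le_ofReal (hKT x hx)
    exact absurd (h1.trans_le (h2.trans (Gam_le_nk hM3 hε x))) (lt_irrefl _)
  have hph := ph_cd h hε hκ j
  have hph0 : ∀ x, sg ε κ f x ≤ 0 → ph j ε κ f x = 0 := by
    intro x hx
    rw [ph, max_eq_right hx]; simp
  have hphK : ∀ x ∉ K, ph j ε κ f x = 0 := fun x hx => hph0 x (not_le.1 hx).le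
  have hlap0 : ∀ x, sg ε κ f x ≤ 0 → Δ (ph j ε κ f) x = 0 := by
    intro x hx
    rw [ph_lap h hε hκ j x, max_eq_right hx]; simp
  have hgr := green_ibp hD hKc hKD hph.contDiffOn hphK hv
  set P : F → ℝ := fun x => (max (sg ε κ f x) 0) ^ (j+3) with hP
  have hPc : Continuous P := by
    have := hsgc.continuous
    fun_prop
  have hPK : ∀ x ∉ K, P x = 0 := fun x hx => by
    simp only [hP]; rw [max_eq_right (not_le.1 hx).le]; simp
  have hvK : ContinuousOn v K := hv.continuousOn.mono hKD
  have hbc := bet_continuous (F := F) hε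
  have i1 : Integrable fun x => v x * (P x * bet ε x) :=
    integrable_of_supp hKc (hvK.mul (hPc.mul hbc).continuousOn) (fun x hx => by rw [hPK x hx]; simp)
  have i2 : Integrable fun x => v x * Δ (ph j ε κ f) x := by
    refine integrable_of_supp hKc (hvK.mul ?_) (fun x hx => by rw [hlap0 x (not_le.1 hx).le]; simp)
    exact (lap_continuousOn isOpen_univ hph.contDiffOn).mono (subset_univ _)
  have i3 : Integrable fun x => ph j ε κ f x * v x ^ p := by
    refine integrable_of_supp hKc (hph.continuous.continuousOn.mul ?_) (fun x hx => by rw [hphK x hx]; simp)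
    exact hvK.rpow_const (fun x hx => Or.inl (hvpos x (hKD hx)).ne')
  have hgr2 : ∫ x, v x * Δ (ph j ε κ f) x = ∫ x, ph j ε κ f x * v x ^ p := by
    rw [hgr]
    refine integral_congr_ae (Eventually.of_forall fun x => ?_)
    by_cases hx : x ∈ K
    · simp only [hvl x (hKD hx)]
    · simp only [hphK x hx, zero_mul]
  set g : F → ℝ := fun x => v x * (P x * bet ε x) + v x * Δ (ph j ε κ f) x - ph j ε κ f x * v x ^ p with hg
  have hgi : Integrable g := (i1.add i2).sub i3
  have hgint : ∫ x, g x = ∫ x, v x * (P x * bet ε x) := by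
    simp only [hg]
    have i12 : Integrable fun x => v x * (P x * bet ε x) + v x * Δ (ph j ε κ f) x := i1.add i2
    rw [integral_sub i12 i3, integral_add i1 i2, hgr2]; ring
  set rr : F → ℝ := fun x => (Gam ε x) ^ (1 - q) * 
        ((ML f x).toReal ^ q + (np f x).toReal ^ q * ‖x‖ ^ (-(2*q)) + ‖x‖ ^ (-(2*q))) with hrr
  have up : ENNReal.ofReal (∫ x, g x) ≤ ENNReal.ofReal (C1 * ((C2.toReal + 1) * (B + 2))) := by
    refine (ofReal_integral_le hgi).trans ?_
    have hJ' : C2 * ((∫⁻ x : F, ‖x‖ₑ ^ (((Module.finrank ℝ F : ℝ) - 2) * (q - 1)) * (f x) ^ q) + 1 + 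
        ENNReal.ofReal (ε ^ (((Module.finrank ℝ F : ℝ) - 2) * (q - 1))) * Q) ≤ 
        ENNReal.ofReal ((C2.toReal + 1) * (B + 2)) := by
      calc _ ≤ C2 * (ENNReal.ofReal B + 1 + 1) := by gcongr
        _ = ENNReal.ofReal (C2.toReal * (B + 1 + 1)) := by
            rw [ENNReal.ofReal_mul ENNReal.toReal_nonneg, ENNReal.ofReal_toReal hC2, 
              ENNReal.ofReal_add (by positivity) zero_le_one, ENNReal.ofReal_add hB zero_le_one, ENNReal.ofReal_one]
        _ ≤ _ := ENNReal.ofReal_le_ofReal (by nlinarith [ENNReal.toReal_nonneg (a := C2)])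
    calc ∫⁻ x, ENNReal.ofReal (g x) ≤ ∫⁻ x, (Metric.ball (0:F) 1).indicator 
          (fun x => ENNReal.ofReal C1 * ENNReal.ofReal (rr x)) x := by
          refine lintegral_mono_ae ?_
          filter_upwards [ae_ne_zero (F := F) (by omega)] with x hx
          by_cases hs : 0 < sg ε κ f x
          · have hxK : x ∈ K := hs.le
            have hx1 := hK1 x hxK
            rw [indicator_of_mem (mem_ball_zero_iff.2 hx1), ← ENNReal.ofReal_mul hC1.le]
            refine ENNReal.ofReal_le_ofReal ?_
            have := hpt f L r R ε κ h hε hκ hnp hmol x hx hx1 hs (v x) (hvpos x (hKD hxK))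
            simp only [hg, hP, hrr]
            linarith
          · rw [not_lt] at hs
            have : g x = 0 := by
              simp only [hg, hP, hph0 x hs, hlap0 x hs, max_eq_right hs]; simp
            rw [this]; simp
      _ = ∫⁻ x in Metric.ball (0:F) 1, ENNReal.ofReal C1 * ENNReal.ofReal (rr x) := by
          rw [lintegral_indicator Metric.isOpen_ball.measurableSet]
      _ = ENNReal.ofReal C1 * ∫⁻ x in Metric.ball (0:F) 1, ENNReal.ofReal (rr x) := 
          lintegral_const_mul' _ _ ENNReal.ofReal_ne_top
      _ ≤ ENNReal.ofReal C1 * ENNReal.ofReal ((C2.toReal + 1) * (B + 2)) := by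
          gcongr 1
          exact hrhs.trans hJ'
      _ = _ := by rw [← ENNReal.ofReal_mul hC1.le]
  have up' : ∫ x, g x ≤ C1 * ((C2.toReal + 1) * (B + 2)) := 
    (ENNReal.ofReal_le_ofReal_iff (by positivity)).1 up
  have low : v 0 * c0 ≤ ∫ x, g x := by
    rw [hgint]
    have hnn : ∀ x, 0 ≤ v x * (P x * bet ε x) := by
      intro x
      by_cases hx : x ∈ K
      · have := hvpos x (hKD hx)
        have := bet_nonneg hM3 hε x
        have : 0 ≤ P x := by simp only [hP]; positivity
        positivity
      · rw [hPK x hx]; simp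
    calc v 0 * c0 = ∫ x in Metric.ball (0:F) ε, (v 0 / 2 * (1/2) ^ (j+3)) * bet ε x := by
          rw [integral_const_mul, bet_ball hε, ← hc1, hc0]; ring
      _ ≤ ∫ x in Metric.ball (0:F) ε, v x * (P x * bet ε x) := by
          refine setIntegral_mono_on ((bet_integrable hε).const_mul _).integrableOn i1.integrableOn 
            Metric.isOpen_ball.measurableSet fun x hx => ?_
          have hxδ := hδD x (Metric.ball_subset_ball hεδ.le hx)
          have hGx := hεG x hx
          have hsg : 1/2 ≤ sg ε κ f x := by
            unfold sg
            have : (S x + 2) / Gam ε x ≤ 1/2 := by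
              rw [div_le_iff₀ (Gam_pos hε x)]
              linarith [hSN x]
            linarith
          have hb := bet_nonneg hM3 hε x
          rw [mul_assoc]
          have : (1/2:ℝ) ^ (j+3) ≤ P x := by
            simp only [hP]
            gcongr
            exact hsg.trans (le_max_left _ _)
          have h6 := hxδ.2
          have h7 := hvpos x hxδ.1
          gcongr
      _ ≤ _ := setIntegral_le_integral i1 (Eventually.of_forall hnn)
  have := low.trans up'
  rw [div_mul_eq_mul_div, le_div_iff₀ hc0p]
  nlinarith [mul_pos hC1 (show 0 < C2.toReal + 1 by positivity)]

end tbd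

open Set MeasureTheory Filter Topology

set_option linter.unusedSectionVars false

section eta
open scoped ENNReal
open scoped Laplacian

/-- a smooth convex version of the positive part -/
noncomputable def et (τ t : ℝ) : ℝ := (τ ^ 3 + (max t 0) ^ 3) ^ (1/3 : ℝ) - τ
/-- derivative of `et` -/
noncomputable def et1 (τ t : ℝ) : ℝ := (max t 0) ^ 2 * (τ ^ 3 + (max t 0) ^ 3) ^ (-(2/3) : ℝ)
/-- second derivative of `et` -/
noncomputable def et2 (τ t : ℝ) : ℝ := 2 * τ ^ 3 * max t 0 * (τ ^ 3 + (max t 0) ^ 3) ^ (-(5/3) : ℝ)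


lemma et_base {τ : ℝ} (hτ : 0 < τ) (t : ℝ) : 0 < τ ^ 3 + (max t 0) ^ 3 := by
  have : 0 ≤ max t 0 := le_max_right _ _
  positivity

lemma et_cd {τ : ℝ} (hτ : 0 < τ) : ContDiff ℝ 2 (et τ) := by
  have h := contDiff_pospow 3 le_rfl
  exact ((contDiff_const.add h).rpow_const_of_ne (fun t => (et_base hτ t).ne')).sub contDiff_const

lemma et_deriv {τ : ℝ} (hτ : 0 < τ) (t : ℝ) : HasDerivAt (et τ) (et1 τ t) t := by
  have h := hasDerivAt_pospow 2 (by norm_num) t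
  have h2 := ((h.const_add (τ ^ 3)).rpow_const (p := 1/3) (Or.inl (et_base hτ t).ne')).sub_const τ
  have h3 : HasDerivAt (et τ) _ t := h2
  refine h3.congr_deriv ?_
  rw [et1, show (1/3 - 1 : ℝ) = -(2/3) by norm_num]; push_cast; ring

lemma et_deriv2 {τ : ℝ} (hτ : 0 < τ) (t : ℝ) : HasDerivAt (et1 τ) (et2 τ t) t := by
  have h := hasDerivAt_pospow 2 (by norm_num) t
  have h1 := hasDerivAt_pospow 1 (by norm_num) t
  have h2 := ((h.const_add (τ ^ 3)).rpow_const (p := -(2/3)) (Or.inl (et_base hτ t).ne'))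
  have h3 : HasDerivAt (et1 τ) _ t := h1.mul h2
  refine h3.congr_deriv ?_
  rw [et2]; norm_num
  have : (τ ^ 3 + (max t 0) ^ 3) ^ (-(2/3) : ℝ) = 
      (τ ^ 3 + (max t 0) ^ 3) ^ (-(5/3) : ℝ) * (τ ^ 3 + (max t 0) ^ 3) := by
    rw [← Real.rpow_add_one (et_base hτ t).ne']; norm_num
  rw [this]; ring

lemma et1_nonneg {τ : ℝ} (hτ : 0 < τ) (t : ℝ) : 0 ≤ et1 τ t :=
  mul_nonneg (sq_nonneg _) (Real.rpow_nonneg (et_base hτ t).le _)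

lemma et2_nonneg {τ : ℝ} (hτ : 0 < τ) (t : ℝ) : 0 ≤ et2 τ t := by
  have : 0 ≤ max t 0 := le_max_right _ _
  have := Real.rpow_nonneg (et_base hτ t).le (-(5/3))
  unfold et2; positivity

lemma et_cube {τ : ℝ} (hτ : 0 < τ) (t : ℝ) : max t 0 ≤ (τ ^ 3 + (max t 0) ^ 3) ^ (1/3 : ℝ) := by
  have h0 : 0 ≤ max t 0 := le_max_right _ _
  have : ((max t 0) ^ 3) ^ (1/3 : ℝ) ≤ (τ ^ 3 + (max t 0) ^ 3) ^ (1/3 : ℝ) := 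
    Real.rpow_le_rpow (by positivity) (by linarith [pow_pos hτ 3]) (by norm_num)
  refine le_trans (le_of_eq ?_) this
  rw [← Real.rpow_natCast, ← Real.rpow_mul h0]; norm_num

lemma et_tau {τ : ℝ} (hτ : 0 < τ) (t : ℝ) : τ ≤ (τ ^ 3 + (max t 0) ^ 3) ^ (1/3 : ℝ) := by
  have h0 : 0 ≤ max t 0 := le_max_right _ _
  have : (τ ^ 3) ^ (1/3 : ℝ) ≤ (τ ^ 3 + (max t 0) ^ 3) ^ (1/3 : ℝ) := 
    Real.rpow_le_rpow (by positivity) (by linarith [pow_nonneg h0 3]) (by norm_num)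
  refine le_trans (le_of_eq ?_) this
  rw [← Real.rpow_natCast, ← Real.rpow_mul hτ.le]; norm_num

lemma et_nonneg {τ : ℝ} (hτ : 0 < τ) (t : ℝ) : 0 ≤ et τ t := by have := et_tau hτ t; unfold et; linarith

lemma et_ge {τ : ℝ} (hτ : 0 < τ) (t : ℝ) : t - τ ≤ et τ t := by
  have := et_cube hτ t; unfold et; linarith [le_max_left t 0]

lemma et_le {τ : ℝ} (hτ : 0 < τ) (t : ℝ) : et τ t ≤ max t 0 := by
  have h0 : 0 ≤ max t 0 := le_max_right _ _
  have : (τ ^ 3 + (max t 0) ^ 3) ^ (1/3 : ℝ) ≤ ((τ + max t 0) ^ 3) ^ (1/3 : ℝ) := 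
    Real.rpow_le_rpow (et_base hτ t).le (by nlinarith [mul_nonneg (mul_nonneg hτ.le h0) (add_nonneg hτ.le h0)]) (by norm_num)
  have h2 : ((τ + max t 0) ^ 3) ^ (1/3 : ℝ) = τ + max t 0 := by
    rw [← Real.rpow_natCast, ← Real.rpow_mul (by positivity)]; norm_num
  unfold et; linarith

lemma et_zero {τ : ℝ} (hτ : 0 < τ) {t : ℝ} (ht : t ≤ 0) : et τ t = 0 := by
  refine le_antisymm ?_ (et_nonneg hτ t)
  have := et_le hτ t
  rwa [max_eq_right ht] at this

lemma et1_le {τ : ℝ} (hτ : 0 < τ) (t : ℝ) : et1 τ t ≤ 1 := by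
  have h0 : 0 ≤ max t 0 := le_max_right _ _
  have hb := et_base hτ t
  have h := et_cube hτ t
  have e : (τ ^ 3 + (max t 0) ^ 3) ^ (-(2/3) : ℝ) = (((τ ^ 3 + (max t 0) ^ 3) ^ (1/3 : ℝ)) ^ 2)⁻¹ := by
    rw [Real.rpow_neg hb.le, ← Real.rpow_natCast (_ ^ (1/3:ℝ)) 2, ← Real.rpow_mul hb.le]; norm_num
  rw [et1, e, ← div_eq_mul_inv]
  exact div_le_one_of_le₀ (pow_le_pow_left₀ h0 h 2) (by positivity)

lemma et1_half {t : ℝ} (ht : 1 ≤ t) : 1/2 ≤ et1 1 t := by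
  have h0 : max t 0 = t := max_eq_left (by linarith)
  have hb : (0:ℝ) < 1 + t ^ 3 := by positivity
  have e : (1 ^ 3 + t ^ 3 : ℝ) ^ (-(2/3) : ℝ) ≥ (2 * t ^ 3) ^ (-(2/3) : ℝ) := 
    Real.rpow_le_rpow_of_nonpos (by positivity) (by nlinarith [one_le_pow₀ ht (n := 3)]) (by norm_num)
  have e2 : (2 * t ^ 3) ^ (-(2/3) : ℝ) = 2 ^ (-(2/3) : ℝ) * (t ^ 2)⁻¹ := by
    have ht0 : 0 ≤ t := by linarith
    rw [Real.mul_rpow (by norm_num) (by positivity), Real.rpow_neg (by positivity : 0 ≤ t ^ 3), 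
      ← Real.rpow_natCast t 3, ← Real.rpow_mul ht0, ← Real.rpow_natCast t 2]; norm_num
  have e3 : (2:ℝ) ^ (-(2/3) : ℝ) ≥ 2 ^ (-1 : ℝ) := 
    Real.rpow_le_rpow_of_exponent_le (by norm_num) (by norm_num)
  rw [Real.rpow_neg_one] at e3
  rw [et1, h0]
  calc (1/2 : ℝ) = t ^ 2 * (2⁻¹ * (t ^ 2)⁻¹) := by field_simp
    _ ≤ t ^ 2 * (1 ^ 3 + t ^ 3 : ℝ) ^ (-(2/3) : ℝ) := by
      gcongr
      refine le_trans ?_ e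
      rw [e2]; gcongr

lemma et2_bound {T s : ℝ} (hT : 0 ≤ T) (hs : 0 ≤ s) : et2 1 s * (s + T) ^ 3 ≤ 8 * (1 + T) ^ 3 := by
  have hb : (0:ℝ) < 1 + s ^ 3 := by positivity
  have e : (1 + s ^ 3 : ℝ) ^ (-(5/3) : ℝ) * (1 + s ^ 3) = (1 + s ^ 3 : ℝ) ^ (-(2/3) : ℝ) := by
    rw [← Real.rpow_add_one hb.ne']; norm_num
  have e2 : (1 + s ^ 3 : ℝ) ^ (-(2/3) : ℝ) ≤ (1 + s ^ 3 : ℝ) ^ (-(1/3) : ℝ) := 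
    Real.rpow_le_rpow_of_exponent_le (by nlinarith [pow_nonneg hs 3]) (by norm_num)
  have h3 := et_cube one_pos s
  rw [max_eq_left hs, one_pow] at h3
  have e3 : s * (1 + s ^ 3 : ℝ) ^ (-(1/3) : ℝ) ≤ 1 := by
    rw [Real.rpow_neg hb.le, ← div_eq_mul_inv]
    exact div_le_one_of_le₀ h3 (by positivity)
  have e4 : s * (1 + s ^ 3 : ℝ) ^ (-(2/3) : ℝ) ≤ 1 := le_trans (by gcongr) e3
  have h5 : (s + T) ^ 3 ≤ (1 + T) ^ 3 * (4 * (1 + s ^ 3)) := by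
    have h6 : s + T ≤ (1 + T) * (1 + s) := by nlinarith
    have h7 : (1 + s) ^ 3 ≤ 4 * (1 + s ^ 3) := by nlinarith [mul_nonneg (by linarith : 0 ≤ 1 + s) (sq_nonneg (s - 1))]
    calc (s + T) ^ 3 ≤ ((1 + T) * (1 + s)) ^ 3 := by gcongr
      _ = (1 + T) ^ 3 * (1 + s) ^ 3 := by ring
      _ ≤ _ := by gcongr
  have hx : 0 ≤ (1 + s ^ 3 : ℝ) ^ (-(5/3) : ℝ) := by positivity
  rw [et2, max_eq_left hs, one_pow, mul_one]
  calc 2 * s * (1 + s ^ 3) ^ (-(5/3) : ℝ) * (s + T) ^ 3 ≤ 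
      2 * s * (1 + s ^ 3) ^ (-(5/3) : ℝ) * ((1 + T) ^ 3 * (4 * (1 + s ^ 3))) := by gcongr
    _ = 8 * (1 + T) ^ 3 * (s * ((1 + s ^ 3) ^ (-(5/3) : ℝ) * (1 + s ^ 3))) := by ring
    _ ≤ 8 * (1 + T) ^ 3 * 1 := by rw [e]; gcongr
    _ = _ := by ring

end eta

open Set MeasureTheory Filter Topology

set_option linter.unusedSectionVars false

section lsub
open scoped ENNReal
open scoped Laplacian

variable {F : Type*} [NormedAddCommGroup F] [InnerProductSpace ℝ F] [FiniteDimensional ℝ F]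
  [MeasurableSpace F] [BorelSpace F]

lemma Gam_grad_sq (hM : 4 ≤ Module.finrank ℝ F) {κ r : ℝ} (hκ : 0 < κ) {x : F} 
    (hx : ‖x‖ ^ 2 + κ ^ 2 ≤ r ^ 2) : 
    ‖fderiv ℝ (Gam κ : F → ℝ) x‖ ^ 2 ≤ 
      ((Module.finrank ℝ F : ℝ) - 2) ^ 2 * (r ^ 2) ^ (((Module.finrank ℝ F : ℝ) - 4) / 2) * Gam κ x ^ 3 := by
  have hM' : (4:ℝ) ≤ Module.finrank ℝ F := by exact_mod_cast hM
  set M : ℝ := (Module.finrank ℝ F : ℝ) with hMdef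
  have hb := rp_base_pos hκ x
  have h1 := Gam_norm_fderiv (by omega) hκ x
  have hrp := rp_pos hκ (-M / 2) x
  calc ‖fderiv ℝ (Gam κ : F → ℝ) x‖ ^ 2 ≤ ((M - 2) * rp κ (-M / 2) x * ‖x‖) ^ 2 := by gcongr
    _ = (M - 2) ^ 2 * (rp κ (-M / 2) x ^ 2 * ‖x‖ ^ 2) := by ring
    _ ≤ (M - 2) ^ 2 * (rp κ (-M / 2) x ^ 2 * (‖x‖ ^ 2 + κ ^ 2)) := by
        gcongr; linarith [sq_nonneg κ]
    _ = (M - 2) ^ 2 * ((‖x‖ ^ 2 + κ ^ 2) ^ ((M - 4) / 2) * Gam κ x ^ 3) := by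
        unfold Gam rp
        congr 1
        rw [← Real.rpow_natCast _ 2, ← Real.rpow_natCast _ 3, ← Real.rpow_mul hb.le, ← Real.rpow_mul hb.le, 
          ← Real.rpow_add_one hb.ne', ← Real.rpow_add hb]
        congr 1; push_cast; ring
    _ ≤ (M - 2) ^ 2 * ((r ^ 2) ^ ((M - 4) / 2) * Gam κ x ^ 3) := by
        have := (Gam_pos hκ x).le
        gcongr
    _ = _ := by ring

/-- local bound for almost subharmonic functions -/
lemma local_sub (hM : 4 ≤ Module.finrank ℝ F) {r : ℝ} (hr : 0 < r) : ∃ A > 0, ∀ u : F → ℝ, ContDiff ℝ 2 u → 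
    (∀ x, 0 ≤ u x) → ∀ η : ℝ, 0 ≤ η → (∀ x ∈ Metric.closedBall (0:F) r, -η ≤ Δ u x) → 
    u 0 ≤ A * (η + ∫ x in Metric.closedBall (0:F) r, u x) := by
  have hM' : (4:ℝ) ≤ Module.finrank ℝ F := by exact_mod_cast hM
  have hM3 : 3 ≤ Module.finrank ℝ F := by omega
  set M : ℝ := (Module.finrank ℝ F : ℝ) with hMdef
  obtain ⟨A1, hA1, hrad⟩ := rad_in (F := F) (by omega) (s := M - 2) (by linarith)
  set T : ℝ := (r ^ 2) ^ (-(M - 2) / 2) with hT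
  have hT0 : 0 < T := by positivity
  set A0 : ℝ := 8 * (1 + T) ^ 3 * ((M - 2) ^ 2 * (r ^ 2) ^ ((M - 4) / 2)) with hA0
  have hA00 : 0 ≤ A0 := by positivity
  set Z : ℝ := (A1 * ENNReal.ofReal (2 * r) ^ (M - (M - 2))).toReal with hZ
  have hZ0 : 0 ≤ Z := ENNReal.toReal_nonneg
  set c1 : ℝ := ∫ z in Metric.ball (0:F) 1, bet 1 z with hc1
  have hc1p : 0 < c1 := bet_ball_pos hM3
  refine ⟨2 / c1 * (A0 + Z + 1), by positivity, fun u hu hu0 η hη hlap => ?_⟩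
  set I : ℝ := ∫ x in Metric.closedBall (0:F) r, u x with hI
  have hI0 : 0 ≤ I := setIntegral_nonneg measurableSet_closedBall fun x _ => hu0 x
  have huc := hu.continuous
  refine le_of_forall_pos_le_add fun δ hδ => ?_
  obtain ⟨δ1, hδ1, hcont⟩ := Metric.continuousAt_iff.1 huc.continuousAt δ hδ
  obtain ⟨κ, hκ, hκδ, hbig, -⟩ := eps_choice (F := F) (N := T + 1) hM3 one_pos (lt_min hδ1 hr) (Q := 0) (by simp)
  set G : F → ℝ := fun x => Gam κ x - T with hG
  set ζ : F → ℝ := fun x => et 1 (G x) with hζ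
  have hGcd : ContDiff ℝ 2 G := (Gam_contDiff hκ).sub contDiff_const
  have hGle : ∀ x : F, r ^ 2 ≤ ‖x‖ ^ 2 + κ ^ 2 → G x ≤ 0 := by
    intro x hx
    simp only [hG, Gam, rp, hT]
    rw [sub_nonpos]
    exact Real.rpow_le_rpow_of_nonpos (by positivity) hx (by rw [← hMdef]; linarith)
  have hζcd : ContDiff ℝ 2 ζ := (et_cd one_pos).comp hGcd
  have hζ0 : ∀ x, 0 ≤ ζ x := fun x => et_nonneg one_pos _
  have hout : ∀ x ∉ Metric.closedBall (0:F) r, r ^ 2 ≤ ‖x‖ ^ 2 + κ ^ 2 := by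
    intro x hx
    have : r < ‖x‖ := by simpa using hx
    nlinarith [sq_nonneg κ]
  have hζK : ∀ x ∉ Metric.closedBall (0:F) r, ζ x = 0 := fun x hx => et_zero one_pos (hGle x (hout x hx))
  have hgr := green_ibp isOpen_univ (isCompact_closedBall (0:F) r) (subset_univ _) hζcd.contDiffOn hζK hu.contDiffOn
  have hGl : ∀ x, Δ G x = - bet κ x := by
    intro x
    rw [hG, lap_sub (Gam_contDiff hκ).contDiffAt contDiffAt_const, lap_const, Gam_lap hκ, sub_zero]
  have hfd : ∀ x, fderiv ℝ G x = fderiv ℝ (Gam κ) x := fun x => fderiv_sub_const _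
  have hζl : ∀ x, Δ ζ x = et1 1 (G x) * (- bet κ x) + et2 1 (G x) * ‖fderiv ℝ (Gam κ : F → ℝ) x‖ ^ 2 := by
    intro x
    rw [hζ, lap_comp hGcd.contDiffAt (et_cd one_pos).contDiffAt (Eventually.of_forall fun t => et_deriv one_pos t) 
      (et_deriv2 one_pos _), hGl, gdot_self, hfd]
  have hζb : ∀ x, Δ ζ x ≤ A0 - et1 1 (G x) * bet κ x := by
    intro x
    rw [hζl]
    have : et2 1 (G x) * ‖fderiv ℝ (Gam κ : F → ℝ) x‖ ^ 2 ≤ A0 := by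
      by_cases hx : r ^ 2 ≤ ‖x‖ ^ 2 + κ ^ 2
      · have := hGle x hx
        rw [et2, max_eq_right this]; simpa using hA00
      · push Not at hx
        have h1 := Gam_grad_sq hM hκ hx.le
        have hGp : 0 ≤ G x := by
          simp only [hG, Gam, rp, hT, sub_nonneg]
          exact Real.rpow_le_rpow_of_nonpos (rp_base_pos hκ x) hx.le (by linarith)
        have h2 := et2_bound hT0.le hGp
        have h3 : G x + T = Gam κ x := by simp [hG]
        rw [h3] at h2
        calc _ ≤ et2 1 (G x) * ((M - 2) ^ 2 * (r ^ 2) ^ ((M - 4) / 2) * Gam κ x ^ 3) := by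
              have := et2_nonneg one_pos (G x)
              gcongr
          _ = (et2 1 (G x) * Gam κ x ^ 3) * ((M - 2) ^ 2 * (r ^ 2) ^ ((M - 4) / 2)) := by ring
          _ ≤ _ := by rw [hA0]; gcongr
    linarith
  have hcb : IsCompact (Metric.closedBall (0:F) r) := isCompact_closedBall _ _
  -- integral of zeta
  have hζi : Integrable ζ := integrable_of_supp hcb hζcd.continuous.continuousOn hζK
  have hζZ : ∫ x, ζ x ≤ Z := by
    have hfin : A1 * ENNReal.ofReal (2 * r) ^ (M - (M - 2)) ≠ ∞ := 
      ENNReal.mul_ne_top hA1 (ENNReal.rpow_ne_top_of_nonneg (by linarith) ENNReal.ofReal_ne_top)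
    rw [hZ, ← ENNReal.ofReal_le_iff_le_toReal hfin, ← hrad (2 * r) (by positivity), 
      ← lintegral_indicator Metric.isOpen_ball.measurableSet]
    refine (ofReal_integral_le hζi).trans (lintegral_mono fun x => ?_)
    by_cases hx : x ∈ Metric.ball (0:F) (2 * r)
    · rw [indicator_of_mem hx]
      refine le_trans (ENNReal.ofReal_le_ofReal ?_) (Gam_le_nk hM3 hκ x)
      refine (et_le one_pos _).trans (max_le ?_ (Gam_pos hκ x).le)
      simp only [hG]; linarith
    · rw [indicator_of_notMem hx, hζK x, ENNReal.ofReal_zero]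
      intro h; apply hx
      simp only [Metric.mem_closedBall, Metric.mem_ball, dist_zero_right] at h ⊢; linarith
  have hlapc : Continuous fun x => Δ u x := continuousOn_univ.1 (lap_continuousOn isOpen_univ hu.contDiffOn)
  have hlapz : Continuous fun x => Δ ζ x := continuousOn_univ.1 (lap_continuousOn isOpen_univ hζcd.contDiffOn)
  have e1 : -(η * Z) ≤ ∫ x, ζ x * Δ u x := by
    have : ∫ x, -(η * ζ x) ≤ ∫ x, ζ x * Δ u x := by
      refine integral_mono (hζi.const_mul η).neg (integrable_of_supp hcb 
        (hζcd.continuous.mul hlapc).continuousOn fun x hx => by rw [hζK x hx, zero_mul]) fun x => ?_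
      by_cases hx : x ∈ Metric.closedBall (0:F) r
      · have := hlap x hx
        have := hζ0 x
        simp only
        nlinarith
      · simp [hζK x hx]
    rw [integral_neg, integral_const_mul] at this
    nlinarith
  have hlz0 := lap_zero_of_supp (Metric.isClosed_closedBall) hζK
  have hui : IntegrableOn u (Metric.closedBall (0:F) r) := huc.continuousOn.integrableOn_compact hcb
  have hbi : IntegrableOn (fun x => u x * bet κ x) (Metric.ball (0:F) κ) := 
    ((huc.mul (bet_continuous hκ)).continuousOn.integrableOn_compact 
      (isCompact_closedBall (0:F) κ)).mono_set Metric.ball_subset_closedBall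
  have hsub : Metric.ball (0:F) κ ⊆ Metric.closedBall 0 r := 
    (Metric.ball_subset_ball (hκδ.le.trans (min_le_right _ _))).trans Metric.ball_subset_closedBall
  have e2 : ∫ x, u x * Δ ζ x ≤ A0 * I - 1 / 2 * ∫ x in Metric.ball (0:F) κ, u x * bet κ x := by
    rw [hI, ← integral_indicator measurableSet_closedBall, ← integral_indicator Metric.isOpen_ball.measurableSet, 
      ← integral_const_mul, ← integral_const_mul, ← integral_sub 
        ((hui.integrable_indicator measurableSet_closedBall).const_mul _)
        ((hbi.integrable_indicator Metric.isOpen_ball.measurableSet).const_mul _)]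
    refine integral_mono (integrable_of_supp hcb (huc.mul hlapz).continuousOn fun x hx => by 
      simp only [hlz0 x hx, mul_zero]) (((hui.integrable_indicator measurableSet_closedBall).const_mul _).sub
        ((hbi.integrable_indicator Metric.isOpen_ball.measurableSet).const_mul _)) fun x => ?_
    simp only
    by_cases hx : x ∈ Metric.closedBall (0:F) r
    · rw [indicator_of_mem hx]
      have h1 := hζb x
      have h2 := hu0 x
      have h3 := bet_nonneg hM3 hκ x
      have h4 : u x * Δ ζ x ≤ u x * (A0 - et1 1 (G x) * bet κ x) := by gcongr
      by_cases hxk : x ∈ Metric.ball (0:F) κ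
      · rw [indicator_of_mem hxk]
        have h5 : 1 / 2 ≤ et1 1 (G x) := et1_half (by simp only [hG]; linarith [hbig x hxk])
        have h6 : 1 / 2 * (u x * bet κ x) ≤ et1 1 (G x) * (u x * bet κ x) := by gcongr
        linarith
      · rw [indicator_of_notMem hxk]
        have h6 : 0 ≤ et1 1 (G x) * (u x * bet κ x) := mul_nonneg (et1_nonneg one_pos _) (by positivity)
        linarith
    · have hxk : x ∉ Metric.ball (0:F) κ := fun h => hx (hsub h)
      rw [indicator_of_notMem hx, indicator_of_notMem hxk, hlz0 x hx]; simp
  have e3 : (u 0 - δ) * c1 ≤ ∫ x in Metric.ball (0:F) κ, u x * bet κ x := by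
    rw [hc1, ← bet_ball hκ, ← integral_const_mul]
    refine setIntegral_mono_on ((bet_integrable hκ).integrableOn.const_mul _) hbi Metric.isOpen_ball.measurableSet 
      fun x hx => ?_
    have h3 := bet_nonneg hM3 hκ x
    refine mul_le_mul_of_nonneg_right ?_ h3
    have h4 := hcont (x := x) (lt_of_lt_of_le (Metric.mem_ball.1 hx) (hκδ.le.trans (min_le_left _ _)))
    rw [Real.dist_eq, abs_lt] at h4
    linarith
  have e4 : (u 0 - δ) * c1 ≤ 2 * (A0 * I + η * Z) := by linarith
  have e5 : u 0 - δ ≤ 2 / c1 * (A0 * I + η * Z) := by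
    rw [div_mul_eq_mul_div, le_div_iff₀ hc1p]; exact e4
  have e6 : 2 / c1 * (A0 * I + η * Z) ≤ 2 / c1 * ((A0 + Z + 1) * (η + I)) := by
    refine mul_le_mul_of_nonneg_left ?_ (by positivity)
    nlinarith [mul_nonneg hA00 hη, mul_nonneg hZ0 hI0]
  linarith

end lsub

open Set MeasureTheory Filter Topology

set_option linter.unusedSectionVars false

section cmp
open scoped ENNReal
open scoped Laplacian

variable {F : Type*} [NormedAddCommGroup F] [InnerProductSpace ℝ F] [FiniteDimensional ℝ F]
  [MeasurableSpace F] [BorelSpace F]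

lemma bet_neg (ε : ℝ) (x : F) : bet ε (-x) = bet ε x := by simp [bet, rp]

lemma Gam_neg (ε : ℝ) (x : F) : Gam ε (-x) = Gam ε x := by simp [Gam, rp]

lemma ofReal_pot {k : F → ℝ} (hk : Continuous k) (hk0 : ∀ x, 0 ≤ k x) (ν : Measure F) [IsFiniteMeasure ν] 
    {E : Set F} (hE : IsCompact E) (hν : ν Eᶜ = 0) (x : F) : 
    ENNReal.ofReal (∫ y, k (x - y) ∂ν) = ∫⁻ y, ENNReal.ofReal (k (x - y)) ∂ν := 
  ofReal_integral_eq_lintegral_ofReal (pot_integrable ν hE hν one_pos hk x) 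
    (Eventually.of_forall fun _ => hk0 _)

lemma bh_small (hM : 3 ≤ Module.finrank ℝ F) (ν : Measure F) [IsFiniteMeasure ν] {E : Set F} 
    (hE : IsCompact E) (hν : ν Eᶜ = 0) {b : F → ℝ} (hb : Continuous b) (hb0 : ∀ x, 0 ≤ b x) 
    (hb1 : ∀ x, b x ≤ 1) (hbE : ∀ x ∈ E, b x = 0) {η : ℝ} (hη : 0 < η) : 
    ∃ ε₀ > 0, ∀ ε, 0 < ε → ε < ε₀ → ∫⁻ x, ENNReal.ofReal (b x * mol ε ν x) ≤ ENNReal.ofReal η := by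
  set m : ℝ := (ν univ).toReal with hm
  have hm0 : 0 ≤ m := ENNReal.toReal_nonneg
  obtain ⟨ε₀, hε₀, h⟩ := bet_approx hb (L := 1) (fun x => by rw [abs_of_nonneg (hb0 x)]; exact hb1 x) hE 
    (η := η / (m + 1)) (by positivity)
  refine ⟨ε₀, hε₀, fun ε hε hεε => ?_⟩
  have hbc := bet_continuous (F := F) hε
  have hae : ∀ᵐ y ∂ν, y ∈ E := by rw [ae_iff]; exact hν
  have key : ∀ y ∈ E, ∫⁻ x, ENNReal.ofReal (b x * bet ε (x - y)) ≤ ENNReal.ofReal (η / (m + 1)) := by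
    intro y hy
    have h1 := h ε hε hεε y hy
    rw [hbE y hy, mul_zero, sub_zero] at h1
    have h2 : ∫⁻ x, ENNReal.ofReal (b x * bet ε (x - y)) = ∫⁻ z, ENNReal.ofReal (bet ε z * b (y - z)) := by
      rw [← lintegral_sub_left_eq_self (fun x => ENNReal.ofReal (b x * bet ε (x - y))) y]
      refine lintegral_congr fun z => ?_
      rw [show y - z - y = -z by abel, bet_neg, mul_comm]
    have hi : Integrable fun z => bet ε z * b (y - z) := by
      refine (bet_integrable hε).mono' (by fun_prop) (Eventually.of_forall fun z => ?_)
      rw [Real.norm_eq_abs, abs_of_nonneg (mul_nonneg (bet_nonneg hM hε z) (hb0 _))]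
      exact mul_le_of_le_one_right (bet_nonneg hM hε z) (hb1 _)
    rw [h2, ← ofReal_integral_eq_lintegral_ofReal hi (Eventually.of_forall fun z => 
      mul_nonneg (bet_nonneg hM hε z) (hb0 _))]
    exact ENNReal.ofReal_le_ofReal ((le_abs_self _).trans h1)
  calc ∫⁻ x, ENNReal.ofReal (b x * mol ε ν x) 
      = ∫⁻ x, ∫⁻ y, ENNReal.ofReal (b x * bet ε (x - y)) ∂ν := by
        refine lintegral_congr fun x => ?_
        rw [ENNReal.ofReal_mul (hb0 x), mol, ofReal_pot hbc (bet_nonneg hM hε) ν hE hν, 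
          ← lintegral_const_mul]
        · simp only [ENNReal.ofReal_mul (hb0 x)]
        · fun_prop
    _ = ∫⁻ y, (∫⁻ x, ENNReal.ofReal (b x * bet ε (x - y))) ∂ν := by
        rw [lintegral_lintegral_swap]
        have : Continuous (Function.uncurry fun x y : F => b x * bet ε (x - y)) := by
          unfold Function.uncurry; fun_prop
        exact this.measurable.ennreal_ofReal.aemeasurable
    _ ≤ ∫⁻ y, ENNReal.ofReal (η / (m + 1)) ∂ν := by
        refine lintegral_mono_ae ?_
        filter_upwards [hae] with y hy using key y hy
    _ = ENNReal.ofReal (η / (m + 1)) * ENNReal.ofReal m := by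
        rw [lintegral_const, hm, ENNReal.ofReal_toReal (measure_ne_top _ _)]
    _ ≤ _ := by
        rw [← ENNReal.ofReal_mul (by positivity)]
        refine ENNReal.ofReal_le_ofReal ?_
        rw [div_mul_eq_mul_div, div_le_iff₀ (by positivity)]
        nlinarith

lemma sub_test {D K : Set F} (hD : IsOpen D) (hK : IsCompact K) (hKD : K ⊆ D) {ρ : ℝ} 
    (hKρ : K ⊆ Metric.closedBall 0 ρ) {p : ℝ} (hp : 0 < p) {w : F → ℝ} (hwc : Continuous w) 
    (hw2 : ContDiffOn ℝ 2 w D) (hwl : ∀ x ∈ D, Δ w x = w x ^ p) (hw0 : ∀ x, 0 ≤ w x) (hw1 : ∀ x, w x ≤ 1) 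
    {u h : F → ℝ} (hu : ContDiff ℝ 2 u) (hu0 : ∀ x, 0 ≤ u x) (huK : ∀ x ∉ K, u x = 0) (hh : Continuous h) 
    (hh0 : ∀ x, 0 ≤ h x) (hlap : ∀ x, - h x ≤ Δ u x) {r ω : ℝ} (hω : 0 ≤ ω) 
    (hwr : ∀ x ∈ Metric.closedBall (0:F) r, ω ≤ w x) : 
    ω ^ p * (∫ x in Metric.closedBall (0:F) r, u x) ≤ ∫ x in Metric.closedBall (0:F) ρ, (1 - w x) * h x := by
  have g1 := green_ibp hD hK hKD hu.contDiffOn huK hw2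
  have g2 := green_ibp hD hK hKD hu.contDiffOn huK (contDiffOn_const (c := (1:ℝ)))
  have huc := hu.continuous
  have hlc : Continuous fun x => Δ u x := continuousOn_univ.1 (lap_continuousOn isOpen_univ hu.contDiffOn)
  have hl0 := lap_zero_of_supp hK.isClosed huK
  have i1 : Integrable fun x => w x * Δ u x := integrable_of_supp hK (hwc.mul hlc).continuousOn 
    fun x hx => by simp only [hl0 x hx, mul_zero]
  have i2 : Integrable fun x => 1 * Δ u x := integrable_of_supp hK (continuous_const.mul hlc).continuousOn 
    fun x hx => by simp only [hl0 x hx, mul_zero]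
  have hwpc : Continuous fun x => w x ^ p := hwc.rpow_const fun x => Or.inr hp.le
  have i3 : Integrable fun x => u x * w x ^ p := integrable_of_supp hK (huc.mul hwpc).continuousOn 
    fun x hx => by simp only [huK x hx, zero_mul]
  have e1 : ∫ x, u x * w x ^ p = ∫ x, w x * Δ u x := by
    rw [g1]
    refine integral_congr_ae (Eventually.of_forall fun x => ?_)
    by_cases hx : x ∈ K
    · simp only [hwl x (hKD hx)]
    · simp only [huK x hx, zero_mul]
  have e2 : ∫ x, 1 * Δ u x = 0 := by
    rw [g2]; simp [lap_const]
  have e3 : ∫ x, u x * w x ^ p = ∫ x, (1 - w x) * -(Δ u x) := by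
    rw [e1, ← sub_zero (∫ x, w x * Δ u x), ← e2, ← integral_sub i1 i2]
    refine integral_congr_ae (Eventually.of_forall fun x => ?_)
    simp only; ring
  have i4 : Integrable fun x => (1 - w x) * -(Δ u x) := 
    integrable_of_supp hK ((continuous_const.sub hwc).mul hlc.neg).continuousOn 
      fun x hx => by simp only [hl0 x hx, neg_zero, mul_zero]
  have i5 : IntegrableOn (fun x => (1 - w x) * h x) (Metric.closedBall (0:F) ρ) := 
    ((continuous_const.sub hwc).mul hh).continuousOn.integrableOn_compact (isCompact_closedBall _ _)
  have i6 : IntegrableOn u (Metric.closedBall (0:F) r) := 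
    huc.continuousOn.integrableOn_compact (isCompact_closedBall _ _)
  calc ω ^ p * (∫ x in Metric.closedBall (0:F) r, u x) 
      = ∫ x in Metric.closedBall (0:F) r, ω ^ p * u x := (integral_const_mul _ _).symm
    _ ≤ ∫ x in Metric.closedBall (0:F) r, u x * w x ^ p := by
        refine setIntegral_mono_on (i6.const_mul _) i3.integrableOn measurableSet_closedBall fun x hx => ?_
        have := hwr x hx
        have := hu0 x
        rw [mul_comm]; gcongr
    _ ≤ ∫ x, u x * w x ^ p := setIntegral_le_integral i3 (Eventually.of_forall fun x => 
        mul_nonneg (hu0 x) (Real.rpow_nonneg (hw0 x) _))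
    _ = ∫ x, (1 - w x) * -(Δ u x) := e3
    _ ≤ ∫ x, (Metric.closedBall (0:F) ρ).indicator (fun x => (1 - w x) * h x) x := by
        refine integral_mono i4 (i5.integrable_indicator measurableSet_closedBall) fun x => ?_
        have h1 := hw1 x
        by_cases hx : x ∈ K
        · rw [indicator_of_mem (hKρ hx)]
          have := hlap x
          simp only
          gcongr <;> linarith
        · simp only [hl0 x hx, neg_zero, mul_zero]
          exact indicator_nonneg (fun y _ => mul_nonneg (by linarith [hw1 y]) (hh0 y)) x
    _ = _ := integral_indicator measurableSet_closedBall

/-- facts about the potential of a continuous density -/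
lemma dens {g : F → ℝ} (hg : Continuous g) (hg0 : ∀ x, 0 ≤ g x) {E : Set F} (hE : IsCompact E) 
    (hgE : ∀ x ∉ E, g x = 0) : IsFiniteMeasure ((volume : Measure F).withDensity fun x => ENNReal.ofReal (g x)) ∧ 
    ((volume : Measure F).withDensity fun x => ENNReal.ofReal (g x)) Eᶜ = 0 ∧ 
    ∀ k : F → ℝ, ∀ x, ∫ y, k (x - y) ∂((volume : Measure F).withDensity fun x => ENNReal.ofReal (g x)) = 
      ∫ z, k z * g (x - z) := by
  have hi : Integrable g := integrable_of_supp hE hg.continuousOn hgE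
  refine ⟨isFiniteMeasure_withDensity_ofReal hi.2, ?_, fun k x => ?_⟩
  · rw [withDensity_apply _ hE.measurableSet.compl, 
      setLIntegral_congr_fun hE.measurableSet.compl (g := fun _ => 0) 
        (fun x hx => by simp only [hgE x hx, ENNReal.ofReal_zero])]
    simp
  · rw [integral_withDensity_eq_integral_toReal_smul hg.measurable.ennreal_ofReal (by simp), 
      ← integral_sub_left_eq_self (fun y => (ENNReal.ofReal (g y)).toReal • k (x - y)) volume x]
    refine integral_congr_ae (Eventually.of_forall fun z => ?_)
    simp only [sub_sub_cancel, ENNReal.toReal_ofReal (hg0 _), smul_eq_mul]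
    ring

end cmp

open Set MeasureTheory Filter Topology

set_option linter.unusedSectionVars false

section cmp
open scoped ENNReal
open scoped Laplacian

variable {F : Type*} [NormedAddCommGroup F] [InnerProductSpace ℝ F] [FiniteDimensional ℝ F]
  [MeasurableSpace F] [BorelSpace F]

lemma Gam_le_zero (hM : 3 ≤ Module.finrank ℝ F) {ε : ℝ} (hε : 0 < ε) (x : F) : Gam ε x ≤ Gam ε (0:F) := by
  have hM' : (3:ℝ) ≤ Module.finrank ℝ F := by exact_mod_cast hM
  unfold Gam rp
  exact Real.rpow_le_rpow_of_nonpos (by positivity) (by simp) (by linarith)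

lemma int_le_mass (ν : Measure F) [IsFiniteMeasure ν] {E : Set F} (hE : IsCompact E) (hν : ν Eᶜ = 0) 
    {k : F → ℝ} (hk : Continuous k) {x : F} {c : ℝ} (h : ∀ y ∈ E, k (x - y) ≤ c) : 
    ∫ y, k (x - y) ∂ν ≤ (ν univ).toReal * c := by
  have hae : ∀ᵐ y ∂ν, y ∈ E := by rw [ae_iff]; exact hν
  have : ∫ y, k (x - y) ∂ν ≤ ∫ y, c ∂ν := by
    refine integral_mono_ae (pot_integrable ν hE hν one_pos hk x) (integrable_const _) ?_
    filter_upwards [hae] with y hy using h y hy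
  simpa [Measure.real] using this

lemma eps_small (hM : 4 ≤ Module.finrank ℝ F) (ν : Measure F) [IsFiniteMeasure ν] {E : Set F} 
    (hE : IsCompact E) (hν : ν Eᶜ = 0) {r : ℝ} (hr : 0 < r) (hEr : ∀ y ∈ E, 2 * r ≤ ‖y‖) {X : ℝ} 
    (hX : ENNReal.ofReal X ≤ ∫⁻ y, nk y ∂ν) {δ : ℝ} (hδ : 0 < δ) : 
    ∀ᶠ ε in 𝓝[>] (0:ℝ), X - δ ≤ pot ε ν 0 ∧ ∀ x ∈ Metric.closedBall (0:F) r, mol ε ν x ≤ δ := by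
  have hM' : (4:ℝ) ≤ Module.finrank ℝ F := by exact_mod_cast hM
  have hM3 : 3 ≤ Module.finrank ℝ F := by omega
  set M : ℝ := (Module.finrank ℝ F : ℝ) with hMdef
  set mE : ℝ := (ν univ).toReal with hmE
  have hmE0 : 0 ≤ mE := ENNReal.toReal_nonneg
  set P : ℝ := mE * r ^ (-(M - 2)) with hP
  have hP0 : 0 ≤ P := by positivity
  have hae : ∀ᵐ y ∂ν, y ∈ E := by rw [ae_iff]; exact hν
  have t1 : Tendsto (fun ε : ℝ => ((1 + ε ^ 2 / r ^ 2) ^ ((M - 2) / 2) - 1) * P) (𝓝[>] 0) (𝓝 0) := by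
    have h1 : ContinuousAt (fun ε : ℝ => ((1 + ε ^ 2 / r ^ 2) ^ ((M - 2) / 2) - 1) * P) 0 := by
      refine ((ContinuousAt.rpow_const ?_ (Or.inr (by linarith))).sub continuousAt_const).mul continuousAt_const
      fun_prop
    have h2 : ((1 + (0:ℝ) ^ 2 / r ^ 2) ^ ((M - 2) / 2) - 1) * P = 0 := by simp
    rw [ContinuousAt, h2] at h1
    exact h1.mono_left nhdsWithin_le_nhds
  have t2 : Tendsto (fun ε : ℝ => mE * (M * (M - 2) * ε ^ 2 * (r ^ 2) ^ (-(M + 2) / 2))) (𝓝[>] 0) (𝓝 0) := by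
    have h1 : ContinuousAt (fun ε : ℝ => mE * (M * (M - 2) * ε ^ 2 * (r ^ 2) ^ (-(M + 2) / 2))) 0 := by fun_prop
    have h2 : mE * (M * (M - 2) * (0:ℝ) ^ 2 * (r ^ 2) ^ (-(M + 2) / 2)) = 0 := by simp
    rw [ContinuousAt, h2] at h1
    exact h1.mono_left nhdsWithin_le_nhds
  filter_upwards [t1.eventually (gt_mem_nhds hδ), t2.eventually (gt_mem_nhds hδ), self_mem_nhdsWithin] 
    with ε h1 h2 hε
  have hε : 0 < ε := hε
  constructor
  · set Aε : ℝ := (1 + ε ^ 2 / r ^ 2) ^ ((M - 2) / 2) with hAε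
    have hA0 : 0 ≤ Aε := by positivity
    have hA1 : 1 ≤ Aε := Real.one_le_rpow (by have : 0 ≤ ε ^ 2 / r ^ 2 := by positivity
                                              linarith) (by linarith)
    have hp0 : 0 ≤ pot ε ν 0 := integral_nonneg fun y => (Gam_pos hε _).le
    have e1 : ENNReal.ofReal X ≤ ENNReal.ofReal (Aε * pot ε ν 0) := by
      refine hX.trans ?_
      rw [ENNReal.ofReal_mul hA0, pot, ofReal_pot (Gam_continuous hε) (fun z => (Gam_pos hε z).le) ν hE hν, 
        ← lintegral_const_mul _ (by have := Gam_continuous (F := F) hε; fun_prop)]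
      refine lintegral_mono_ae ?_
      filter_upwards [hae] with y hy
      rw [zero_sub, Gam_neg]
      exact nk_le_Gam hM3 hε hr (by linarith [hEr y hy])
    have e2 : X ≤ Aε * pot ε ν 0 := (ENNReal.ofReal_le_ofReal_iff (by positivity)).1 e1
    have e3 : pot ε ν 0 ≤ P := by
      refine int_le_mass ν hE hν (Gam_continuous hε) fun y hy => ?_
      have hy' := hEr y hy
      have hyr : r ≤ ‖y‖ := by linarith
      rw [zero_sub, Gam_neg]
      refine (Gam_le hM3 hε (norm_pos_iff.1 (by linarith))).trans ?_
      exact Real.rpow_le_rpow_of_nonpos hr hyr (by linarith)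
    nlinarith
  · intro x hx
    have hx' : ‖x‖ ≤ r := by simpa using hx
    refine (int_le_mass ν hE hν (bet_continuous hε) fun y hy => ?_).trans h2.le
    refine bet_le_out hM3 hε hr ?_
    have := norm_sub_norm_le y x
    rw [norm_sub_rev] at this
    linarith [hEr y hy]

lemma far_small (hM : 4 ≤ Module.finrank ℝ F) (ν : Measure F) [IsFiniteMeasure ν] {E : Set F} 
    (hE : IsCompact E) (hν : ν Eᶜ = 0) {δ : ℝ} (hδ : 0 < δ) : 
    ∃ ρ : ℝ, 0 < ρ ∧ ∀ ε > 0, ∀ x : F, ρ ≤ ‖x‖ → pot ε ν x ≤ δ := by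
  have hM' : (4:ℝ) ≤ Module.finrank ℝ F := by exact_mod_cast hM
  have hM3 : 3 ≤ Module.finrank ℝ F := by omega
  set M : ℝ := (Module.finrank ℝ F : ℝ) with hMdef
  set mE : ℝ := (ν univ).toReal with hmE
  have hmE0 : 0 ≤ mE := ENNReal.toReal_nonneg
  obtain ⟨R, hR, hER⟩ := hE.isBounded.exists_pos_norm_le
  set t : ℝ := 1 + mE / δ with ht
  have ht1 : 1 ≤ t := by have : 0 ≤ mE / δ := by positivity
                         linarith
  refine ⟨R + t, by linarith, fun ε hε x hx => ?_⟩
  refine (int_le_mass ν hE hν (Gam_continuous hε) (c := t⁻¹) fun y hy => ?_).trans ?_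
  · have h1 : t ≤ ‖x - y‖ := by linarith [norm_sub_norm_le x y, hER y hy]
    refine (Gam_le hM3 hε (norm_pos_iff.1 (by linarith))).trans ?_
    refine (Real.rpow_le_rpow_of_nonpos (by linarith) h1 (by linarith)).trans ?_
    rw [← Real.rpow_neg_one]
    exact Real.rpow_le_rpow_of_exponent_le ht1 (by linarith)
  · rw [← div_eq_mul_inv, div_le_iff₀ (by linarith), ht, mul_add, mul_div_cancel₀ _ hδ.ne']
    linarith

end cmp

open Set MeasureTheory Filter Topology

set_option linter.unusedSectionVars false

section cmp
open scoped ENNReal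
open scoped Laplacian

variable {F : Type*} [NormedAddCommGroup F] [InnerProductSpace ℝ F] [FiniteDimensional ℝ F]
  [MeasurableSpace F] [BorelSpace F]

/-- the truncated power of a potential, its potential, and the basic inequalities -/
lemma cutoff_pot (hM : 4 ≤ Module.finrank ℝ F) {p : ℝ} (hp : 1 < p) (μ : Measure F) [IsFiniteMeasure μ] 
    {E : Set F} (hE : IsCompact E) (hμ : μ Eᶜ = 0) {Y : ℝ} (hY0 : 0 ≤ Y) 
    (hY : ∫⁻ x, nk x * (∫⁻ y, nk (x - y) ∂μ) ^ p ≤ ENNReal.ofReal Y) {ε ρ η : ℝ} (hε : 0 < ε) (hη : 0 < η) : 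
    ∃ Q : F → ℝ, ContDiff ℝ 2 Q ∧ (∀ x, 0 ≤ Q x) ∧ Q 0 ≤ Y ∧ 
      ∀ x ∈ Metric.closedBall (0:F) ρ, Δ Q x ≤ - (cM F * pot ε μ x ^ p - η) := by
  have hM3 : 3 ≤ Module.finrank ℝ F := by omega
  set mE : ℝ := (μ univ).toReal with hmE
  have hmE0 : 0 ≤ mE := ENNReal.toReal_nonneg
  have hpot := pot_contDiff μ hE hμ hε
  have hpc := hpot.continuous
  have hp0 : ∀ x, 0 ≤ pot ε μ x := fun x => integral_nonneg fun y => (Gam_pos hε _).le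
  have hpm : ∀ x, pot ε μ x ≤ mE * Gam ε (0:F) := fun x => 
    int_le_mass μ hE hμ (Gam_continuous hε) fun y _ => Gam_le_zero hM3 hε _
  set χ : F → ℝ := fun x => max 0 (min 1 (ρ + 1 - ‖x‖)) with hχ
  have hχc : Continuous χ := by fun_prop
  have hχ0 : ∀ x, 0 ≤ χ x := fun x => le_max_left _ _
  have hχ1 : ∀ x, χ x ≤ 1 := fun x => max_le zero_le_one (min_le_left _ _)
  have hχin : ∀ x ∈ Metric.closedBall (0:F) ρ, χ x = 1 := by
    intro x hx
    have : ‖x‖ ≤ ρ := by simpa using hx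
    simp only [hχ]
    rw [min_eq_left (by linarith), max_eq_right zero_le_one]
  have hχout : ∀ x ∉ Metric.closedBall (0:F) (ρ + 1), χ x = 0 := by
    intro x hx
    have : ρ + 1 < ‖x‖ := by simpa using hx
    simp only [hχ]
    rw [max_eq_left ((min_le_right _ _).trans (by linarith))]
  set g : F → ℝ := fun x => χ x * pot ε μ x ^ p with hg
  have hgc : Continuous g := hχc.mul (hpc.rpow_const fun x => Or.inr (by linarith))
  have hg0 : ∀ x, 0 ≤ g x := fun x => mul_nonneg (hχ0 x) (Real.rpow_nonneg (hp0 x) _)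
  have hgle : ∀ x, g x ≤ pot ε μ x ^ p := fun x => mul_le_of_le_one_left (Real.rpow_nonneg (hp0 x) _) (hχ1 x)
  have hgb : ∀ x, |g x| ≤ (mE * Gam ε (0:F)) ^ p := by
    intro x
    rw [abs_of_nonneg (hg0 x)]
    exact (hgle x).trans (Real.rpow_le_rpow (hp0 x) (hpm x) (by linarith))
  have hgK : ∀ x ∉ Metric.closedBall (0:F) (ρ + 1), g x = 0 := fun x hx => by
    simp only [hg, hχout x hx, zero_mul]
  obtain ⟨κ₀, hκ₀, happ⟩ := bet_approx hgc hgb (isCompact_closedBall (0:F) ρ) hη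
  set κ := κ₀ / 2 with hκd
  have hκ : 0 < κ := by positivity
  have happ' := happ κ hκ (by linarith)
  have hcb := isCompact_closedBall (0:F) (ρ + 1)
  obtain ⟨hfin, hsupp, hint⟩ := dens hgc hg0 hcb hgK
  set ν := (volume : Measure F).withDensity fun x => ENNReal.ofReal (g x) with hνd
  refine ⟨pot κ ν, pot_contDiff ν hcb hsupp hκ, fun x => integral_nonneg fun y => (Gam_pos hκ _).le, ?_, ?_⟩
  · rw [pot, hint, ← ENNReal.ofReal_le_ofReal_iff hY0]
    have hi : Integrable fun z => Gam κ z * g (0 - z) := by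
      refine integrable_of_supp hcb ((Gam_continuous hκ).mul (hgc.comp (by fun_prop))).continuousOn 
        fun x hx => ?_
      rw [zero_sub, hgK, mul_zero]
      simpa using hx
    refine (ofReal_integral_le hi).trans (le_trans ?_ hY)
    rw [← lintegral_neg_eq_self (fun x => nk x * (∫⁻ y, nk (x - y) ∂μ) ^ p)]
    refine lintegral_mono fun z => ?_
    rw [nk_neg, zero_sub, ENNReal.ofReal_mul (Gam_pos hκ z).le]
    refine mul_le_mul' (Gam_le_nk hM3 hκ z) ?_
    refine (ENNReal.ofReal_le_ofReal (hgle (-z))).trans ?_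
    rw [← ENNReal.ofReal_rpow_of_nonneg (hp0 _) (by linarith)]
    refine ENNReal.rpow_le_rpow ?_ (by linarith)
    rw [pot, ofReal_pot (Gam_continuous hε) (fun z => (Gam_pos hε z).le) μ hE hμ]
    exact lintegral_mono fun y => Gam_le_nk hM3 hε _
  · intro x hx
    rw [pot_lap ν hcb hsupp hκ, mol, hint]
    have h1 := abs_le.1 (happ' x hx)
    have h2 : g x = pot ε μ x ^ p := by simp only [hg, hχin x hx, one_mul]
    rw [h2] at h1
    linarith [h1.1]

theorem compare (hM : 4 ≤ Module.finrank ℝ F) {p : ℝ} (hp : 1 < p) {D E : Set F} (hD : IsOpen D) 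
    (h0 : (0:F) ∈ D) (hE : IsCompact E) (hED : ∀ x ∈ E, x ∉ D) {w : ℝ → F → ℝ} 
    (hwc : ∀ m > 0, Continuous (w m)) (hw2 : ∀ m > 0, ContDiffOn ℝ 2 (w m) D) 
    (hwl : ∀ m > 0, ∀ x ∈ D, Δ (w m) x = (w m x) ^ p) (hwb : ∀ m > 0, ∀ x, x ∉ D → w m x = m) 
    (hw0 : ∀ m > 0, ∀ x, 0 ≤ w m x) (hwm : ∀ m > 0, ∀ x, w m x ≤ m) (hw1 : ∀ x ∈ D, 0 < w 1 x) {Wst : ℝ} 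
    (hW : ∀ m > 0, w m 0 ≤ Wst) (μ : Measure F) [IsFiniteMeasure μ] (hμ : μ Eᶜ = 0) {X Y : ℝ} 
    (hX : ENNReal.ofReal X ≤ ∫⁻ y, nk y ∂μ) (hY0 : 0 ≤ Y) 
    (hY : ∫⁻ x, nk x * (∫⁻ y, nk (x - y) ∂μ) ^ p ≤ ENNReal.ofReal Y) : X - Y / cM F ≤ Wst := by
  have hM3 : 3 ≤ Module.finrank ℝ F := by omega
  have hcM := cM_pos (F := F) hM3
  obtain ⟨r', hr', hball⟩ := Metric.isOpen_iff.1 hD 0 h0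
  set r := r' / 2 with hr
  have hrp : 0 < r := by positivity
  have hrD : Metric.closedBall (0:F) r ⊆ D := (Metric.closedBall_subset_ball (by linarith)).trans hball
  have hEr : ∀ y ∈ E, 2 * r ≤ ‖y‖ := by
    intro y hy
    by_contra h
    push Not at h
    exact hED y hy (hball (by simpa using by linarith))
  obtain ⟨A, hA, hloc⟩ := local_sub hM hrp
  obtain ⟨x₀, hx₀, hmin⟩ := (isCompact_closedBall (0:F) r).exists_isMinOn ⟨0, by simp [hrp.le]⟩ 
    (hwc 1 one_pos).continuousOn
  set ω := w 1 x₀ with hω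
  have hωp : 0 < ω := hw1 x₀ (hrD hx₀)
  have hωr : ∀ x ∈ Metric.closedBall (0:F) r, ω ≤ w 1 x := fun x hx => hmin hx
  have hωpp : 0 < ω ^ p := Real.rpow_pos_of_pos hωp p
  set mE : ℝ := (μ univ).toReal with hmE
  have hmE0 : 0 ≤ mE := ENNReal.toReal_nonneg
  suffices H : ∀ δ > 0, X - Y / cM F - Wst ≤ (3 + A * (2 + 2 / ω ^ p)) * δ by
    have hc : 0 < 3 + A * (2 + 2 / ω ^ p) := by positivity
    have : X - Y / cM F - Wst ≤ 0 := by
      refine le_of_forall_pos_le_add fun e he => ?_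
      have := H (e / (3 + A * (2 + 2 / ω ^ p))) (by positivity)
      rw [mul_div_cancel₀ _ hc.ne'] at this
      linarith
    linarith
  intro δ hδ
  obtain ⟨ρ, hρ, hfar⟩ := far_small hM μ hE hμ (half_pos hδ)
  set V : ℝ := (volume (Metric.closedBall (0:F) ρ)).toReal with hV
  have hV0 : 0 ≤ V := ENNReal.toReal_nonneg
  have hbc : Continuous fun x => 1 - w 1 x := continuous_const.sub (hwc 1 one_pos)
  obtain ⟨ε₁, hε₁, hbh⟩ := bh_small hM3 μ hE hμ (b := fun x => 1 - w 1 x) hbc 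
    (fun x => by linarith [hwm 1 one_pos x]) (fun x => by linarith [hw0 1 one_pos x]) 
    (fun x hx => by rw [hwb 1 one_pos x (hED x hx), sub_self]) hδ
  obtain ⟨ε, ⟨⟨hε3, hε4⟩, hε2⟩, hε1⟩ := (((eps_small hM μ hE hμ hrp hEr hX hδ).and 
    (nhdsWithin_le_nhds (gt_mem_nhds hε₁))).and self_mem_nhdsWithin).exists
  have hε : 0 < ε := hε1
  have hbh' := hbh ε hε hε2
  have hpot := pot_contDiff μ hE hμ hε
  have hpc := hpot.continuous
  have hp0 : ∀ x, 0 ≤ pot ε μ x := fun x => integral_nonneg fun y => (Gam_pos hε _).le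
  have hpm : ∀ x, pot ε μ x ≤ mE * Gam ε (0:F) := fun x => 
    int_le_mass μ hE hμ (Gam_continuous hε) fun y _ => Gam_le_zero hM3 hε _
  set m : ℝ := mE * Gam ε (0:F) + 1 with hm
  have hmp : 0 < m := by have := Gam_pos hε (0:F); positivity
  set η : ℝ := δ / (V + 1) with hη
  have hηp : 0 < η := by positivity
  have hηδ : η ≤ δ := div_le_self hδ.le (by linarith)
  have hηV : η * V ≤ δ := by
    rw [hη, div_mul_eq_mul_div, div_le_iff₀ (by positivity)]; nlinarith
  obtain ⟨Q, hQ2, hQ0, hQY, hQl⟩ := cutoff_pot hM hp μ hE hμ hY0 hY (ρ := ρ) hε (mul_pos hcM hηp)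
  set z : F → ℝ := fun x => pot ε μ x - (cM F)⁻¹ * Q x - w m x - δ with hz
  have hwmc := hwc m hmp
  have hzc : Continuous z := ((hpc.sub (continuous_const.mul hQ2.continuous)).sub hwmc).sub continuous_const
  have hz2 : ContDiffOn ℝ 2 z D := 
    ((hpot.contDiffOn.sub (contDiff_const.mul hQ2).contDiffOn).sub (hw2 m hmp)).sub contDiffOn_const
  have hzle : ∀ x, z x ≤ pot ε μ x - w m x - δ := by
    intro x
    have := mul_nonneg (inv_nonneg.2 hcM.le) (hQ0 x)
    simp only [hz]; linarith
  set K : Set F := {x | 0 ≤ z x} with hK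
  have hKcl : IsClosed K := isClosed_le continuous_const hzc
  have hKρ : K ⊆ Metric.closedBall 0 ρ := by
    intro x hx
    by_contra h
    have h1 : ρ ≤ ‖x‖ := by
      have : ρ < ‖x‖ := by simpa using h
      exact this.le
    have h2 := hfar ε hε x h1
    have h3 : 0 ≤ z x := hx
    linarith [hzle x, hw0 m hmp x]
  have hKc : IsCompact K := (isCompact_closedBall (0:F) ρ).of_isClosed_subset hKcl hKρ
  have hKD : K ⊆ D := by
    intro x hx
    by_contra h
    have h3 : 0 ≤ z x := hx
    have h4 := hwb m hmp x h
    linarith [hzle x, hpm x]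
  set u : F → ℝ := fun x => et δ (z x) with hu
  have huK : ∀ x ∉ K, u x = 0 := fun x hx => et_zero hδ (not_le.1 hx).le
  have hu2 : ContDiff ℝ 2 u := cd2_of_supp hD hKcl hKD ((et_cd hδ).comp_contDiffOn hz2) huK
  have hu0 : ∀ x, 0 ≤ u x := fun x => et_nonneg hδ _
  have hmolc := mol_continuous μ hE hμ hε
  have hmol0 : ∀ x, 0 ≤ mol ε μ x := mol_nonneg hM3 hε μ
  have hlap : ∀ x, -(mol ε μ x + η) ≤ Δ u x := by
    intro x
    by_cases hx : x ∈ K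
    · have hxD := hKD hx
      have hzx : 0 ≤ z x := hx
      have hz2x : ContDiffAt ℝ 2 z x := hz2.contDiffAt (hD.mem_nhds hxD)
      have hw2x : ContDiffAt ℝ 2 (w m) x := (hw2 m hmp).contDiffAt (hD.mem_nhds hxD)
      have e0 : Δ z x = - mol ε μ x - (cM F)⁻¹ * Δ Q x - w m x ^ p := by
        rw [hz, lap_sub ((hpot.contDiffAt.sub (contDiffAt_const.mul hQ2.contDiffAt)).sub hw2x) contDiffAt_const,
          lap_sub (hpot.contDiffAt.sub (contDiffAt_const.mul hQ2.contDiffAt)) hw2x, 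
          lap_sub hpot.contDiffAt (contDiffAt_const.mul hQ2.contDiffAt), lap_const_mul _ hQ2.contDiffAt, lap_const, 
          pot_lap μ hE hμ hε, hwl m hmp x hxD, sub_zero]
      have e1 : pot ε μ x ^ p - η ≤ -((cM F)⁻¹ * Δ Q x) := by
        have := hQl x (hKρ hx)
        rw [← mul_neg, inv_mul_eq_div, le_div_iff₀ hcM]
        linarith
      have e2 : w m x ^ p ≤ pot ε μ x ^ p := 
        Real.rpow_le_rpow (hw0 m hmp x) (by linarith [hzle x]) (by linarith)
      have e3 : -(mol ε μ x + η) ≤ Δ z x := by rw [e0]; linarith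
      rw [hu, lap_comp hz2x (et_cd hδ).contDiffAt (Eventually.of_forall fun t => et_deriv hδ t) (et_deriv2 hδ _)]
      have e4 := mul_nonneg (et2_nonneg hδ (z x)) (gdot_self_nonneg z x)
      have e5 := et1_nonneg hδ (z x)
      have e6 := et1_le hδ (z x)
      have e7 := hmol0 x
      nlinarith
    · rw [lap_zero_of_supp hKcl huK x hx]
      linarith [hmol0 x]
  have l1 := hloc u hu2 hu0 (2 * δ) (by linarith) fun x hx => by
    linarith [hlap x, hε4 x hx]
  have l2 := sub_test (h := fun x => mol ε μ x + η) hD hKc hKD hKρ (by linarith : 0 < p) (hwc 1 one_pos) (hw2 1 one_pos) (hwl 1 one_pos) 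
    (hw0 1 one_pos) (hwm 1 one_pos) hu2 hu0 huK (hmolc.add continuous_const) 
    (fun x => add_nonneg (hmol0 x) hηp.le) hlap hωp.le hωr
  have l3 : ∫ x in Metric.closedBall (0:F) ρ, (1 - w 1 x) * (mol ε μ x + η) ≤ 2 * δ := by
    have i1 : IntegrableOn (fun x => (1 - w 1 x) * mol ε μ x) (Metric.closedBall (0:F) ρ) := 
      (hbc.mul hmolc).continuousOn.integrableOn_compact (isCompact_closedBall _ _)
    have i2 : IntegrableOn (fun _ : F => η) (Metric.closedBall (0:F) ρ) := 
      continuousOn_const.integrableOn_compact (isCompact_closedBall _ _)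
    have b1 : ∫ x in Metric.closedBall (0:F) ρ, (1 - w 1 x) * mol ε μ x ≤ δ := by
      rw [← ENNReal.ofReal_le_ofReal_iff hδ.le, ofReal_integral_eq_lintegral_ofReal i1 
        (Eventually.of_forall fun x => mul_nonneg (by linarith [hwm 1 one_pos x]) (hmol0 x))]
      exact (setLIntegral_le_lintegral _ _).trans hbh'
    have b2 : ∫ x in Metric.closedBall (0:F) ρ, η = η * V := by
      simp [Measure.real, hV, mul_comm]
    calc _ ≤ ∫ x in Metric.closedBall (0:F) ρ, ((1 - w 1 x) * mol ε μ x + η) := by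
          refine setIntegral_mono_on ?_ (i1.add i2) measurableSet_closedBall fun x _ => ?_
          · exact (hbc.mul (hmolc.add continuous_const)).continuousOn.integrableOn_compact (isCompact_closedBall _ _)
          · have := hw0 1 one_pos x
            nlinarith
      _ = _ := integral_add i1 i2
      _ ≤ 2 * δ := by rw [b2]; linarith
  have l4 : ∫ x in Metric.closedBall (0:F) r, u x ≤ 2 * δ / ω ^ p := by
    rw [le_div_iff₀ hωpp, mul_comm]; exact l2.trans l3
  have l5 : z 0 - δ ≤ u 0 := et_ge hδ _
  have l6 : X - δ - Y / cM F - Wst - δ ≤ z 0 := by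
    have h1 : (cM F)⁻¹ * Q 0 ≤ Y / cM F := by rw [div_eq_inv_mul]; gcongr
    simp only [hz]
    linarith [hW m hmp]
  have l7 : u 0 ≤ A * (2 * δ + 2 * δ / ω ^ p) := l1.trans (by gcongr)
  have l8 : A * (2 * δ + 2 * δ / ω ^ p) = A * (2 + 2 / ω ^ p) * δ := by ring
  linarith

end cmp

open Set MeasureTheory Filter Topology

set_option linter.unusedSectionVars false

section dual
open scoped ENNReal

/-- minimax through Hahn-Banach and Riesz-Markov-Kakutani -/
lemma sep_compact {X : Type*} [TopologicalSpace X] [CompactSpace X] [T2Space X] [MeasurableSpace X]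
    [BorelSpace X] (𝓐 : Set C(X, ℝ)) (h0 : (0 : C(X, ℝ)) ∈ 𝓐)
    (hcv : ∀ a ∈ 𝓐, ∀ b ∈ 𝓐, ∀ s t : ℝ, 0 ≤ s → 0 ≤ t → s + t = 1 →
      ∃ c ∈ 𝓐, ∀ x, s * a x + t * b x ≤ c x) (k : C(X, ℝ)) :
    (∃ a ∈ 𝓐, ∀ x, k x < a x) ∨
    ∃ μ : Measure X, IsFiniteMeasure μ ∧ μ ≠ 0 ∧ ∀ a ∈ 𝓐, ∫ x, a x ∂μ ≤ ∫ x, k x ∂μ := by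
  by_cases hk : ∃ a ∈ 𝓐, ∀ x, k x < a x
  · exact Or.inl hk
  right
  set U : Set C(X, ℝ) := {g | ∃ a ∈ 𝓐, ∀ x, g x < a x} with hU
  have hUc : Convex ℝ U := by
    rintro g ⟨a, ha, hga⟩ h ⟨b, hb, hhb⟩ s t hs ht hst
    obtain ⟨c, hc, hcc⟩ := hcv a ha b hb s t hs ht hst
    refine ⟨c, hc, fun x => lt_of_lt_of_le ?_ (hcc x)⟩
    simp only [ContinuousMap.add_apply, ContinuousMap.smul_apply, smul_eq_mul]
    have e1 := hga x
    have e2 := hhb x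
    rcases hs.eq_or_lt with rfl | hs'
    · have : t = 1 := by linarith
      subst this; linarith
    · have := mul_lt_mul_of_pos_left e1 hs'
      have := mul_le_mul_of_nonneg_left e2.le ht
      linarith
  have hUo : IsOpen U := by
    rw [Metric.isOpen_iff]
    rintro g ⟨a, ha, hga⟩
    rcases isEmpty_or_nonempty X with hX | hX
    · exact ⟨1, one_pos, fun h _ => ⟨a, ha, fun x => (hX.false x).elim⟩⟩
    obtain ⟨x0, -, hx0⟩ := isCompact_univ.exists_isMinOn (univ_nonempty (α := X))
      (f := fun x => a x - g x) (by fun_prop)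
    refine ⟨a x0 - g x0, by linarith [hga x0], fun h hh => ⟨a, ha, fun x => ?_⟩⟩
    have h1 := ContinuousMap.dist_lt_iff (by linarith [hga x0]) |>.1 (Metric.mem_ball.1 hh) x
    rw [Real.dist_eq] at h1
    have h2 : a x0 - g x0 ≤ a x - g x := hx0 (mem_univ x)
    linarith [(abs_lt.1 h1).2]
  obtain ⟨l, hl⟩ := geometric_hahn_banach_open_point hUc hUo hk
  have hpos : ∀ h : C(X, ℝ), (∀ x, 0 ≤ h x) → 0 ≤ l h := by
    intro h hh
    by_contra hneg
    push Not at hneg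
    have key : ∀ t : ℝ, 0 ≤ t → l (-1) - t * l h < l k := by
      intro t ht
      have := hl (-1 - t • h) ⟨0, h0, fun x => by
        have := mul_nonneg ht (hh x)
        simp; linarith⟩
      simpa using this
    have := key (|l k - l (-1)| / (- l h)) (by have : 0 < - l h := by linarith
                                               positivity)
    have e : |l k - l (-1)| / (- l h) * l h = - |l k - l (-1)| := by
      have hne : l h ≠ 0 := hneg.ne
      field_simp
    rw [e] at this
    linarith [le_abs_self (l k - l (-1))]
  let Λ : CompactlySupportedContinuousMap X ℝ →ₚ[ℝ] ℝ := PositiveLinearMap.mk₀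
    { toFun := fun f => l f.toContinuousMap
      map_add' := fun f g => by rw [← map_add]; rfl
      map_smul' := fun c f => by rw [RingHom.id_apply, ← map_smul]; rfl }
    (fun f hf => hpos _ fun x => hf x)
  have hint : ∀ g : C(X, ℝ), ∫ x, g x ∂(RealRMK.rieszMeasure Λ) = l g := by
    intro g
    exact RealRMK.integral_rieszMeasure Λ ⟨g, HasCompactSupport.of_compactSpace g⟩
  refine ⟨RealRMK.rieszMeasure Λ, inferInstance, ?_, ?_⟩
  · intro h
    have h1 := hl (-1) ⟨0, h0, fun x => by simp⟩
    rw [← hint, ← hint, h] at h1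
    simp at h1
  · intro a ha
    rw [hint, hint]
    refine le_of_forall_pos_lt_add fun e he => ?_
    have h2 : ∀ s : ℝ, 0 < s → l a - s * l 1 < l k := by
      intro s hs
      have := hl (a - s • 1) ⟨a, ha, fun x => by simp [hs]⟩
      simpa using this
    have h1 : 0 ≤ l 1 := hpos 1 fun x => by simp
    have := h2 (e / (l 1 + 1)) (by positivity)
    have h3 : e / (l 1 + 1) * l 1 ≤ e := by
      rw [div_mul_eq_mul_div, div_le_iff₀ (by positivity)]
      nlinarith
    linarith


variable {F : Type*} [NormedAddCommGroup F] [InnerProductSpace ℝ F] [FiniteDimensional ℝ F]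
  [MeasurableSpace F] [BorelSpace F]

lemma pot_nonneg' {κ : ℝ} (hκ : 0 < κ) (ν : Measure F) (x : F) : 0 ≤ pot κ ν x :=
  integral_nonneg fun y => (Gam_pos hκ _).le

lemma Adm.pot_antitone (hM : 3 ≤ Module.finrank ℝ F) {f : F → ℝ≥0∞} {L r R : ℝ} (h : Adm f L r R)
    {κ κ' : ℝ} (hκ : 0 < κ) (hk : κ ≤ κ') (x : F) :
    pot κ' (volume.withDensity f) x ≤ pot κ (volume.withDensity f) x := by
  have := h.fin
  have hM' : (3:ℝ) ≤ Module.finrank ℝ F := by exact_mod_cast hM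
  refine integral_mono
    (pot_integrable _ (isCompact_closedBall _ _) h.supp one_pos (Gam_continuous (hκ.trans_le hk)) x)
    (pot_integrable _ (isCompact_closedBall _ _) h.supp one_pos (Gam_continuous hκ) x) fun y => ?_
  unfold Gam rp
  exact Real.rpow_le_rpow_of_nonpos (by positivity) (by gcongr) (by linarith)

lemma Adm.comb {f g : F → ℝ≥0∞} {L r R L' r' R' : ℝ} (h : Adm f L r R) (h' : Adm g L' r' R')
    {s t : ℝ} (hs : 0 ≤ s) (ht : 0 ≤ t) :
    Adm (fun x => ENNReal.ofReal s * f x + ENNReal.ofReal t * g x) (s * L + t * L') (min r r')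
      (max R R') where
  meas := (h.meas.const_mul _).add (h'.meas.const_mul _)
  L0 := by have := h.L0; have := h'.L0; positivity
  r0 := lt_min h.r0 h'.r0
  le := fun x => by
    have := h.L0; have := h'.L0
    rw [ENNReal.ofReal_add (by positivity) (by positivity), ENNReal.ofReal_mul hs,
      ENNReal.ofReal_mul ht]
    exact add_le_add (mul_le_mul_right (h.le x) _) (mul_le_mul_right (h'.le x) _)
  zin := fun x hx => by
    rw [h.zin x (hx.trans_le (min_le_left _ _)), h'.zin x (hx.trans_le (min_le_right _ _))]; simp
  zout := fun x hx => by
    rw [h.zout x ((le_max_left _ _).trans_lt hx), h'.zout x ((le_max_right _ _).trans_lt hx)]; simp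

lemma Adm.pot_comb {f g : F → ℝ≥0∞} {L r R L' r' R' : ℝ} (h : Adm f L r R) (h' : Adm g L' r' R')
    {s t : ℝ} (hs : 0 ≤ s) (ht : 0 ≤ t) {κ : ℝ} (hκ : 0 < κ) (x : F) :
    pot κ (volume.withDensity fun x => ENNReal.ofReal s * f x + ENNReal.ofReal t * g x) x =
      s * pot κ (volume.withDensity f) x + t * pot κ (volume.withDensity g) x := by
  have p1 := pot_nonneg' hκ (volume.withDensity f) x
  have p2 := pot_nonneg' hκ (volume.withDensity g) x
  have p3 := pot_nonneg' hκ
    (volume.withDensity fun x => ENNReal.ofReal s * f x + ENNReal.ofReal t * g x) x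
  have hG := Gam_continuous (F := F) hκ
  have hG0 := fun z : F => (Gam_pos hκ z).le
  rw [← ENNReal.ofReal_eq_ofReal_iff p3 (by positivity),
    ENNReal.ofReal_add (by positivity) (by positivity), ENNReal.ofReal_mul hs,
    ENNReal.ofReal_mul ht]
  unfold pot
  rw [(h.comb h' hs ht).ker_ofReal hG hG0, h.ker_ofReal hG hG0, h'.ker_ofReal hG hG0]
  have m1 : Measurable fun y => ENNReal.ofReal (Gam κ (x - y)) := by
    have : Continuous fun y => Gam κ (x - y) := hG.comp (by fun_prop)
    exact this.measurable.ennreal_ofReal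
  have m2 : Measurable fun y => ENNReal.ofReal (Gam κ (x - y)) * f y := m1.mul h.meas
  have m3 : Measurable fun y => ENNReal.ofReal (Gam κ (x - y)) * g y := m1.mul h'.meas
  rw [← lintegral_const_mul _ m2, ← lintegral_const_mul _ m3,
    ← lintegral_add_left (m2.const_mul _)]
  refine lintegral_congr fun y => ?_
  ring

lemma J_comb {f g : F → ℝ≥0∞} (hf : Measurable f) (hg : Measurable g) {w : F → ℝ≥0∞}
    (hw : Measurable w) {q : ℝ} (hq : 1 ≤ q) {B s t : ℝ} (hs : 0 ≤ s) (ht : 0 ≤ t) (hst : s + t = 1)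
    (h1 : ∫⁻ x, w x * (f x) ^ q ≤ ENNReal.ofReal B) (h2 : ∫⁻ x, w x * (g x) ^ q ≤ ENNReal.ofReal B) :
    ∫⁻ x, w x * (ENNReal.ofReal s * f x + ENNReal.ofReal t * g x) ^ q ≤ ENNReal.ofReal B := by
  have e : ENNReal.ofReal s + ENNReal.ofReal t = 1 := by
    rw [← ENNReal.ofReal_add hs ht, hst, ENNReal.ofReal_one]
  have m1 : Measurable fun x => w x * (f x) ^ q := hw.mul (hf.pow_const _)
  have m2 : Measurable fun x => w x * (g x) ^ q := hw.mul (hg.pow_const _)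
  calc ∫⁻ x, w x * (ENNReal.ofReal s * f x + ENNReal.ofReal t * g x) ^ q 
      ≤ ∫⁻ x, (ENNReal.ofReal s * (w x * (f x) ^ q) + ENNReal.ofReal t * (w x * (g x) ^ q)) := by
        refine lintegral_mono fun x => ?_
        refine (mul_le_mul_right (ENNReal.rpow_arith_mean_le_arith_mean2_rpow _ _ (f x) (g x) e hq)
          (w x)).trans (le_of_eq (by ring))
    _ = ENNReal.ofReal s * (∫⁻ x, w x * (f x) ^ q) + ENNReal.ofReal t * ∫⁻ x, w x * (g x) ^ q := by
        rw [lintegral_add_left (m1.const_mul _), lintegral_const_mul _ m1, lintegral_const_mul _ m2]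
    _ ≤ ENNReal.ofReal s * ENNReal.ofReal B + ENNReal.ofReal t * ENNReal.ofReal B :=
        add_le_add (mul_le_mul_right h1 _) (mul_le_mul_right h2 _)
    _ = ENNReal.ofReal B := by rw [← add_mul, e, one_mul]

lemma adm_zero : Adm (fun _ : F => 0) 0 1 1 where
  meas := measurable_const
  L0 := le_rfl
  r0 := one_pos
  le := fun x => zero_le
  zin := fun _ _ => rfl
  zout := fun _ _ => rfl

lemma dual_meas (hM : 3 ≤ Module.finrank ℝ F) {q : ℝ} (hq : 1 ≤ q) {w : F → ℝ≥0∞}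
    (hw : Measurable w) {E : Set F} (hE : IsCompact E) (hE0 : (0:F) ∉ E) (B : ℝ) :
    (∃ (f : F → ℝ≥0∞) (L r R : ℝ), Adm f L r R ∧ ∫⁻ x, w x * (f x) ^ q ≤ ENNReal.ofReal B ∧
      ∀ x ∈ E, nk x < np f x + 1) ∨
    ∃ μ : Measure F, IsFiniteMeasure μ ∧ μ ≠ 0 ∧ μ Eᶜ = 0 ∧
      ∀ (f : F → ℝ≥0∞) (L r R : ℝ), Adm f L r R → ∫⁻ x, w x * (f x) ^ q ≤ ENNReal.ofReal B →
        ∫⁻ x, np f x ∂μ ≤ ∫⁻ x, nk x ∂μ := by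
  have hcE : CompactSpace E := isCompact_iff_compactSpace.1 hE
  have hne : ∀ x ∈ E, x ≠ 0 := fun x hx h => hE0 (h ▸ hx)
  have hkc : Continuous fun x : E => ‖(x:F)‖ ^ (-((Module.finrank ℝ F : ℝ) - 2)) := by
    refine Continuous.rpow_const (by fun_prop) fun x => Or.inl ?_
    exact norm_ne_zero_iff.2 (hne _ x.2)
  set k : C(E, ℝ) := ⟨fun x : E => ‖(x:F)‖ ^ (-((Module.finrank ℝ F : ℝ) - 2)) - 1,
    hkc.sub continuous_const⟩ with hk
  have hcont : ∀ {f : F → ℝ≥0∞} {L r R : ℝ}, Adm f L r R → ∀ {κ : ℝ}, 0 < κ →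
      Continuous (pot κ (volume.withDensity f)) := by
    intro f L r R h κ hκ
    have := h.fin
    exact pot_continuous (Gam_continuous hκ) _ (isCompact_closedBall _ _) h.supp
  set 𝓐 : Set C(E, ℝ) := {a : C(E, ℝ) | ∃ (f : F → ℝ≥0∞) (L r R κ : ℝ), Adm f L r R ∧
      ∫⁻ x, w x * (f x) ^ q ≤ ENNReal.ofReal B ∧ 0 < κ ∧
      ∀ x : E, a x = pot κ (volume.withDensity f) x} with h𝓐
  have hz : (0 : C(E, ℝ)) ∈ 𝓐 := by
    refine ⟨fun _ => 0, 0, 1, 1, 1, adm_zero, ?_, one_pos, fun x => ?_⟩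
    · have : ∀ x : F, w x * (0:ℝ≥0∞) ^ q = 0 := fun x => by
        rw [ENNReal.zero_rpow_of_pos (by linarith), mul_zero]
      simp [this]
    · have : volume.withDensity (fun _ : F => (0:ℝ≥0∞)) = 0 := withDensity_zero
      simp [pot, this]
  have hcv : ∀ a ∈ 𝓐, ∀ b ∈ 𝓐, ∀ s t : ℝ, 0 ≤ s → 0 ≤ t → s + t = 1 →
      ∃ c ∈ 𝓐, ∀ x, s * a x + t * b x ≤ c x := by
    rintro a ⟨f, L, r, R, κ, hf, hJ, hκ, ha⟩ b ⟨g, L', r', R', κ', hg, hJ', hκ', hb⟩ s t hs ht hst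
    have hm : 0 < min κ κ' := lt_min hκ hκ'
    have hA := hf.comb hg hs ht
    refine ⟨⟨fun x : E => pot (min κ κ') (volume.withDensity fun x => ENNReal.ofReal s * f x +
      ENNReal.ofReal t * g x) x, (hcont hA hm).comp continuous_subtype_val⟩,
      ⟨_, _, _, _, _, hA, J_comb hf.meas hg.meas hw hq hs ht hst hJ hJ', hm, fun x => rfl⟩,
      fun x => ?_⟩
    rw [ha, hb]
    refine le_trans ?_ (hf.pot_comb hg hs ht hm x).ge
    gcongr 2
    · exact hf.pot_antitone hM hm (min_le_left _ _) _
    · exact hg.pot_antitone hM hm (min_le_right _ _) _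
  rcases sep_compact 𝓐 hz hcv k with h | h
  · left
    obtain ⟨a, ⟨f, L, r, R, κ, hf, hJ, hκ, ha⟩, hlt⟩ := h
    refine ⟨f, L, r, R, hf, hJ, fun x hx => ?_⟩
    have h1 := hlt ⟨x, hx⟩
    rw [ha] at h1
    have h2 : ‖x‖ ^ (-((Module.finrank ℝ F : ℝ) - 2)) < pot κ (volume.withDensity f) x + 1 := by
      have : ‖x‖ ^ (-((Module.finrank ℝ F : ℝ) - 2)) - 1 < pot κ (volume.withDensity f) x := h1
      linarith
    have p1 := pot_nonneg' hκ (volume.withDensity f) x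
    rw [nk_real (hne x hx)]
    refine ((ENNReal.ofReal_lt_ofReal_iff (by positivity)).2 h2).trans_le ?_
    rw [ENNReal.ofReal_add p1 zero_le_one, ENNReal.ofReal_one]
    exact add_le_add (pot_le_np hM hf hκ x) le_rfl
  · right
    obtain ⟨μ, hμf, hμ0, hμ⟩ := h
    have hme : MeasurableEmbedding (Subtype.val : E → F) :=
      MeasurableEmbedding.subtype_coe hE.measurableSet
    refine ⟨μ.map Subtype.val, inferInstance, ?_, ?_, ?_⟩
    · rwa [Ne, Measure.map_eq_zero_iff measurable_subtype_coe.aemeasurable]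
    · rw [Measure.map_apply measurable_subtype_coe hE.measurableSet.compl]; simp
    · intro f L r R hf hJ
      obtain ⟨κ₀, hκ₀, hκ⟩ := np_le_pot hM hf one_pos
      have h1 := hκ (κ₀ / 2) (by positivity) (by linarith)
      have hc := hcont hf (κ := κ₀ / 2) (by positivity)
      have h2 := hμ ⟨fun x : E => pot (κ₀ / 2) (volume.withDensity f) x, by fun_prop⟩
        ⟨f, L, r, R, κ₀ / 2, hf, hJ, by positivity, fun x => rfl⟩
      rw [hme.lintegral_map, hme.lintegral_map]
      have hint : ∀ g : E → ℝ, Continuous g → Integrable g μ := by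
        intro g hg
        obtain ⟨C, hC⟩ := isCompact_univ.exists_bound_of_continuousOn hg.continuousOn
        exact Integrable.of_bound hg.aestronglyMeasurable C
          (Eventually.of_forall fun x => hC x (mem_univ x))
      have i1 := hint (fun x : E => pot (κ₀ / 2) (volume.withDensity f) x) (by fun_prop)
      have i2 := hint _ hkc
      calc ∫⁻ x : E, np f x ∂μ ≤ ∫⁻ x : E, ENNReal.ofReal
              (pot (κ₀ / 2) (volume.withDensity f) x + 1) ∂μ := lintegral_mono fun x => h1 x
        _ = ENNReal.ofReal (∫ x : E, (pot (κ₀ / 2) (volume.withDensity f) x + 1) ∂μ) := by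
            have i3 : Integrable (fun x : E => pot (κ₀ / 2) (volume.withDensity f) x + 1) μ :=
              i1.add (integrable_const 1)
            rw [ofReal_integral_eq_lintegral_ofReal i3]
            exact Eventually.of_forall fun x =>
              add_nonneg (pot_nonneg' (by positivity) _ _) zero_le_one
        _ ≤ ENNReal.ofReal (∫ x : E, ‖(x:F)‖ ^ (-((Module.finrank ℝ F : ℝ) - 2)) ∂μ) := by
            refine ENNReal.ofReal_le_ofReal ?_
            rw [integral_add i1 (integrable_const 1)]
            have h3 : ∫ x : E, k x ∂μ =
              ∫ x : E, ‖(x:F)‖ ^ (-((Module.finrank ℝ F : ℝ) - 2)) ∂μ - ∫ x : E, (1:ℝ) ∂μ :=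
              integral_sub i2 (integrable_const 1)
            rw [h3] at h2
            have h2' : ∫ x : E, pot (κ₀ / 2) (volume.withDensity f) x ∂μ ≤ _ := h2
            linarith
        _ = ∫⁻ x : E, nk (x:F) ∂μ := by
            rw [ofReal_integral_eq_lintegral_ofReal i2]
            · exact lintegral_congr fun x => (nk_real (hne _ x.2)).symm
            · exact Eventually.of_forall fun x => by positivity

end dual

open Set MeasureTheory Filter Topology

set_option linter.unusedSectionVars false

section dualb
open scoped ENNReal
open scoped Laplacian

lemma scal_dual {p q : ℝ} (hpq : p.HolderConjugate q) {x y b : ℝ} (hy : 0 < y) (hb : 0 < b)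
    (h : (b / y) ^ (1 / q) * y ≤ x) : y ≤ x ^ p * b ^ (1 - p) := by
  have hp := hpq.pos
  have h1 : ((b / y) ^ (1 / q) * y) ^ p ≤ x ^ p := Real.rpow_le_rpow (by positivity) h hp.le
  have e : 1 / q * p = p - 1 := by
    have h3 := hpq.inv_add_inv_eq_one
    have h2 : q⁻¹ = 1 - p⁻¹ := by linarith
    rw [one_div, h2]; field_simp
  rw [Real.mul_rpow (by positivity) hy.le, ← Real.rpow_mul (by positivity), e,
    Real.div_rpow hb.le hy.le] at h1
  have e2 : y ^ p = y ^ (p - 1) * y := by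
    rw [← Real.rpow_add_one hy.ne']; congr 1; ring
  have e3 : b ^ (p - 1) / y ^ (p - 1) * y ^ p = b ^ (p - 1) * y := by
    rw [e2]; have := (Real.rpow_pos_of_pos hy (p - 1)).ne'; field_simp
  rw [e3] at h1
  have e4 : b ^ (1 - p) * b ^ (p - 1) = 1 := by
    rw [← Real.rpow_add hb]; simp
  calc y = b ^ (1 - p) * (b ^ (p - 1) * y) := by rw [← mul_assoc, e4, one_mul]
    _ ≤ b ^ (1 - p) * x ^ p := by gcongr
    _ = _ := mul_comm _ _

variable {F : Type*} [NormedAddCommGroup F] [InnerProductSpace ℝ F] [FiniteDimensional ℝ F]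
  [MeasurableSpace F] [BorelSpace F]

lemma psi_meas (μ : Measure F) [IsFiniteMeasure μ] : Measurable fun x : F => ∫⁻ y, nk (x - y) ∂μ := by
  refine Measurable.lintegral_prod_right ?_
  exact nk_meas.comp (by fun_prop)

lemma np_tonelli (μ : Measure F) [IsFiniteMeasure μ] {f : F → ℝ≥0∞} (hf : Measurable f) :
    ∫⁻ x, np f x ∂μ = ∫⁻ x, f x * ∫⁻ y, nk (x - y) ∂μ := by
  unfold np
  rw [lintegral_lintegral_swap]
  · refine lintegral_congr fun y => ?_
    have hm : Measurable fun z => nk (y - z) := nk_meas.comp (by fun_prop)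
    rw [← lintegral_const_mul _ hm]
    refine lintegral_congr fun x => ?_
    rw [← nk_neg, neg_sub, mul_comm]
  · refine Measurable.aemeasurable ?_
    exact (nk_meas.comp (by fun_prop)).mul (hf.comp measurable_snd)

lemma nk_ne_zero (hM : 3 ≤ Module.finrank ℝ F) (x : F) : nk x ≠ 0 := by
  have hM' : (3:ℝ) ≤ Module.finrank ℝ F := by exact_mod_cast hM
  unfold nk
  intro h
  rcases ENNReal.rpow_eq_zero_iff.1 h with h | h
  · linarith [h.2]
  · exact enorm_ne_top h.1

lemma nk_ne_top {x : F} (hx : x ≠ 0) : nk x ≠ ∞ := by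
  rw [nk_real hx]; exact ENNReal.ofReal_ne_top

/-- bound for truncated energies -/
lemma energy_trunc (hM : 3 ≤ Module.finrank ℝ F) {p q : ℝ} (hpq : p.HolderConjugate q)
    {B : ℝ} (hB : 0 < B) (μ : Measure F) [IsFiniteMeasure μ] {X : ℝ}
    (hμ : ∀ (f : F → ℝ≥0∞) (L r R : ℝ), Adm f L r R →
      ∫⁻ x : F, ‖x‖ₑ ^ (((Module.finrank ℝ F : ℝ) - 2) * (q - 1)) * (f x) ^ q ≤ ENNReal.ofReal B →
        ∫⁻ x, np f x ∂μ ≤ ENNReal.ofReal X) (hX : 0 ≤ X) (n : ℕ) :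
    ∫⁻ x : F, {x : F | 1 / ((n:ℝ) + 1) ≤ ‖x‖ ∧ ‖x‖ ≤ n + 1}.indicator
      (fun x => nk x * (min (∫⁻ y, nk (x - y) ∂μ) n) ^ p) x ≤ ENNReal.ofReal (X ^ p * B ^ (1 - p)) := by
  have hp := hpq.lt
  have hq := hpq.symm.lt
  set A : Set F := {x : F | 1 / ((n:ℝ) + 1) ≤ ‖x‖ ∧ ‖x‖ ≤ n + 1} with hA
  have hAm : MeasurableSet A :=
    (measurableSet_le measurable_const measurable_norm).inter
      (measurableSet_le measurable_norm measurable_const)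
  set ψ : F → ℝ≥0∞ := fun x => ∫⁻ y, nk (x - y) ∂μ with hψ
  have hψm : Measurable ψ := psi_meas μ
  have hn : (0:ℝ) < 1 / ((n:ℝ) + 1) := by positivity
  have hA0 : ∀ x ∈ A, x ≠ 0 := fun x hx h => by
    have := hx.1; rw [h, norm_zero] at this; linarith
  have hmin : ∀ x, min (ψ x) n ≠ ∞ := fun x => ne_top_of_le_ne_top (ENNReal.natCast_ne_top n) (min_le_right _ _)
  set Lk : ℝ := (1 / ((n:ℝ) + 1)) ^ (-((Module.finrank ℝ F : ℝ) - 2)) with hLk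
  have hLk0 : 0 ≤ Lk := by positivity
  set I := ∫⁻ x, A.indicator (fun x => nk x * (min (ψ x) n) ^ p) x with hI
  have hIfin : I ≠ ∞ := by
    have : I ≤ ∫⁻ x in Metric.closedBall (0:F) (n + 1), ENNReal.ofReal Lk * (n:ℝ≥0∞) ^ p := by
      rw [← lintegral_indicator Metric.isClosed_closedBall.measurableSet]
      refine lintegral_mono fun x => ?_
      by_cases hx : x ∈ A
      · rw [indicator_of_mem hx, indicator_of_mem (by simpa using hx.2)]
        exact mul_le_mul' (Adm.nk_out hM hn hx.1)
          (ENNReal.rpow_le_rpow (min_le_right _ _) (by linarith))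
      · rw [indicator_of_notMem hx]; exact zero_le
    refine ne_top_of_le_ne_top ?_ this
    rw [setLIntegral_const]
    refine ENNReal.mul_ne_top (ENNReal.mul_ne_top ENNReal.ofReal_ne_top
      (ENNReal.rpow_ne_top_of_nonneg (by linarith) (ENNReal.natCast_ne_top n)))
      (isCompact_closedBall _ _).measure_lt_top.ne
  by_cases hI0 : I = 0
  · rw [hI0]; exact zero_le
  set y := I.toReal with hy
  have hy0 : 0 < y := ENNReal.toReal_pos hI0 hIfin
  have hIy : I = ENNReal.ofReal y := (ENNReal.ofReal_toReal hIfin).symm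
  rw [hIy]
  refine ENNReal.ofReal_le_ofReal (scal_dual hpq hy0 hB ?_)
  set c := (B / y) ^ (1 / q) with hc
  have hc0 : 0 < c := by positivity
  set f : F → ℝ≥0∞ := A.indicator (fun x => ENNReal.ofReal c * ((min (ψ x) n) ^ (p - 1) * nk x)) with hf
  have hfm : Measurable f :=
    ((((hψm.min measurable_const).pow_const _).mul nk_meas).const_mul _).indicator hAm
  have hadm : Adm f (c * ((n:ℝ) ^ (p - 1) * Lk)) (1 / ((n:ℝ) + 1)) (n + 1) := by
    refine ⟨hfm, by positivity, hn, fun x => ?_, fun x hx => ?_, fun x hx => ?_⟩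
    · by_cases hx : x ∈ A
      · rw [hf, indicator_of_mem hx, ENNReal.ofReal_mul hc0.le, ENNReal.ofReal_mul (by positivity),
          ← ENNReal.ofReal_rpow_of_nonneg (Nat.cast_nonneg n) (by linarith), ENNReal.ofReal_natCast]
        refine mul_le_mul_right (mul_le_mul' ?_ (Adm.nk_out hM hn hx.1)) _
        exact ENNReal.rpow_le_rpow (min_le_right _ _) (by linarith)
      · rw [hf, indicator_of_notMem hx]; exact zero_le
    · exact indicator_of_notMem (fun h => absurd h.1 (not_le.2 hx)) _
    · exact indicator_of_notMem (fun h => absurd h.2 (not_le.2 hx)) _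
  have hIm : Measurable (A.indicator (fun x => nk x * (min (ψ x) n) ^ p)) :=
    (nk_meas.mul ((hψm.min measurable_const).pow_const _)).indicator hAm
  have hJ : ∫⁻ x : F, ‖x‖ₑ ^ (((Module.finrank ℝ F : ℝ) - 2) * (q - 1)) * (f x) ^ q ≤ ENNReal.ofReal B := by
    have e : ∀ x : F, ‖x‖ₑ ^ (((Module.finrank ℝ F : ℝ) - 2) * (q - 1)) * (f x) ^ q =
        ENNReal.ofReal c ^ q * A.indicator (fun x => nk x * (min (ψ x) n) ^ p) x := by
      intro x
      by_cases hx : x ∈ A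
      · have hx0 := hA0 x hx
        have e1 : ‖x‖ₑ ≠ 0 := by simpa using hx0
        have e2 : ‖x‖ₑ ≠ ∞ := enorm_ne_top
        have e3 : (p - 1) * q = p := by have := hpq.sub_one_mul_conj; linarith
        rw [hf, indicator_of_mem hx, indicator_of_mem hx, ENNReal.mul_rpow_of_nonneg _ _ (by linarith),
          ENNReal.mul_rpow_of_nonneg _ _ (by linarith), ← ENNReal.rpow_mul, e3]
        have e4 : ‖x‖ₑ ^ (((Module.finrank ℝ F : ℝ) - 2) * (q - 1)) * nk x ^ q = nk x := by
          unfold nk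
          rw [← ENNReal.rpow_mul, ← ENNReal.rpow_add _ _ e1 e2]
          congr 1; ring
        calc _ = ENNReal.ofReal c ^ q * ((‖x‖ₑ ^ (((Module.finrank ℝ F : ℝ) - 2) * (q - 1)) * nk x ^ q) *
              (min (ψ x) n) ^ p) := by ring
          _ = _ := by rw [e4]
      · rw [hf, indicator_of_notMem hx, indicator_of_notMem hx, ENNReal.zero_rpow_of_pos (by linarith)]
        simp
    simp_rw [e]
    rw [lintegral_const_mul _ hIm, ← hI, hIy, ENNReal.ofReal_rpow_of_pos hc0,
      ← ENNReal.ofReal_mul (by positivity)]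
    refine ENNReal.ofReal_le_ofReal (le_of_eq ?_)
    rw [hc, ← Real.rpow_mul (by positivity), one_div, inv_mul_cancel₀ (by linarith), Real.rpow_one]
    field_simp
  have h1 := hμ f _ _ _ hadm hJ
  rw [np_tonelli μ hfm] at h1
  have h2 : ENNReal.ofReal (c * y) ≤ ENNReal.ofReal X := by
    refine le_trans ?_ h1
    rw [ENNReal.ofReal_mul hc0.le, ← hIy, hI, ← lintegral_const_mul _ hIm]
    refine lintegral_mono fun x => ?_
    by_cases hx : x ∈ A
    · rw [hf, indicator_of_mem hx, indicator_of_mem hx]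
      show _ ≤ ENNReal.ofReal c * (min (ψ x) n ^ (p - 1) * nk x) * ψ x
      calc ENNReal.ofReal c * (nk x * min (ψ x) n ^ p) 
          = ENNReal.ofReal c * (min (ψ x) n ^ (p - 1) * nk x) * min (ψ x) n := by
            have : min (ψ x) n ^ p = min (ψ x) n ^ (p - 1) * min (ψ x) n := by
              conv_lhs => rw [show p = (p - 1) + 1 by ring]
              rw [ENNReal.rpow_add_of_nonneg _ _ (by linarith) zero_le_one, ENNReal.rpow_one]
            rw [this]; ring
        _ ≤ _ := mul_le_mul_right (min_le_left _ _) _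
    · rw [indicator_of_notMem hx]; simp
  exact (ENNReal.ofReal_le_ofReal_iff hX).1 h2

lemma energy_full (hM : 3 ≤ Module.finrank ℝ F) {p q : ℝ} (hpq : p.HolderConjugate q)
    {B : ℝ} (hB : 0 < B) (μ : Measure F) [IsFiniteMeasure μ] {X : ℝ}
    (hμ : ∀ (f : F → ℝ≥0∞) (L r R : ℝ), Adm f L r R →
      ∫⁻ x : F, ‖x‖ₑ ^ (((Module.finrank ℝ F : ℝ) - 2) * (q - 1)) * (f x) ^ q ≤ ENNReal.ofReal B →
        ∫⁻ x, np f x ∂μ ≤ ENNReal.ofReal X) (hX : 0 ≤ X) :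
    ∫⁻ x : F, nk x * (∫⁻ y, nk (x - y) ∂μ) ^ p ≤ ENNReal.ofReal (X ^ p * B ^ (1 - p)) := by
  have hp := hpq.lt
  have hψm := psi_meas μ
  have hmeas : ∀ n : ℕ, Measurable ({x : F | 1 / ((n:ℝ) + 1) ≤ ‖x‖ ∧ ‖x‖ ≤ n + 1}.indicator
      (fun x => nk x * (min (∫⁻ y, nk (x - y) ∂μ) n) ^ p)) := fun n =>
    (nk_meas.mul ((hψm.min measurable_const).pow_const _)).indicator
      ((measurableSet_le measurable_const measurable_norm).inter
      (measurableSet_le measurable_norm measurable_const))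
  have h1 := lintegral_liminf_le (μ := volume) (u := atTop) hmeas
  have h2 : (liminf (fun n : ℕ => ∫⁻ x : F, {x : F | 1 / ((n:ℝ) + 1) ≤ ‖x‖ ∧ ‖x‖ ≤ n + 1}.indicator
      (fun x => nk x * (min (∫⁻ y, nk (x - y) ∂μ) n) ^ p) x) atTop) ≤
      ENNReal.ofReal (X ^ p * B ^ (1 - p)) := by
    refine (liminf_le_liminf (Eventually.of_forall fun n => energy_trunc hM hpq hB μ hμ hX n)).trans ?_
    simp
  refine le_trans (le_of_eq ?_) (h1.trans h2)
  refine lintegral_congr_ae ?_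
  filter_upwards [ae_ne_zero (F := F) (by omega)] with x hx
  refine (Tendsto.liminf_eq ?_).symm
  have hx' := norm_pos_iff.2 hx
  have ev : ∀ᶠ n : ℕ in atTop, x ∈ {x : F | 1 / ((n:ℝ) + 1) ≤ ‖x‖ ∧ ‖x‖ ≤ n + 1} := by
    have e1 : ∀ᶠ n : ℕ in atTop, 1 / ((n:ℝ) + 1) < ‖x‖ :=
      (tendsto_one_div_add_atTop_nhds_zero_nat (𝕜 := ℝ)).eventually (gt_mem_nhds hx')
    have e2 : ∀ᶠ n : ℕ in atTop, ‖x‖ ≤ n := tendsto_natCast_atTop_atTop.eventually_ge_atTop _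
    filter_upwards [e1, e2] with n h1 h2
    exact ⟨h1.le, by linarith⟩
  have t1 : Tendsto (fun n : ℕ => nk x * (min (∫⁻ y, nk (x - y) ∂μ) (n:ℝ≥0∞)) ^ p) atTop
      (𝓝 (nk x * (∫⁻ y, nk (x - y) ∂μ) ^ p)) := by
    refine ENNReal.Tendsto.const_mul ?_ (Or.inr (nk_ne_top hx))
    refine Tendsto.ennrpow_const _ ?_
    have : Tendsto (fun n : ℕ => min (∫⁻ y, nk (x - y) ∂μ) (n:ℝ≥0∞)) atTop
        (𝓝 (min (∫⁻ y, nk (x - y) ∂μ) ∞)) :=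
      tendsto_const_nhds.min ENNReal.tendsto_nat_nhds_top
    simpa using this
  refine t1.congr' ?_
  filter_upwards [ev] with n hn
  symm
  apply indicator_of_mem
  exact hn

end dualb

open Set MeasureTheory Filter Topology

set_option linter.unusedSectionVars false

section core
open scoped ENNReal
open scoped Laplacian

variable {F : Type*} [NormedAddCommGroup F] [InnerProductSpace ℝ F] [FiniteDimensional ℝ F]
  [MeasurableSpace F] [BorelSpace F]

lemma core_bound (hM : 4 ≤ Module.finrank ℝ F) {p q : ℝ} (hpq : p.HolderConjugate q) 
    (hMq : 2 * q < Module.finrank ℝ F) :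
    ∃ C : ℝ, 0 < C ∧ ∀ (D : Set F) (v : F → ℝ) (w : ℝ → F → ℝ) (Wst : ℝ), IsOpen D → 0 ∈ D → 
      ContDiffOn ℝ 2 v D → (∀ x ∈ D, 0 < v x) → (∀ x ∈ D, Δ v x = v x ^ p) → 
      (∀ m > 0, Continuous (w m)) → (∀ m > 0, ContDiffOn ℝ 2 (w m) D) → 
      (∀ m > 0, ∀ x ∈ D, Δ (w m) x = (w m x) ^ p) → (∀ m > 0, ∀ x, x ∉ D → w m x = m) → 
      (∀ m > 0, ∀ x, 0 ≤ w m x) → (∀ m > 0, ∀ x, w m x ≤ m) → (∀ x ∈ D, 0 < w 1 x) → 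
      (∀ m > 0, w m 0 ≤ Wst) → v 0 ≤ C * Wst + C := by
  have hM3 : 3 ≤ Module.finrank ℝ F := by omega
  have hp := hpq.lt
  have hq := hpq.symm.lt
  obtain ⟨C0, hC0, hT⟩ := test_bound (F := F) hM hpq hMq
  have hc := cM_pos (F := F) hM3
  set θ : ℝ := (cM F / 2) ^ (1 / (p - 1)) with hθ
  have hθ0 : 0 < θ := by positivity
  have hθp : θ ^ p = θ * (cM F / 2) := by
    have e : θ ^ (p - 1) = cM F / 2 := by
      rw [hθ, ← Real.rpow_mul (by positivity), one_div, inv_mul_cancel₀ (by linarith), Real.rpow_one]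
    rw [← e, mul_comm, ← Real.rpow_add_one hθ0.ne']; congr 1; ring
  refine ⟨C0 * (2 / θ) + 2 * C0, by positivity, ?_⟩
  intro D v w Wst hD h0 hv2 hv0 hvl hwc hw2 hwl hwb hw0 hwm hw1 hW
  have hW0 : 0 ≤ Wst := (hw0 1 one_pos 0).trans (hW 1 one_pos)
  set B : ℝ := 2 * Wst / θ + 1 with hB
  have hB0 : 0 < B := by positivity
  have hE : IsCompact (Dᶜ ∩ Metric.closedBall (0:F) 2) :=
    (isCompact_closedBall _ _).inter_left hD.isClosed_compl
  set E := Dᶜ ∩ Metric.closedBall (0:F) 2 with hEdef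
  have hE0 : (0:F) ∉ E := fun h => h.1 h0
  rcases dual_meas hM3 hq.le (meas_pw (F := F) (((Module.finrank ℝ F : ℝ) - 2) * (q - 1))) hE hE0 B
    with ⟨f, L, r, R, hA, hJ, hlt⟩ | ⟨μ, hμf, hμ0, hμE, hμ⟩
  · have := hT f L r R hA B hB0.le hJ D v hD h0 hv2 hv0 hvl
      (fun x hx hx2 => hlt x ⟨hx, by simpa using hx2⟩)
    have e : C0 * (B + 1) = C0 * (2 / θ) * Wst + 2 * C0 := by rw [hB]; ring
    rw [e] at this
    have : 0 ≤ C0 * (2 / θ) := by positivity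
    have := mul_nonneg (mul_nonneg zero_le_two hC0.le) hW0
    linarith
  · exfalso
    have hae : ∀ᵐ y ∂μ, y ∈ E := by rw [ae_iff]; exact hμE
    obtain ⟨s, hs, hsE⟩ : ∃ s : ℝ, 0 < s ∧ ∀ y ∈ E, s ≤ ‖y‖ := by
      have : Eᶜ ∈ 𝓝 (0:F) := hE.isClosed.isOpen_compl.mem_nhds hE0
      obtain ⟨s, hs, hsb⟩ := Metric.mem_nhds_iff.1 this
      exact ⟨s, hs, fun y hy => not_lt.1 fun h => hsb (by simpa using h) hy⟩
    have hXfin : ∫⁻ y, nk y ∂μ ≠ ∞ := by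
      have : ∫⁻ y, nk y ∂μ ≤ ∫⁻ y, ENNReal.ofReal (s ^ (-((Module.finrank ℝ F : ℝ) - 2))) ∂μ := by
        refine lintegral_mono_ae ?_
        filter_upwards [hae] with y hy using Adm.nk_out hM3 hs (hsE y hy)
      refine ne_top_of_le_ne_top ?_ this
      rw [lintegral_const]
      exact ENNReal.mul_ne_top ENNReal.ofReal_ne_top (measure_ne_top _ _)
    have hX0 : ∫⁻ y, nk y ∂μ ≠ 0 := by
      rw [Ne, lintegral_eq_zero_iff nk_meas]
      intro h
      apply hμ0
      rw [← Measure.measure_univ_eq_zero, ← compl_empty, ← mem_ae_iff]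
      filter_upwards [h] with y hy
      exact nk_ne_zero hM3 y hy
    set X := (∫⁻ y, nk y ∂μ).toReal with hX
    have hXp : 0 < X := ENNReal.toReal_pos hX0 hXfin
    have hXe : ∫⁻ y, nk y ∂μ = ENNReal.ofReal X := (ENNReal.ofReal_toReal hXfin).symm
    have hY := energy_full hM3 hpq hB0 μ (X := X) (fun f L r R hA hJ => hXe ▸ hμ f L r R hA hJ) hXp.le
    set t := θ * B / X with ht
    have ht0 : 0 < t := by positivity
    have : IsFiniteMeasure (ENNReal.ofReal t • μ) :=
      Measure.smul_finite _ ENNReal.ofReal_ne_top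
    have h := compare hM hp hD h0 hE (fun x hx => hx.1) hwc hw2 hwl hwb hw0 hwm hw1 hW
      (ENNReal.ofReal t • μ) (by simp [hμE]) (X := θ * B) (Y := θ ^ p * B) ?_ (by positivity) ?_
    · rw [hθp] at h
      have e : θ * B - θ * (cM F / 2) * B / cM F = Wst + θ / 2 := by
        rw [hB]; field_simp; ring
      rw [e] at h
      linarith
    · rw [lintegral_smul_measure, hXe, smul_eq_mul, ← ENNReal.ofReal_mul ht0.le]
      refine ENNReal.ofReal_le_ofReal (le_of_eq ?_)
      rw [ht]; field_simp
    · have e : ∀ x : F, nk x * (∫⁻ y, nk (x - y) ∂(ENNReal.ofReal t • μ)) ^ p =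
          ENNReal.ofReal t ^ p * (nk x * (∫⁻ y, nk (x - y) ∂μ) ^ p) := by
        intro x
        rw [lintegral_smul_measure, smul_eq_mul, ENNReal.mul_rpow_of_nonneg _ _ (by linarith)]
        ring
      simp_rw [e]
      rw [lintegral_const_mul]
      swap
      · exact nk_meas.mul ((psi_meas μ).pow_const _)
      refine (mul_le_mul_right hY _).trans ?_
      rw [ENNReal.ofReal_rpow_of_pos ht0, ← ENNReal.ofReal_mul (by positivity)]
      refine ENNReal.ofReal_le_ofReal (le_of_eq ?_)
      rw [← mul_assoc, ← Real.mul_rpow ht0.le hXp.le]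
      have e1 : t * X = θ * B := by rw [ht]; field_simp
      rw [e1, Real.mul_rpow hθ0.le hB0.le, mul_assoc, ← Real.rpow_add hB0]
      simp

end core

open Set MeasureTheory Filter Topology

set_option linter.unusedSectionVars false

section lift
open scoped ENNReal
open scoped Laplacian

lemma laplacian_eq_lap {N : ℕ} (u : EuclideanSpace ℝ (Fin N) → ℝ) (x : EuclideanSpace ℝ (Fin N)) :
    laplacian u x = Δ u x := by
  rw [InnerProductSpace.laplacian_eq_iteratedFDeriv_orthonormalBasis u
    (EuclideanSpace.basisFun (Fin N) ℝ)]
  simp [laplacian]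

/-- projection forgetting the last coordinates -/
noncomputable def prj (N j : ℕ) : EuclideanSpace ℝ (Fin N ⊕ Fin j) →L[ℝ] EuclideanSpace ℝ (Fin N) :=
  LinearMap.toContinuousLinearMap
    { toFun := fun z => WithLp.toLp 2 fun i => z (Sum.inl i)
      map_add' := fun x y => by ext i; simp
      map_smul' := fun c x => by ext i; simp }

lemma prj_inl (N j : ℕ) (i : Fin N) :
    prj N j (EuclideanSpace.single (Sum.inl i) 1) = EuclideanSpace.single i 1 := by
  ext k
  simp [prj, Pi.single_apply]

lemma prj_inr (N j : ℕ) (i : Fin j) :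
    prj N j (EuclideanSpace.single (Sum.inr i) 1) = 0 := by
  ext k
  simp [prj]

lemma lap_lift {N j : ℕ} {Ω : Set (EuclideanSpace ℝ (Fin N))} (hΩ : IsOpen Ω)
    {g : EuclideanSpace ℝ (Fin N) → ℝ} (hg : ContDiffOn ℝ 2 g Ω) (ξ : EuclideanSpace ℝ (Fin N))
    {z : EuclideanSpace ℝ (Fin N ⊕ Fin j)} (hz : ξ + prj N j z ∈ Ω) :
    Δ (fun z => g (ξ + prj N j z)) z = Δ g (ξ + prj N j z) := by
  rw [InnerProductSpace.laplacian_eq_iteratedFDeriv_orthonormalBasis _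
    (EuclideanSpace.basisFun (Fin N ⊕ Fin j) ℝ),
    InnerProductSpace.laplacian_eq_iteratedFDeriv_orthonormalBasis g
    (EuclideanSpace.basisFun (Fin N) ℝ)]
  have hs : IsOpen ((fun y => ξ + y) ⁻¹' Ω) := hΩ.preimage (by fun_prop)
  have hs' : IsOpen ((prj N j) ⁻¹' ((fun y => ξ + y) ⁻¹' Ω)) := hs.preimage (prj N j).continuous
  have hgc : ContDiffOn ℝ 2 (fun y => g (ξ + y)) ((fun y => ξ + y) ⁻¹' Ω) :=
    hg.comp (by fun_prop) fun y hy => hy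
  have key := ContinuousLinearMap.iteratedFDerivWithin_comp_right (prj N j) hgc hs.uniqueDiffOn
    hs'.uniqueDiffOn (x := z) hz (i := 2) le_rfl
  rw [iteratedFDerivWithin_of_isOpen 2 hs' hz, iteratedFDerivWithin_of_isOpen 2 hs hz,
    iteratedFDeriv_comp_add_left] at key
  have key' : iteratedFDeriv ℝ 2 (fun z => g (ξ + prj N j z)) z = _ := key
  simp only [key', Fintype.sum_sum_type, EuclideanSpace.basisFun_apply]
  have h2 : ∀ i : Fin j, ((iteratedFDeriv ℝ 2 g (ξ + prj N j z)).compContinuousLinearMap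
      fun _ => prj N j) ![EuclideanSpace.single (Sum.inr i) 1, EuclideanSpace.single (Sum.inr i) 1] = 0 := by
    intro i
    rw [ContinuousMultilinearMap.compContinuousLinearMap_apply]
    exact ContinuousMultilinearMap.map_coord_zero _ 0 (by simp [prj_inr])
  have h1 : ∀ i : Fin N, ((iteratedFDeriv ℝ 2 g (ξ + prj N j z)).compContinuousLinearMap
      fun _ => prj N j) ![EuclideanSpace.single (Sum.inl i) 1, EuclideanSpace.single (Sum.inl i) 1] = 
      iteratedFDeriv ℝ 2 g (ξ + prj N j z) ![EuclideanSpace.single i 1, EuclideanSpace.single i 1] := by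
    intro i
    rw [ContinuousMultilinearMap.compContinuousLinearMap_apply]
    congr 1
    ext k : 1
    fin_cases k <;> simp [prj_inl]
  simp [h1, h2]

lemma omega_bound (N : ℕ) {p : ℝ} (hp : 1 < p) :
    ∃ C : ℝ, 0 < C ∧ ∀ (D : Set (EuclideanSpace ℝ (Fin N))) (v : EuclideanSpace ℝ (Fin N) → ℝ) 
      (w : ℝ → EuclideanSpace ℝ (Fin N) → ℝ), IsOpen D → 
      ContDiffOn ℝ 2 v D → (∀ x ∈ D, 0 < v x) → (∀ x ∈ D, Δ v x = v x ^ p) → 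
      (∀ m > 0, Continuous (w m)) → (∀ m > 0, ContDiffOn ℝ 2 (w m) D) → 
      (∀ m > 0, ∀ x ∈ D, Δ (w m) x = (w m x) ^ p) → (∀ m > 0, ∀ x, x ∉ D → w m x = m) → 
      (∀ m > 0, ∀ x, 0 ≤ w m x) → (∀ m > 0, ∀ x, w m x ≤ m) → (∀ x ∈ D, 0 < w 1 x) → 
      ∀ ξ ∈ D, ∀ Wst : ℝ, (∀ m > 0, w m ξ ≤ Wst) → v ξ ≤ C * Wst + C := by
  have hpq := Real.HolderConjugate.conjExponent hp
  set q := p.conjExponent with hq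
  set j := 4 + ⌈2 * q⌉₊ with hj
  have hfin : Module.finrank ℝ (EuclideanSpace ℝ (Fin N ⊕ Fin j)) = N + j := by
    simp
  obtain ⟨C, hC, h⟩ := core_bound (F := EuclideanSpace ℝ (Fin N ⊕ Fin j)) (by rw [hfin]; omega) hpq
    (by
      rw [hfin, hj]; push_cast
      have := Nat.le_ceil (2 * q)
      have : (0:ℝ) ≤ N := Nat.cast_nonneg N
      linarith)
  refine ⟨C, hC, ?_⟩
  intro D v w hD hv2 hv0 hvl hwc hw2 hwl hwb hw0 hwm hw1 ξ hξ Wst hW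
  have hA : Continuous fun z : EuclideanSpace ℝ (Fin N ⊕ Fin j) => ξ + prj N j z := by fun_prop
  have hA2 : ContDiff ℝ 2 fun z : EuclideanSpace ℝ (Fin N ⊕ Fin j) => ξ + prj N j z := by fun_prop
  have e0 : ξ + prj N j 0 = ξ := by simp
  have := h ((fun z => ξ + prj N j z) ⁻¹' D) (fun z => v (ξ + prj N j z))
    (fun m z => w m (ξ + prj N j z)) Wst (hD.preimage hA) (by simpa using hξ)
    (hv2.comp hA2.contDiffOn fun z hz => hz) (fun z hz => hv0 _ hz)
    (fun z hz => by rw [lap_lift hD hv2 ξ hz]; exact hvl _ hz)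
    (fun m hm => (hwc m hm).comp hA) (fun m hm => (hw2 m hm).comp hA2.contDiffOn fun z hz => hz)
    (fun m hm z hz => by rw [lap_lift hD (hw2 m hm) ξ hz]; exact hwl m hm _ hz)
    (fun m hm z hz => hwb m hm _ hz) (fun m hm z => hw0 m hm _) (fun m hm z => hwm m hm _)
    (fun z hz => hw1 _ hz) (fun m hm => by simpa using hW m hm)
  simpa using this

end lift

open Set MeasureTheory Filter Topology

set_option linter.unusedSectionVars false

section extrap
open scoped Laplacian

variable {F : Type*} [NormedAddCommGroup F] [InnerProductSpace ℝ F] [FiniteDimensional ℝ F]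

lemma comparison {D : Set F} (hDo : IsOpen D) (hDb : Bornology.IsBounded D)
    (hF : 0 < Module.finrank ℝ F) {a b : F → ℝ}
    (hac : ContinuousOn a (closure D)) (hbc : ContinuousOn b (closure D))
    (ha : ContDiffOn ℝ 2 a D) (hb : ContDiffOn ℝ 2 b D)
    (hbd : ∀ x ∈ frontier D, a x ≤ b x) (h : ∀ x ∈ D, b x < a x → Δ b x ≤ Δ a x) :
    ∀ x ∈ D, a x ≤ b x := by
  intro x hx
  have := max_principle hDo hDb hF (z := fun y => a y - b y) (hac.sub hbc) (ha.sub hb)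
    (fun y hy => by linarith [hbd y hy]) (fun y hy hy0 => by
      rw [lap_sub (ha.contDiffAt (hDo.mem_nhds hy)) (hb.contDiffAt (hDo.mem_nhds hy))]
      linarith [h y hy (by linarith)]) x hx
  linarith

/-- the family of solutions with constant boundary values -/
structure Fam (Ω : Set F) (p : ℝ) (w : ℝ → F → ℝ) : Prop where
  c : ∀ m > 0, Continuous (w m)
  d : ∀ m > 0, ContDiffOn ℝ 2 (w m) Ω
  l : ∀ m > 0, ∀ x ∈ Ω, Δ (w m) x = (w m x) ^ p
  b : ∀ m > 0, ∀ x, x ∉ Ω → w m x = m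
  nn : ∀ m > 0, ∀ x, 0 ≤ w m x
  le : ∀ m > 0, ∀ x, w m x ≤ m

variable {Ω : Set F} {p : ℝ} {w : ℝ → F → ℝ}

lemma not_mem_of_frontier (hΩ : IsOpen Ω) {x : F} (hx : x ∈ frontier Ω) : x ∉ Ω := by
  rw [hΩ.frontier_eq] at hx; exact hx.2

lemma Fam.mono (h : Fam Ω p w) (hp : 1 < p) (hΩ : IsOpen Ω) (hb : Bornology.IsBounded Ω)
    (hF : 0 < Module.finrank ℝ F) {m m' : ℝ} (hm : 0 < m) (hmm : m ≤ m') (x : F) :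
    w m x ≤ w m' x := by
  have hm' := hm.trans_le hmm
  by_cases hx : x ∈ Ω
  · refine comparison hΩ hb hF (h.c m hm).continuousOn (h.c m' hm').continuousOn (h.d m hm)
      (h.d m' hm') (fun y hy => ?_) (fun y hy hlt => ?_) x hx
    · have := not_mem_of_frontier hΩ hy
      rwa [h.b m hm y this, h.b m' hm' y this]
    · rw [h.l m hm y hy, h.l m' hm' y hy]
      exact Real.rpow_le_rpow (h.nn m' hm' y) hlt.le (by linarith)
  · rwa [h.b m hm x hx, h.b m' hm' x hx]

lemma scal_c {p K : ℝ} (hp : 1 < p) (hK : 1 ≤ K) :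
    ∃ c : ℝ, 0 < c ∧ c * K ≤ 1 ∧ (c * K) ^ p ≤ c := by
  have hK0 : 0 < K := by linarith
  have hp1 : 0 < p - 1 := by linarith
  refine ⟨K ^ (-(p / (p - 1))), by positivity, ?_, ?_⟩
  · rw [← Real.rpow_add_one hK0.ne']
    refine Real.rpow_le_one_of_one_le_of_nonpos hK ?_
    have : 1 ≤ p / (p - 1) := by rw [le_div_iff₀ hp1]; linarith
    linarith
  · rw [← Real.rpow_add_one hK0.ne', ← Real.rpow_mul hK0.le]
    refine Real.rpow_le_rpow_of_exponent_le hK (le_of_eq ?_)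
    field_simp; ring

lemma Fam.pos (h : Fam Ω p w) (hp : 1 < p) (hΩ : IsOpen Ω) (hb : Bornology.IsBounded Ω)
    (hF : 0 < Module.finrank ℝ F) : ∀ x ∈ Ω, 0 < w 1 x := by
  obtain ⟨R, hR0, hR⟩ := hb.closure.exists_pos_norm_le
  have hF' : (1:ℝ) ≤ Module.finrank ℝ F := by exact_mod_cast hF
  obtain ⟨c, hc, hc1, hc2⟩ := scal_c hp (K := R ^ 2 + 1) (by nlinarith [sq_nonneg R])
  have hcd : ContDiff ℝ 2 fun y : F => c * (‖y‖ ^ 2 + 1) :=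
    contDiff_const.mul ((contDiff_norm_sq ℝ).add contDiff_const)
  have hle : ∀ y ∈ closure Ω, c * (‖y‖ ^ 2 + 1) ≤ c * (R ^ 2 + 1) := fun y hy => by
    have := hR y hy; gcongr
  intro x hx
  have := comparison hΩ hb hF (a := fun y : F => c * (‖y‖ ^ 2 + 1)) (b := w 1)
    hcd.continuous.continuousOn (h.c 1 one_pos).continuousOn hcd.contDiffOn (h.d 1 one_pos)
    (fun y hy => by
      rw [h.b 1 one_pos y (not_mem_of_frontier hΩ hy)]
      exact (hle y (frontier_subset_closure hy)).trans hc1)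
    (fun y hy hlt => by
      rw [h.l 1 one_pos y hy, lap_const_mul (f := fun y : F => ‖y‖ ^ 2 + 1) c
        ((contDiff_norm_sq ℝ).add contDiff_const).contDiffAt,
        lap_add (f := fun y : F => ‖y‖ ^ 2) (g := fun _ => 1) (contDiff_norm_sq ℝ).contDiffAt
          contDiff_const.contDiffAt, lap_normsq, lap_const]
      calc w 1 y ^ p ≤ (c * (R ^ 2 + 1)) ^ p :=
            Real.rpow_le_rpow (h.nn 1 one_pos y) (hlt.le.trans (hle y (subset_closure hy))) (by linarith)
        _ ≤ c := hc2
        _ ≤ _ := by nlinarith) x hx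
  refine lt_of_lt_of_le ?_ this
  positivity

/-- sublevel sets of a large function -/
lemma sublevel {v : F → ℝ} (hΩ : IsOpen Ω) (hvc : ContinuousOn v Ω)
    (hvbd : ∀ M > (0:ℝ), ∃ K, K ⊆ Ω ∧ IsCompact K ∧ ∀ x ∈ Ω \ K, M ≤ v x) {A : ℝ} (hA : 0 < A) :
    IsOpen {x | x ∈ Ω ∧ v x < A} ∧ Bornology.IsBounded {x | x ∈ Ω ∧ v x < A} ∧
      closure {x | x ∈ Ω ∧ v x < A} ⊆ Ω ∧
      ∀ x ∈ frontier {x | x ∈ Ω ∧ v x < A}, x ∈ Ω ∧ A ≤ v x := by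
  obtain ⟨K, hK, hKc, hKv⟩ := hvbd A hA
  have hsub : {x | x ∈ Ω ∧ v x < A} ⊆ K := fun x hx => by
    by_contra hxK
    linarith [hKv x ⟨hx.1, hxK⟩, hx.2]
  have hcl : closure {x | x ∈ Ω ∧ v x < A} ⊆ Ω := (closure_minimal hsub hKc.isClosed).trans hK
  have ho : IsOpen {x | x ∈ Ω ∧ v x < A} := hvc.isOpen_inter_preimage hΩ isOpen_Iio
  refine ⟨ho, hKc.isBounded.subset hsub, hcl, fun x hx => ?_⟩
  have hxΩ := hcl (frontier_subset_closure hx)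
  exact ⟨hxΩ, not_lt.1 fun hlt => not_mem_of_frontier ho hx ⟨hxΩ, hlt⟩⟩

lemma Fam.le_large (h : Fam Ω p w) (hp : 1 < p) (hΩ : IsOpen Ω)
    (hF : 0 < Module.finrank ℝ F) {v : F → ℝ} (hvd : ContDiffOn ℝ 2 v Ω) (hv0 : ∀ x ∈ Ω, 0 < v x)
    (hvl : ∀ x ∈ Ω, Δ v x = v x ^ p)
    (hvbd : ∀ M > (0:ℝ), ∃ K, K ⊆ Ω ∧ IsCompact K ∧ ∀ x ∈ Ω \ K, M ≤ v x) {m : ℝ} (hm : 0 < m) :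
    ∀ x ∈ Ω, w m x ≤ v x := by
  intro x hx
  have hA : 0 < max m (v x + 1) := lt_max_of_lt_left hm
  obtain ⟨h1, h2, h3, h4⟩ := sublevel hΩ hvd.continuousOn hvbd hA
  have hs : {y | y ∈ Ω ∧ v y < max m (v x + 1)} ⊆ Ω := fun y hy => hy.1
  refine comparison h1 h2 hF (h.c m hm).continuousOn (hvd.continuousOn.mono h3)
    ((h.d m hm).mono hs) (hvd.mono hs) (fun y hy => ?_) (fun y hy hlt => ?_) x ⟨hx, ?_⟩
  · exact (h.le m hm y).trans ((le_max_left _ _).trans (h4 y hy).2)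
  · rw [h.l m hm y hy.1, hvl y hy.1]
    exact Real.rpow_le_rpow (hv0 y hy.1).le hlt.le (by linarith)
  · exact lt_of_lt_of_le (by linarith) (le_max_right _ _)

lemma Fam.cover (h : Fam Ω p w) (hp : 1 < p) (hΩ : IsOpen Ω) (hb : Bornology.IsBounded Ω)
    (hF : 0 < Module.finrank ℝ F) {g : F → ℝ} (hg : ContinuousOn g Ω) {K : Set F} (hK : IsCompact K)
    (hKΩ : K ⊆ Ω) (hlt : ∀ y ∈ K, ∃ m > 0, g y < w m y) : ∃ m > 0, ∀ y ∈ K, g y < w m y := by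
  have key := hK.elim_directed_cover (fun k : ℕ => {y | y ∈ Ω ∧ g y - w (k + 1) y < 0})
    (fun k => (hg.sub (h.c (k + 1) (by positivity)).continuousOn).isOpen_inter_preimage hΩ isOpen_Iio)
    (fun y hy => by
      obtain ⟨m, hm, hlt⟩ := hlt y hy
      refine mem_iUnion.2 ⟨⌈m⌉₊, hKΩ hy, ?_⟩
      have := h.mono hp hΩ hb hF hm (m' := ⌈m⌉₊ + 1) (by linarith [Nat.le_ceil m]) y
      linarith)
    (by
      refine (Monotone.directed_le fun i j hij y hy => ⟨hy.1, ?_⟩)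
      have hij' : (i:ℝ) ≤ j := by exact_mod_cast hij
      have := h.mono hp hΩ hb hF (m := i + 1) (m' := j + 1) (by positivity) (by linarith) y
      linarith [hy.2])
  obtain ⟨k, hk⟩ := key
  exact ⟨k + 1, by positivity, fun y hy => by linarith [(hk hy).2]⟩

lemma scal_conv {p a s W V : ℝ} (hp : 1 < p) (ha : 0 < a) (hW : 0 ≤ W) (hV : 0 ≤ V)
    (hs : s = (1 + a) * W - a * V) {n : ℝ} (hn : 0 ≤ n) (hsn : s < n) :
    (1 + a) * W ^ p - a * V ^ p ≤ n ^ p := by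
  -- `W ≤ (n + a V) / (1 + a)`
  have h1 : W ≤ (1 / (1 + a)) * n + (a / (1 + a)) * V := by
    have : (1 / (1 + a)) * n + (a / (1 + a)) * V = (n + a * V) / (1 + a) := by field_simp
    rw [this, le_div_iff₀ (by positivity)]; linarith
  have hcx := (convexOn_rpow hp.le).2
  have h2 := hcx (mem_Ici.2 hn) (mem_Ici.2 hV) (show 0 ≤ 1 / (1 + a) by positivity)
    (show 0 ≤ a / (1 + a) by positivity) (by field_simp)
  simp only [smul_eq_mul] at h2
  have h3 := (Real.rpow_le_rpow hW h1 (by linarith)).trans h2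
  have h4 : (1 + a) * ((1 / (1 + a)) * n ^ p + (a / (1 + a)) * V ^ p) = n ^ p + a * V ^ p := by
    field_simp
  have := mul_le_mul_of_nonneg_left h3 (by positivity : 0 ≤ 1 + a)
  linarith

lemma Fam.extrap (h : Fam Ω p w) (hp : 1 < p) (hΩ : IsOpen Ω) (hb : Bornology.IsBounded Ω)
    (hF : 0 < Module.finrank ℝ F) {v : F → ℝ} (hvd : ContDiffOn ℝ 2 v Ω) (hv0 : ∀ x ∈ Ω, 0 < v x)
    (hvl : ∀ x ∈ Ω, Δ v x = v x ^ p)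
    (hvbd : ∀ M > (0:ℝ), ∃ K, K ⊆ Ω ∧ IsCompact K ∧ ∀ x ∈ Ω \ K, M ≤ v x) {C : ℝ} (hC : 1 ≤ C)
    (hcore : ∀ ξ ∈ Ω, ∀ Wst : ℝ, (∀ m > 0, w m ξ ≤ Wst) → v ξ ≤ C * Wst + C) {x : F} (hx : x ∈ Ω)
    {n : ℝ} (hn : 0 < n) :
    ∃ m > 0, w n x ≤ (1 + 1 / (2 * C)) * w m x - 1 / (2 * C) * v x := by
  have hC0 : 0 < C := by linarith
  set α := 1 / (2 * C) with hα
  have hα0 : 0 < α := by positivity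
  set A : ℝ := max (2 * C * (n + 4)) (v x + 1) with hAdef
  have hA : 0 < A := lt_max_of_lt_left (by positivity)
  have hA1 : 2 * C * (n + 4) ≤ A := le_max_left _ _
  obtain ⟨h1, h2, h3, h4⟩ := sublevel hΩ hvd.continuousOn hvbd hA
  set D := {y | y ∈ Ω ∧ v y < A} with hD
  have hs : D ⊆ Ω := fun y hy => hy.1
  have hfr : IsCompact (frontier D) :=
    (Metric.isCompact_of_isClosed_isBounded isClosed_closure h2.closure).of_isClosed_subset
      isClosed_frontier frontier_subset_closure
  obtain ⟨m, hm, hmw⟩ := h.cover hp hΩ hb hF (g := fun y => (v y - C - 1) / C)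
    ((hvd.continuousOn.sub continuousOn_const).sub continuousOn_const |>.div_const C) hfr
    (fun y hy => (h4 y hy).1) (fun y hy => by
      by_contra hcon
      push Not at hcon
      have := hcore y (h4 y hy).1 _ hcon
      have e : C * ((v y - C - 1) / C) = v y - C - 1 := by field_simp
      linarith)
  refine ⟨m, hm, ?_⟩
  have hwm := h.d m hm
  refine comparison h1 h2 hF (a := w n) (b := fun y => (1 + α) * w m y - α * v y)
    (h.c n hn).continuousOn ?_ ((h.d n hn).mono hs) ?_ (fun y hy => ?_) (fun y hy hlt => ?_) x ⟨hx, ?_⟩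
  · exact (continuousOn_const.mul (h.c m hm).continuousOn).sub
      (continuousOn_const.mul (hvd.continuousOn.mono h3))
  · exact (contDiffOn_const.mul (hwm.mono hs)).sub (contDiffOn_const.mul (hvd.mono hs))
  · refine (h.le n hn y).trans ?_
    have e1 := hmw y hy
    have e2 := (h4 y hy).2
    have e3 : v y = A ∨ True := Or.inr trivial
    rw [div_lt_iff₀ hC0] at e1
    have e4 : (1 + α) * (v y - C - 1) ≤ (1 + α) * (w m y * C) := by gcongr
    have e5 : α * (2 * C) = 1 := by rw [hα]; field_simp
    have e6 : α ≤ 1 := by rw [hα, div_le_one (by positivity)]; linarith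
    have e7 : C * ((1 + α) * w m y - α * v y) ≥ (1 + α) * (v y - C - 1) - v y / 2 := by
      nlinarith
    have e8 : (1 + α) * (v y - C - 1) - v y / 2 ≥ C * n := by
      nlinarith [mul_nonneg hα0.le (hA.le.trans e2)]
    have e9 : C * n ≤ C * ((1 + α) * w m y - α * v y) := e8.le.trans e7
    exact le_of_mul_le_mul_left e9 hC0
  · have d1 := hwm.contDiffAt (hΩ.mem_nhds hy.1)
    have d2 := hvd.contDiffAt (hΩ.mem_nhds hy.1)
    rw [lap_sub (f := fun y => (1 + α) * w m y) (g := fun y => α * v y) (contDiffAt_const.mul d1)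
      (contDiffAt_const.mul d2), lap_const_mul _ d1, lap_const_mul _ d2, h.l m hm y hy.1,
      h.l n hn y hy.1, hvl y hy.1]
    exact scal_conv hp hα0 (h.nn m hm y) (hv0 y hy.1).le rfl (h.nn n hn y) hlt
  · exact lt_of_lt_of_le (by linarith) (le_max_right _ _)

lemma Fam.approx (h : Fam Ω p w) (hp : 1 < p) (hΩ : IsOpen Ω) (hb : Bornology.IsBounded Ω)
    (hF : 0 < Module.finrank ℝ F) {v : F → ℝ} (hvd : ContDiffOn ℝ 2 v Ω) (hv0 : ∀ x ∈ Ω, 0 < v x)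
    (hvl : ∀ x ∈ Ω, Δ v x = v x ^ p)
    (hvbd : ∀ M > (0:ℝ), ∃ K, K ⊆ Ω ∧ IsCompact K ∧ ∀ x ∈ Ω \ K, M ≤ v x) {C : ℝ} (hC : 1 ≤ C)
    (hcore : ∀ ξ ∈ Ω, ∀ Wst : ℝ, (∀ m > 0, w m ξ ≤ Wst) → v ξ ≤ C * Wst + C) {x : F} (hx : x ∈ Ω)
    {ε : ℝ} (hε : 0 < ε) : ∃ m > 0, v x - ε < w m x := by
  have hC0 : 0 < C := by linarith
  set S : Set ℝ := (fun m => w m x) '' Ioi 0 with hS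
  have hne : S.Nonempty := ⟨w 1 x, 1, mem_Ioi.2 one_pos, rfl⟩
  have hbd : BddAbove S := ⟨v x, by
    rintro _ ⟨m, hm, rfl⟩
    exact h.le_large hp hΩ hF hvd hv0 hvl hvbd hm x hx⟩
  have h1 : sSup S ≤ (1 + 1 / (2 * C)) * sSup S - 1 / (2 * C) * v x := by
    refine csSup_le hne ?_
    rintro _ ⟨n, hn, rfl⟩
    obtain ⟨m, hm, hle⟩ := h.extrap hp hΩ hb hF hvd hv0 hvl hvbd hC hcore hx hn
    have : w m x ≤ sSup S := le_csSup hbd ⟨m, hm, rfl⟩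
    refine hle.trans ?_
    have : (1 + 1 / (2 * C)) * w m x ≤ (1 + 1 / (2 * C)) * sSup S := by gcongr
    linarith
  have h2 : v x ≤ sSup S := by
    have : 0 < 1 / (2 * C) := by positivity
    refine le_of_mul_le_mul_left ?_ this
    linarith
  obtain ⟨_, ⟨m, hm, rfl⟩, hlt⟩ := exists_lt_of_lt_csSup hne (show v x - ε < sSup S by linarith)
  exact ⟨m, hm, hlt⟩

end extrap

open Set MeasureTheory Filter Topology

set_option linter.unusedSectionVars false

section final
open scoped Laplacian

variable {N : ℕ}

/-- the rescaled solutions, extended by their boundary value -/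
noncomputable def wfam (Ω : Set (EuclideanSpace ℝ (Fin N))) (t₀ p : ℝ)
    (u : ℝ → EuclideanSpace ℝ (Fin N) → ℝ) (m : ℝ) (x : EuclideanSpace ℝ (Fin N)) : ℝ :=
  open Classical in
  if x ∈ Ω then (m / (-t₀)) * (u (-(m / (-t₀)) ^ (p - 1)) x - t₀) else m

lemma wfam_fam (hN : 2 ≤ N) (Ω : Set (EuclideanSpace ℝ (Fin N)))
    (hΩo : IsOpen Ω) (hΩb : Bornology.IsBounded Ω)
    (t₀ : ℝ) (ht₀ : t₀ < 0) (p : ℝ) (hp : 1 < p)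
    (u : ℝ → EuclideanSpace ℝ (Fin N) → ℝ)
    (hu : ∀ lam < (0:ℝ),
      IsClassicalSolution Ω lam (fun t => (max (t - t₀) 0) ^ p) (u lam)) :
    Fam Ω p (wfam Ω t₀ p u) := by
  classical
  have hF : 0 < Module.finrank ℝ (EuclideanSpace ℝ (Fin N)) := by
    rw [finrank_euclideanSpace]; simp; omega
  have key : ∀ m > 0, Continuous (wfam Ω t₀ p u m) ∧ ContDiffOn ℝ 2 (wfam Ω t₀ p u m) Ω ∧
      (∀ x ∈ Ω, Δ (wfam Ω t₀ p u m) x = (max (wfam Ω t₀ p u m x) 0) ^ p) := by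
    intro m hm
    have ht : 0 < -t₀ := by linarith
    obtain ⟨s, hs⟩ : ∃ s, s = m / (-t₀) := ⟨_, rfl⟩
    have hs0 : 0 < s := by rw [hs]; positivity
    have hpos : 0 < s ^ (p - 1) := by positivity
    obtain ⟨h1, h2, h3, h4⟩ := hu (-s ^ (p - 1)) (by linarith)
    have hsm : s * (0 - t₀) = m := by rw [hs, zero_sub, div_mul_cancel₀ _ ht.ne']
    have heq : wfam Ω t₀ p u m = fun x => if x ∈ Ω then s * (u (-s ^ (p - 1)) x - t₀) else m := by
      funext x; simp only [wfam, hs]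
    have hd : ContDiffOn ℝ 2 (fun x => s * (u (-s ^ (p - 1)) x - t₀)) Ω :=
      contDiffOn_const.mul (h2.sub contDiffOn_const)
    have hon : ∀ x ∈ Ω, wfam Ω t₀ p u m x = s * (u (-s ^ (p - 1)) x - t₀) := fun x hx => by
      rw [heq]; simp only [if_pos hx]
    refine ⟨?_, hd.congr hon, fun x hx => ?_⟩
    · rw [heq]
      refine continuous_if (p := fun x => x ∈ Ω) (fun x hx => ?_) ?_ continuousOn_const
      · have hx' : x ∈ frontier Ω := hx
        rw [h4 x hx', hsm]
      · exact continuousOn_const.mul (h1.sub continuousOn_const)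
    · have hev : wfam Ω t₀ p u m =ᶠ[𝓝 x] fun x => s * (u (-s ^ (p - 1)) x - t₀) :=
        Filter.eventually_of_mem (hΩo.mem_nhds hx) hon
      have hux := h2.contDiffAt (hΩo.mem_nhds hx)
      rw [(InnerProductSpace.laplacian_congr_nhds hev).eq_of_nhds, hon x hx,
        lap_const_mul (f := fun x => u (-s ^ (p - 1)) x - t₀) s (hux.sub contDiffAt_const),
        lap_sub hux contDiffAt_const, lap_const]
      have h5 := h3 x hx
      rw [laplacian_eq_lap] at h5
      have h6 : Δ (u (-s ^ (p - 1))) x = s ^ (p - 1) * (max (u (-s ^ (p - 1)) x - t₀) 0) ^ p := by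
        simp only at h5
        linarith
      have h7 : max (s * (u (-s ^ (p - 1)) x - t₀)) 0 = s * max (u (-s ^ (p - 1)) x - t₀) 0 := by
        rw [mul_max_of_nonneg _ _ hs0.le, mul_zero]
      rw [h6, h7, Real.mul_rpow hs0.le (le_max_right _ _), sub_zero, ← mul_assoc]
      congr 1
      rw [mul_comm, ← Real.rpow_add_one hs0.ne']
      congr 1; ring
  have hb : ∀ m > 0, ∀ x, x ∉ Ω → wfam Ω t₀ p u m x = m := fun m _ x hx => by
    simp only [wfam, if_neg hx]
  have hnn : ∀ m > 0, ∀ x, 0 ≤ wfam Ω t₀ p u m x := fun m hm x => by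
    by_cases hx : x ∈ Ω
    · obtain ⟨k1, k2, k3⟩ := key m hm
      refine comparison hΩo hΩb hF (a := fun _ => 0) continuousOn_const k1.continuousOn
        contDiffOn_const k2 (fun y hy => ?_) (fun y hy hlt => ?_) x hx
      · rw [hb m hm y (not_mem_of_frontier hΩo hy)]; exact hm.le
      · rw [k3 y hy, lap_const, max_eq_right hlt.le, Real.zero_rpow (by linarith)]
    · rw [hb m hm x hx]; exact hm.le
  refine ⟨fun m hm => (key m hm).1, fun m hm => (key m hm).2.1, fun m hm x hx => ?_, hb, hnn,
    fun m hm x => ?_⟩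
  · rw [(key m hm).2.2 x hx, max_eq_left (hnn m hm x)]
  · by_cases hx : x ∈ Ω
    · obtain ⟨k1, k2, k3⟩ := key m hm
      refine comparison hΩo hΩb hF (b := fun _ => m) k1.continuousOn continuousOn_const k2
        contDiffOn_const (fun y hy => ?_) (fun y hy hlt => ?_) x hx
      · rw [hb m hm y (not_mem_of_frontier hΩo hy)]
      · rw [k3 y hy, lap_const]
        exact Real.rpow_nonneg (le_max_right _ _) _
    · rw [hb m hm x hx]

end final

/-- Corollary 1.4(i): for `f(t) = ((t - t₀)⁺)^p` with `p > 1`, the rescaled solutions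
`(-λ)^{1/(p-1)} (u_λ - t₀)` converge, locally uniformly in `Ω`, to the large solution
`v` of `Δ v = v^p` in `Ω`. -/
theorem stmt_9 {N : ℕ} (hN : 2 ≤ N) (Ω : Set (EuclideanSpace ℝ (Fin N)))
    (hΩo : IsOpen Ω) (hΩb : Bornology.IsBounded Ω) (hΩne : Ω.Nonempty)
    (t₀ : ℝ) (ht₀ : t₀ < 0) (p : ℝ) (hp : 1 < p)
    (u : ℝ → EuclideanSpace ℝ (Fin N) → ℝ)
    (hu : ∀ lam < (0:ℝ),
      IsClassicalSolution Ω lam (fun t => (max (t - t₀) 0) ^ p) (u lam))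
    (v : EuclideanSpace ℝ (Fin N) → ℝ)
    (hvd : ContDiffOn ℝ 2 v Ω) (hvpos : ∀ x ∈ Ω, 0 < v x)
    (hveq : ∀ x ∈ Ω, laplacian v x = v x ^ p)
    (hvbd : ∀ M > (0:ℝ), ∃ K, K ⊆ Ω ∧ IsCompact K ∧ ∀ x ∈ Ω \ K, M ≤ v x) :
    ∀ K ⊆ Ω, IsCompact K →
      TendstoUniformlyOn (fun lam x => (-lam) ^ (1/(p-1)) * (u lam x - t₀)) v atBot K := by
  intro K hKΩ hK
  have hF : 0 < Module.finrank ℝ (EuclideanSpace ℝ (Fin N)) := by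
    rw [finrank_euclideanSpace]; simp; omega
  have hfam := wfam_fam hN Ω hΩo hΩb t₀ ht₀ p hp u hu
  have hvl : ∀ x ∈ Ω, Laplacian.laplacian v x = v x ^ p := fun x hx => by
    rw [← laplacian_eq_lap]; exact hveq x hx
  obtain ⟨C, hC0, hC⟩ := omega_bound N hp
  have hcore : ∀ ξ ∈ Ω, ∀ Wst : ℝ, (∀ m > 0, wfam Ω t₀ p u m ξ ≤ Wst) →
      v ξ ≤ max C 1 * Wst + max C 1 := by
    intro ξ hξ Wst hW
    have h0 : 0 ≤ Wst := (hfam.nn 1 one_pos ξ).trans (hW 1 one_pos)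
    refine (hC Ω v (wfam Ω t₀ p u) hΩo hvd hvpos hvl hfam.c hfam.d hfam.l hfam.b hfam.nn hfam.le
      (hfam.pos hp hΩo hΩb hF) ξ hξ Wst hW).trans ?_
    gcongr <;> exact le_max_left _ _
  rw [Metric.tendstoUniformlyOn_iff]
  intro ε hε
  obtain ⟨m₀, hm₀, hlow⟩ := hfam.cover hp hΩo hΩb hF (g := fun y => v y - ε)
    (hvd.continuousOn.sub continuousOn_const) hK hKΩ (fun y hy =>
      hfam.approx hp hΩo hΩb hF hvd hvpos hvl hvbd (le_max_right C 1) hcore (hKΩ hy) hε)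
  have ht : 0 < -t₀ := by linarith
  have hp1 : 0 < p - 1 := by linarith
  filter_upwards [eventually_lt_atBot (0:ℝ), eventually_le_atBot (-(m₀ / (-t₀)) ^ (p - 1))]
    with lam hl0 hl x hx
  obtain ⟨s, hs⟩ : ∃ s, s = (-lam) ^ (1 / (p - 1)) := ⟨_, rfl⟩
  have hl0' : 0 < -lam := by linarith
  have hs0 : 0 < s := by rw [hs]; positivity
  have hsl : s ^ (p - 1) = -lam := by
    rw [hs, ← Real.rpow_mul hl0'.le, one_div_mul_cancel hp1.ne', Real.rpow_one]
  have hms : s * (-t₀) / (-t₀) = s := mul_div_cancel_right₀ _ ht.ne'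
  have hw : wfam Ω t₀ p u (s * (-t₀)) x = s * (u lam x - t₀) := by
    simp only [wfam, if_pos (hKΩ hx), hms, hsl, neg_neg]
  have hm : m₀ ≤ s * (-t₀) := by
    rw [← div_le_iff₀ ht]
    have : (m₀ / (-t₀)) ^ (p - 1) ≤ s ^ (p - 1) := by rw [hsl]; linarith
    exact (Real.rpow_le_rpow_iff (by positivity) hs0.le hp1).1 this
  have h1 := hfam.mono hp hΩo hΩb hF hm₀ hm x
  have h2 := hfam.le_large hp hΩo hF hvd hvpos hvl hvbd (hm₀.trans_le hm) x (hKΩ hx)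
  have h3 := hlow x hx
  rw [hw] at h1 h2
  rw [← hs, Real.dist_eq, abs_lt]
  constructor <;> linarith
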